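/- Let B₀ = {0, 4, 4i}. The fundamental group π₁(U_{B₀}) of the complement in ℂ² of the curve F_{B₀} = f⁻¹({0, 4, 4i}) is isomorphic to the free group F₃ of rank 3. -/

import Mathlib

open Complex

/-- The polynomial map `f(x,y) = x⁶ + y⁶ + 6xy` on `ℂ²`. -/
noncomputable def f : ℂ × ℂ → ℂ := fun p => p.1 ^ 6 + p.2 ^ 6 + 6 * p.1 * p.2

/-- `U B = ℂ² \ f⁻¹(B)`, the complement of the union of fibers of `f` over `B`. -/
def U (B : Set ℂ) : Set (ℂ × ℂ) := {p | f p ∉ B}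

section
open Set Filter Topology
structure Hol (E : Type*) [TopologicalSpace E] (X : Set E) (G : Type*) [Group G] where
  h : (ℝ → E) → G
  congr' : ∀ γ γ' : ℝ → E, (∀ r ∈ Icc (0:ℝ) 1, γ r = γ' r) → h γ = h γ'
  const' : ∀ x ∈ X, h (fun _ => x) = 1
  sq' : ∀ F : ℝ × ℝ → E, Continuous F → (∀ p, F p ∈ X) →
    h (fun r => F (1, r)) * h (fun r => F (r, 0)) = h (fun r => F (r, 1)) * h (fun r => F (0, r))

namespace Hol
section
variable {E : Type*} [TopologicalSpace E] {X : Set E} {G : Type*} [Group G] (H : Hol E X G)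
variable {V : Type*} [AddCommGroup V] [Module ℝ V]

noncomputable def hs (F : V → E) (a b : V) : G := H.h (fun r => F (a + r • (b - a)))

theorem sqOn (F : ℝ × ℝ → E) (hF : ContinuousOn F (Icc 0 1 ×ˢ Icc 0 1))
    (hX : MapsTo F (Icc 0 1 ×ˢ Icc 0 1) X) :
    H.h (fun r => F (1, r)) * H.h (fun r => F (r, 0)) =
      H.h (fun r => F (r, 1)) * H.h (fun r => F (0, r)) := by
  have hc : Continuous (fun p : ℝ × ℝ => F ((projIcc (0:ℝ) 1 zero_le_one p.1 : ℝ),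
      (projIcc (0:ℝ) 1 zero_le_one p.2 : ℝ))) := by
    apply hF.comp_continuous (by fun_prop)
    intro p; exact ⟨Subtype.coe_prop _, Subtype.coe_prop _⟩
  have := H.sq' _ hc (fun p => hX ⟨Subtype.coe_prop _, Subtype.coe_prop _⟩)
  have e0 : (projIcc (0:ℝ) 1 zero_le_one 0 : ℝ) = 0 := by simp
  have e1 : (projIcc (0:ℝ) 1 zero_le_one 1 : ℝ) = 1 := by simp
  simp only [e0, e1] at this
  have key : ∀ r ∈ Icc (0:ℝ) 1, (projIcc (0:ℝ) 1 zero_le_one r : ℝ) = r := fun r hr => by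
    rw [projIcc_of_mem _ hr]
  convert this using 2 <;> exact H.congr' _ _ fun r hr => by simp only [key r hr]

theorem hs_congr {V' : Type*} [AddCommGroup V'] [Module ℝ V'] {F : V → E} {F' : V' → E} {a b : V}
    {a' b' : V'}
    (h : ∀ r ∈ Icc (0:ℝ) 1, F (a + r • (b - a)) = F' (a' + r • (b' - a'))) :
    H.hs F a b = H.hs F' a' b' := H.congr' _ _ h

theorem hs_const {F : V → E} {a b : V} {x : E} (hx : x ∈ X)
    (h : ∀ r ∈ Icc (0:ℝ) 1, F (a + r • (b - a)) = x) : H.hs F a b = 1 := by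
  rw [← H.const' x hx]; exact H.congr' _ _ h

variable [TopologicalSpace V] [IsTopologicalAddGroup V] [ContinuousSMul ℝ V]

theorem tri {K : Set V} (hK : Convex ℝ K) {F : V → E} (hF : ContinuousOn F K) (hX : MapsTo F K X)
    {a b c : V} (ha : a ∈ K) (hb : b ∈ K) (hc : c ∈ K) :
    H.hs F b c * H.hs F a b = H.hs F a c := by
  have hm : MapsTo (fun p : ℝ × ℝ => a + p.1 • ((b - a) + p.2 • (c - b)))
      (Icc 0 1 ×ˢ Icc 0 1) K := by
    rintro ⟨x, y⟩ ⟨hx, hy⟩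
    have h1 : b + y • (c - b) ∈ K := hK.add_smul_sub_mem hb hc hy
    have := hK.add_smul_sub_mem ha h1 hx
    convert this using 3
    simp only []; abel
  have := H.sqOn (fun p : ℝ × ℝ => F (a + p.1 • ((b - a) + p.2 • (c - b))))
    (hF.comp (by fun_prop) hm) (fun p hp => hX (hm hp))
  have e : H.h (fun r : ℝ => F (a + (0:ℝ) • ((b - a) + r • (c - b)))) = 1 := by
    rw [← H.const' (F a) (hX ha)]; simp
  simp only [] at this
  rw [e, mul_one] at this
  unfold hs
  convert this using 2
  · congr 1; ext r; congr 1; simp only [one_smul]; abel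
  · simp
  · congr 1; ext r; congr 1; simp

theorem hs_self {F : V → E} {a : V} (ha : F a ∈ X) : H.hs F a a = 1 :=
  H.hs_const ha (by simp)

theorem hs_inv {K : Set V} (hK : Convex ℝ K) {F : V → E} (hF : ContinuousOn F K)
    (hX : MapsTo F K X) {a b : V} (ha : a ∈ K) (hb : b ∈ K) :
    H.hs F b a = (H.hs F a b)⁻¹ := by
  rw [eq_inv_iff_mul_eq_one, H.tri hK hF hX ha hb ha, H.hs_self (hX ha)]

/-- square: any two routes around a quadrilateral -/
theorem quad {K : Set V} (hK : Convex ℝ K) {F : V → E} (hF : ContinuousOn F K) (hX : MapsTo F K X)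
    {a b c d : V} (ha : a ∈ K) (hb : b ∈ K) (hc : c ∈ K) (hd : d ∈ K) :
    H.hs F b d * H.hs F a b = H.hs F c d * H.hs F a c := by
  rw [H.tri hK hF hX ha hb hd, H.tri hK hF hX ha hc hd]

theorem tri' {F : V → E} {a b c : V} (hF : ContinuousOn F (convexHull ℝ {a, b, c}))
    (hX : MapsTo F (convexHull ℝ {a, b, c}) X) :
    H.hs F b c * H.hs F a b = H.hs F a c :=
  H.tri (convex_convexHull ℝ _) hF hX (subset_convexHull _ _ (by simp))
    (subset_convexHull _ _ (by simp)) (subset_convexHull _ _ (by simp))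

/-- a path inside a star-convex set -/
theorem star_path {K : Set V} {c : V} (hK : StarConvex ℝ c K) {F : V → E} (hF : ContinuousOn F K)
    (hX : MapsTo F K X) {γ : ℝ → V} (hγ : ContinuousOn γ (Icc 0 1)) (hm : MapsTo γ (Icc 0 1) K) :
    H.h (fun r => F (γ r)) * H.hs F c (γ 0) = H.hs F c (γ 1) := by
  have hm : MapsTo (fun p : ℝ × ℝ => c + p.1 • (γ p.2 - c)) (Icc 0 1 ×ˢ Icc 0 1) K := by
    rintro ⟨x, y⟩ ⟨hx, hy⟩
    exact hK.add_smul_sub_mem (hm hy) hx.1 hx.2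
  have hcc : ContinuousOn (fun p : ℝ × ℝ => c + p.1 • (γ p.2 - c)) (Icc 0 1 ×ˢ Icc 0 1) := by
    apply continuousOn_const.add
    apply continuousOn_fst.smul
    exact (hγ.comp continuousOn_snd (fun p hp => hp.2)).sub continuousOn_const
  have := H.sqOn (fun p : ℝ × ℝ => F (c + p.1 • (γ p.2 - c))) (hF.comp hcc hm)
    (fun p hp => hX (hm hp))
  have hc : c ∈ K := by
    have := hm (x := ((0:ℝ), (0:ℝ))) (by simp)
    simpa using this
  have e : H.h (fun r : ℝ => F (c + (0:ℝ) • (γ r - c))) = 1 := by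
    rw [← H.const' (F c) (hX hc)]; simp
  simp only [] at this
  rw [e, mul_one] at this
  unfold hs
  rw [← this]
  congr 2
  ext r; simp

/-- path as a sequence of segments in parameter space -/
theorem h_eq_hs (γ : ℝ → E) : H.h γ = H.hs γ (0:ℝ) 1 := by unfold hs; simp

theorem star_seg {K : Set V} {c : V} (hK : StarConvex ℝ c K) {F : V → E} (hF : ContinuousOn F K)
    (hX : MapsTo F K X) {a b : V} (hm : ∀ r ∈ Icc (0:ℝ) 1, a + r • (b - a) ∈ K) :
    H.hs F a b * H.hs F c a = H.hs F c b := by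
  have := H.star_path hK hF hX (γ := fun r => a + r • (b - a)) (by fun_prop) hm
  simpa [hs] using this

/-- pullback -/
def comap {E' : Type*} [TopologicalSpace E'] (Φ : E' → E) (Y : Set E') (hΦ : ContinuousOn Φ Y)
    (hm : MapsTo Φ Y X) : Hol E' Y G where
  h γ := H.h (fun r => Φ (γ r))
  congr' γ γ' h := H.congr' _ _ fun r hr => by rw [h r hr]
  const' x hx := H.const' _ (hm hx)
  sq' F hF hY := H.sq' (fun p => Φ (F p)) (hΦ.comp_continuous hF hY) (fun p => hm (hY p))

def prod {G' : Type*} [Group G'] (H' : Hol E X G') : Hol E X (G × G') where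
  h γ := (H.h γ, H'.h γ)
  congr' γ γ' h := by rw [H.congr' _ _ h, H'.congr' _ _ h]
  const' x hx := by rw [H.const' _ hx, H'.const' _ hx]; rfl
  sq' F hF hY := Prod.ext (H.sq' F hF hY) (H'.sq' F hF hY)
end

section
variable {E : Type*} [NormedAddCommGroup E] [NormedSpace ℝ E] {X : Set E} {G : Type*} [Group G]
  (H : Hol E X G)

theorem path_convex {K : Set E} (hK : Convex ℝ K) (hKX : K ⊆ X) {γ : ℝ → E} {a b : ℝ}
    (hγ : ContinuousOn γ (uIcc a b)) (hm : MapsTo γ (uIcc a b) K) :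
    H.hs γ a b = H.hs id (γ a) (γ b) := by
  have hseg : ∀ r ∈ Icc (0:ℝ) 1, a + r • (b - a) ∈ uIcc a b := fun r hr =>
    (convex_uIcc a b).add_smul_sub_mem left_mem_uIcc right_mem_uIcc hr
  have h1 := H.star_path (K := K) (c := γ a) (F := id) (hK.starConvex (hm left_mem_uIcc))
    continuousOn_id hKX (γ := fun r => γ (a + r • (b - a)))
    (hγ.comp (by fun_prop) hseg) (fun r hr => hm (hseg r hr))
  simp only [zero_smul, add_zero, one_smul, add_sub_cancel] at h1
  rw [H.hs_self (F := id) (hKX (hm left_mem_uIcc)), mul_one] at h1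
  exact h1

theorem l2g (hXo : IsOpen X) (R : E → E → G → Prop)
    (hR : ∀ p q r c d, R p q c → R q r d → R p r (d * c)) (hR' : ∀ p q c, R p q c → R q p c⁻¹)
    (hloc : ∀ p ∈ X, ∀ᶠ p' in 𝓝 p, R p p' (H.hs id p p'))
    {γ : ℝ → E} (hγ : ContinuousOn γ (Icc 0 1)) (hm : MapsTo γ (Icc 0 1) X) :
    R (γ 0) (γ 1) (H.h γ) := by
  have hadd : ∀ a ∈ Icc (0:ℝ) 1, ∀ b ∈ Icc (0:ℝ) 1, ∀ c ∈ Icc (0:ℝ) 1,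
      H.hs γ b c * H.hs γ a b = H.hs γ a c := fun a ha b hb c hc =>
    H.tri (convex_Icc 0 1) hγ hm ha hb hc
  have key : ∀ s0 ∈ Icc (0:ℝ) 1, ∀ᶠ s in 𝓝[Icc 0 1] s0, R (γ s0) (γ s) (H.hs γ s0 s) := by
    intro s0 hs0
    obtain ⟨ε, hε, hb⟩ := Metric.isOpen_iff.1 hXo _ (hm hs0)
    have h2 := hγ s0 hs0
    have h3 := h2.eventually (hloc _ (hm hs0))
    have h4 : ∀ᶠ s in 𝓝[Icc 0 1] s0, γ s ∈ Metric.ball (γ s0) ε :=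
      h2.eventually (Metric.ball_mem_nhds _ hε)
    obtain ⟨δ, hδ, h5⟩ := Metric.mem_nhdsWithin_iff.1 h4
    have h6 : ∀ᶠ s in 𝓝[Icc 0 1] s0, s ∈ Metric.ball s0 δ ∩ Icc 0 1 :=
      inter_mem (mem_nhdsWithin_of_mem_nhds (Metric.ball_mem_nhds _ hδ)) self_mem_nhdsWithin
    filter_upwards [h3, h6] with s hs1 hs2
    have hsub : uIcc s0 s ⊆ Metric.ball s0 δ ∩ Icc 0 1 := by
      rw [← segment_eq_uIcc]
      exact ((convex_ball s0 δ).inter (convex_Icc 0 1)).segment_subset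
        ⟨Metric.mem_ball_self hδ, hs0⟩ hs2
    rw [H.path_convex (convex_ball (γ s0) ε) hb (hγ.mono fun x hx => (hsub hx).2)
      (fun x hx => h5 (hsub hx))]
    exact hs1
  rw [h_eq_hs]
  refine isPreconnected_Icc.induction₂ (s := Icc (0:ℝ) 1)
      (fun x y => R (γ x) (γ y) (H.hs γ x y)) key ?_ ?_ (by simp) (by simp)
  · intro x y z hx hy hz h1 h2
    rw [← hadd x hx y hy z hz]; exact hR _ _ _ _ _ h1 h2
  · intro x y hx hy h1
    rw [H.hs_inv (convex_Icc 0 1) hγ hm hx hy]; exact hR' _ _ _ h1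

theorem local_to_global (hXo : IsOpen X) (S : Subgroup G) (g : E → G)
    (hloc : ∀ p ∈ X, ∀ᶠ p' in 𝓝 p, (g p')⁻¹ * H.hs id p p' * g p ∈ S)
    {γ : ℝ → E} (hγ : ContinuousOn γ (Icc 0 1)) (hm : MapsTo γ (Icc 0 1) X) :
    (g (γ 1))⁻¹ * H.h γ * g (γ 0) ∈ S := by
  refine H.l2g hXo (fun p q c => (g q)⁻¹ * c * g p ∈ S) ?_ ?_ hloc hγ hm
  · intro p q r c d h1 h2
    have := S.mul_mem h2 h1
    convert this using 1; group
  · intro p q c h1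
    have := S.inv_mem h1
    convert this using 1; group

/-- star-shaped charts -/
theorem star_id {K : Set E} {c : E} (hK : StarConvex ℝ c K) (hX : K ⊆ X) {p q : E}
    (hm : segment ℝ p q ⊆ K) :
    H.hs id p q * H.hs id c p = H.hs id c q := by
  refine H.star_seg hK continuousOn_id hX fun r hr => hm ?_
  rw [segment_eq_image']; exact ⟨r, hr, rfl⟩
end
end Hol

def Ys : Set ℂ := {t | t ≠ 0 ∧ t ≠ 4 ∧ t ≠ 4 * I}
def D3 : Set ℂ := {t | t.re < 0 ∨ t.im < 0}
def D1 : Set ℂ := {t | (0 < t.re ∨ 0 < t.im) ∧ ¬ (t.re = 4 ∧ t.im ≤ 0) ∧ ¬ (t.im = 4 ∧ t.re ≤ 0)}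
def t3 : ℂ := ⟨-8, -8⟩
def t1 : ℂ := ⟨4, 4⟩
def W : Fin 4 → Set ℂ := ![{t | 0 < t.re ∧ t.re < 4 ∧ t.im < 0}, {t | 4 < t.re ∧ t.im < 0},
  {t | 0 < t.im ∧ t.im < 4 ∧ t.re < 0}, {t | 4 < t.im ∧ t.re < 0}]
def sW : Fin 4 → ℂ := ![⟨2, -2⟩, ⟨8, -8⟩, ⟨-2, 2⟩, ⟨-8, 8⟩]

theorem isOpen_Ys : IsOpen Ys :=
  (isOpen_ne).inter (isOpen_ne.inter isOpen_ne)
theorem D3_sub : D3 ⊆ Ys := by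
  rintro t h; refine ⟨?_, ?_, ?_⟩ <;> rintro rfl <;> (simp [D3] at h; try norm_num at h)
theorem D1_sub : D1 ⊆ Ys := by
  rintro t h; refine ⟨?_, ?_, ?_⟩ <;> rintro rfl <;> simp [D1] at h
theorem Ys_sub {t : ℂ} (h : t ∈ Ys) : t ∈ D3 ∨ t ∈ D1 := by
  by_contra! hc
  obtain ⟨h1, h2⟩ := hc
  simp only [D3, mem_ofPred_eq, not_or, not_lt] at h1
  obtain ⟨h3, h4, h5⟩ := h
  simp only [ne_eq, Complex.ext_iff] at h3 h4 h5
  norm_num at h3 h4 h5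
  apply h2
  refine ⟨?_, ?_, ?_⟩
  · by_contra! h6
    exact h3 (by linarith) (by linarith)
  · rintro ⟨h6, h7⟩; exact h4 h6 (by linarith)
  · rintro ⟨h6, h7⟩; exact h5 (by linarith) h6
theorem isOpen_D3 : IsOpen D3 :=
  (isOpen_lt continuous_re continuous_const).union (isOpen_lt continuous_im continuous_const)
theorem isOpen_D1 : IsOpen D1 := by
  refine ((isOpen_lt continuous_const continuous_re).union
    (isOpen_lt continuous_const continuous_im)).inter (IsOpen.inter ?_ ?_)
  · exact ((isClosed_eq continuous_re continuous_const).inter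
      (isClosed_le continuous_im continuous_const)).isOpen_compl
  · exact ((isClosed_eq continuous_im continuous_const).inter
      (isClosed_le continuous_re continuous_const)).isOpen_compl
theorem star_D3 : StarConvex ℝ t3 D3 := by
  rintro t h a b ha hb hab
  simp [D3, t3] at h ⊢
  rcases h with h | h
  · left; rcases hb.eq_or_lt with rfl | hb <;> nlinarith
  · right; rcases hb.eq_or_lt with rfl | hb <;> nlinarith
theorem star_D1 : StarConvex ℝ t1 D1 := by
  rintro t ⟨h1, h2, h3⟩ a b ha hb hab
  obtain rfl : a = 1 - b := by linarith
  refine ⟨?_, ?_, ?_⟩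
  · simp [t1]
    rcases h1 with h | h
    · left; rcases hb.eq_or_lt with rfl | hb <;> nlinarith
    · right; rcases hb.eq_or_lt with rfl | hb <;> nlinarith
  · rintro ⟨h4, h5⟩
    simp [t1] at h4 h5
    have hb' : 0 < b := by rcases hb.eq_or_lt with rfl | hb; · linarith
                           · exact hb
    have : t.re = 4 := by
      have : b * (t.re - 4) = 0 := by linarith
      rcases mul_eq_zero.1 this with h | h <;> linarith
    exact h2 ⟨this, by nlinarith⟩
  · rintro ⟨h4, h5⟩
    simp [t1] at h4 h5
    have hb' : 0 < b := by rcases hb.eq_or_lt with rfl | hb; · linarith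
                           · exact hb
    have : t.im = 4 := by
      have : b * (t.im - 4) = 0 := by linarith
      rcases mul_eq_zero.1 this with h | h <;> linarith
    exact h3 ⟨this, by nlinarith⟩
theorem W_sub3 (j) : W j ⊆ D3 := by
  intro t h; fin_cases j <;> simp [W] at h <;> simp [D3] <;> tauto
theorem W_sub1 (j) : W j ⊆ D1 := by
  intro t h; fin_cases j <;> simp [W] at h <;>
    refine ⟨?_, ?_, ?_⟩ <;> first | (rintro ⟨h1, h2⟩; linarith) | (left; linarith) | (right; linarith)
theorem W_mem {t : ℂ} (h3 : t ∈ D3) (h1 : t ∈ D1) : ∃ j, t ∈ W j := by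
  obtain ⟨h1, h2, h4⟩ := h1
  rcases h3 with h | h
  · have h0 : 0 < t.im := by rcases h1 with h1 | h1 <;> linarith
    rcases lt_trichotomy t.im 4 with h5 | h5 | h5
    · exact ⟨2, h0, h5, h⟩
    · exact absurd ⟨h5, h.le⟩ h4
    · exact ⟨3, h5, h⟩
  · have h0 : 0 < t.re := by rcases h1 with h1 | h1 <;> linarith
    rcases lt_trichotomy t.re 4 with h5 | h5 | h5
    · exact ⟨0, h0, h5, h⟩
    · exact absurd ⟨h5, h.le⟩ h2
    · exact ⟨1, h5, h⟩
theorem convex_W (j) : Convex ℝ (W j) := by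
  have l1 : IsLinearMap ℝ Complex.re := ⟨by simp, by simp⟩
  have l2 : IsLinearMap ℝ Complex.im := ⟨by simp, by simp⟩
  fin_cases j
  · exact (convex_halfSpace_gt l1 0).inter ((convex_halfSpace_lt l1 4).inter
      (convex_halfSpace_lt l2 0))
  · exact (convex_halfSpace_gt l1 4).inter (convex_halfSpace_lt l2 0)
  · exact (convex_halfSpace_gt l2 0).inter ((convex_halfSpace_lt l2 4).inter
      (convex_halfSpace_lt l1 0))
  · exact (convex_halfSpace_gt l2 4).inter (convex_halfSpace_lt l1 0)
theorem sW_mem (j) : sW j ∈ W j := by fin_cases j <;> simp [sW, W] <;> norm_num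
theorem t3_mem : t3 ∈ D3 := by simp [t3, D3]

namespace Hol
variable {G : Type*} [Group G] (K : Hol ℂ Ys G)
noncomputable def th3 (t : ℂ) : G := K.hs id t3 t
noncomputable def th1 (t : ℂ) : G := K.hs id t1 t
noncomputable def om (j : Fin 4) : G := (K.th1 (sW j))⁻¹ * K.th3 (sW j)
open Classical in
noncomputable def gY (t : ℂ) : G := if t ∈ D3 then K.th3 t else K.th1 t * K.om 0

theorem th3_seg {p q : ℂ} (h : segment ℝ p q ⊆ D3) : K.hs id p q = K.th3 q * (K.th3 p)⁻¹ := by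
  rw [eq_mul_inv_iff_mul_eq]; exact K.star_id star_D3 D3_sub h
theorem th1_seg {p q : ℂ} (h : segment ℝ p q ⊆ D1) : K.hs id p q = K.th1 q * (K.th1 p)⁻¹ := by
  rw [eq_mul_inv_iff_mul_eq]; exact K.star_id star_D1 D1_sub h
theorem th3_path {γ : ℝ → ℂ} (hγ : ContinuousOn γ (Icc 0 1)) (hm : MapsTo γ (Icc 0 1) D3) :
    K.h γ = K.th3 (γ 1) * (K.th3 (γ 0))⁻¹ := by
  rw [eq_mul_inv_iff_mul_eq]; exact K.star_path star_D3 (F := id) continuousOn_id D3_sub hγ hm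
theorem th1_path {γ : ℝ → ℂ} (hγ : ContinuousOn γ (Icc 0 1)) (hm : MapsTo γ (Icc 0 1) D1) :
    K.h γ = K.th1 (γ 1) * (K.th1 (γ 0))⁻¹ := by
  rw [eq_mul_inv_iff_mul_eq]; exact K.star_path star_D1 (F := id) continuousOn_id D1_sub hγ hm

theorem om_eq {j} {t : ℂ} (h : t ∈ W j) : K.th3 t = K.th1 t * K.om j := by
  have hs := (convex_W j).segment_subset (sW_mem j) h
  have h3 := K.th3_seg (hs.trans (W_sub3 j))
  have h1 := K.th1_seg (hs.trans (W_sub1 j))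
  rw [h3] at h1
  rw [om, ← inv_mul_eq_iff_eq_mul]
  have h2 : K.th3 t = K.th1 t * (K.th1 (sW j))⁻¹ * K.th3 (sW j) := by rw [← h1]; group
  rw [h2]; group

theorem th3_t3 : K.th3 t3 = 1 := K.hs_self (F := id) (D3_sub t3_mem)
theorem gY3 {t : ℂ} (h : t ∈ D3) : K.gY t = K.th3 t := if_pos h

theorem gY1 (S : Subgroup G) (hS : ∀ j, (K.om 0)⁻¹ * K.om j ∈ S) {t : ℂ} (h : t ∈ D1) :
    (K.th1 t * K.om 0)⁻¹ * K.gY t ∈ S := by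
  by_cases h3 : t ∈ D3
  · rw [K.gY3 h3]
    obtain ⟨j, hj⟩ := W_mem h3 h
    rw [K.om_eq hj]; convert hS j using 1; group
  · rw [gY, if_neg h3]; simp

theorem gY_gen (S : Subgroup G) (hS : ∀ j, (K.om 0)⁻¹ * K.om j ∈ S) {γ : ℝ → ℂ}
    (hγ : ContinuousOn γ (Icc 0 1)) (hm : MapsTo γ (Icc 0 1) Ys) :
    (K.gY (γ 1))⁻¹ * K.h γ * K.gY (γ 0) ∈ S := by
  refine K.local_to_global isOpen_Ys S K.gY ?_ hγ hm
  intro p hp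
  rcases Ys_sub hp with h | h
  · obtain ⟨ε, hε, hb⟩ := Metric.isOpen_iff.1 isOpen_D3 _ h
    filter_upwards [Metric.ball_mem_nhds p hε] with q hq
    have hs := ((convex_ball p ε).segment_subset (Metric.mem_ball_self hε) hq).trans hb
    rw [K.th3_seg hs, K.gY3 h, K.gY3 (hb hq)]; simp
  · obtain ⟨ε, hε, hb⟩ := Metric.isOpen_iff.1 isOpen_D1 _ h
    filter_upwards [Metric.ball_mem_nhds p hε] with q hq
    have hs := ((convex_ball p ε).segment_subset (Metric.mem_ball_self hε) hq).trans hb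
    rw [K.th1_seg hs]
    have := S.mul_mem (S.inv_mem (K.gY1 S hS (hb hq))) (K.gY1 S hS h)
    convert this using 1; group
end Hol

def bb (ε u : ℂ) : ℂ := 6 * u - 2 * ε * u ^ 3
def Ms : Set (ℂ × ℂ) := {p | p.2 ∈ Ys ∧ p.2 ≠ bb 1 p.1 ∧ p.2 ≠ bb (-1) p.1}
def Nn (ε : ℂ) : Set (ℂ × ℂ) := {p | bb ε p.2 ∈ Ys ∧ ε * p.2 ^ 2 * (1 + p.1 + p.1 ^ 2) ≠ 3 ∧
  ε * p.2 ^ 2 * (1 + p.1 ^ 3) ≠ 3 * (1 - p.1)}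
def Ph (ε : ℂ) (p : ℂ × ℂ) : ℂ × ℂ := (p.2 * p.1, bb ε p.2)
def Ew (ε : ℂ) (p : ℂ × ℂ) : ℂ × ℂ := Ph ε (1 - p.1 ^ 2, p.2)
def adm (ε β : ℂ) : Prop := ∀ x ∈ Icc (0:ℝ) 1, ((x:ℂ), β) ∈ Nn ε
def good (ε β : ℂ) (a δ : ℝ) : Prop :=
  0 < δ ∧ ∀ w : ℂ, |w.re| ≤ a → |w.im| ≤ δ → (1 - w ^ 2, β) ∈ Nn ε
def upR (a δ : ℝ) : Set ℂ := {w | |w.re| ≤ a ∧ 0 ≤ w.im ∧ w.im ≤ δ ∧ w ≠ 0}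

@[fun_prop] theorem cont_bb (ε) : Continuous (bb ε) := by unfold bb; fun_prop
@[fun_prop] theorem cont_Ph (ε) : Continuous (Ph ε) := by unfold Ph bb; fun_prop
@[fun_prop] theorem cont_Ew (ε) : Continuous (Ew ε) := by unfold Ew; fun_prop
theorem isOpen_Ms : IsOpen Ms := by
  refine (isOpen_Ys.preimage continuous_snd).inter (IsOpen.inter ?_ ?_)
  · exact isOpen_ne_fun continuous_snd (by fun_prop)
  · exact isOpen_ne_fun continuous_snd (by fun_prop)
theorem isOpen_Nn (ε) : IsOpen (Nn ε) := by
  refine (isOpen_Ys.preimage (f := fun p : ℂ × ℂ => bb ε p.2) (by fun_prop)).inter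
    (IsOpen.inter ?_ ?_)
  · exact isOpen_ne_fun (by fun_prop) (by fun_prop)
  · exact isOpen_ne_fun (by fun_prop) (by fun_prop)
theorem Ms_iff {ε : ℂ} (hε : ε = 1 ∨ ε = -1) (p : ℂ × ℂ) :
    p ∈ Ms ↔ p.2 ∈ Ys ∧ p.2 ≠ bb ε p.1 ∧ p.2 ≠ bb (-ε) p.1 := by
  rcases hε with rfl | rfl
  · rfl
  · simp only [Ms, mem_ofPred_eq, neg_neg]; tauto
theorem i_mem {t : ℂ} (h : t ∈ Ys) : ((0:ℂ), t) ∈ Ms := by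
  refine ⟨h, ?_, ?_⟩ <;> simpa [bb] using h.1
theorem bb_ne {ε β : ℂ} (h : bb ε β ∈ Ys) : β ≠ 0 := by
  rintro rfl; exact h.1 (by simp [bb])
theorem Ph_iff {ε : ℂ} (hε : ε = 1 ∨ ε = -1) (p : ℂ × ℂ) :
    Ph ε p ∈ Ms ↔ p ∈ Nn ε ∧ p.1 ≠ 1 := by
  obtain ⟨z, β⟩ := p
  rw [Ms_iff hε]
  simp only [Ph, Nn, mem_ofPred_eq]
  have h1 : bb ε β = bb ε (β * z) ↔ β = 0 ∨ z = 1 ∨ ε * β ^ 2 * (1 + z + z ^ 2) = 3 := by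
    have : bb ε β - bb ε (β * z) = 2 * (β * ((z - 1) * (ε * β ^ 2 * (1 + z + z ^ 2) - 3))) := by
      unfold bb; ring
    rw [← sub_eq_zero, this]; simp [sub_eq_zero]
  have h2 : bb ε β = bb (-ε) (β * z) ↔ β = 0 ∨ ε * β ^ 2 * (1 + z ^ 3) = 3 * (1 - z) := by
    have : bb ε β - bb (-ε) (β * z) = -2 * (β * (ε * β ^ 2 * (1 + z ^ 3) - 3 * (1 - z))) := by
      unfold bb; ring
    rw [← sub_eq_zero, this]; simp [sub_eq_zero]
  constructor
  · rintro ⟨h, h3, h4⟩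
    rw [Ne, h1] at h3; rw [Ne, h2] at h4; tauto
  · rintro ⟨⟨h, h3, h4⟩, h5⟩
    have := bb_ne h
    rw [Ne, h1, Ne, h2]; tauto
theorem Ew_mem {ε : ℂ} (hε : ε = 1 ∨ ε = -1) {w β : ℂ} (h : (1 - w ^ 2, β) ∈ Nn ε) (hw : w ≠ 0) :
    Ew ε (w, β) ∈ Ms := by
  refine (Ph_iff hε _).2 ⟨h, ?_⟩
  simpa using hw
theorem star_upR {a η δ : ℝ} (h : 0 < η) (hδ : η ≤ δ) : StarConvex ℝ (⟨0, η⟩ : ℂ) (upR a δ) := by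
  rintro w ⟨h1, h2, h3, h4⟩ c b ha hb hab
  obtain rfl : c = 1 - b := by linarith
  rw [abs_le] at h1
  refine ⟨?_, ?_, ?_, ?_⟩
  · rw [abs_le]; simp; constructor <;> nlinarith
  · simp; nlinarith
  · simp; nlinarith
  · intro h5
    have e1 := congrArg Complex.re h5
    have e2 := congrArg Complex.im h5
    simp at e1 e2
    have : b = 1 := by nlinarith
    subst this
    simpa [h4] using h5

theorem adm.good {ε β : ℂ} (h : adm ε β) : ∃ δ > 0, ∀ β' ∈ Metric.ball β δ, good ε β' 1 δ := by
  have hc : IsCompact ((fun x : ℝ => ((x:ℂ), β)) '' Icc (-1) 1) :=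
    isCompact_Icc.image (by fun_prop)
  have hO : IsOpen ((fun p : ℂ × ℂ => (1 - p.1 ^ 2, p.2)) ⁻¹' Nn ε) :=
    (isOpen_Nn ε).preimage (by fun_prop)
  obtain ⟨δ, hδ, hsub⟩ := hc.exists_thickening_subset_open hO (by
    rintro _ ⟨x, hx, rfl⟩
    have := h (1 - x ^ 2) ⟨by nlinarith [hx.1, hx.2], by nlinarith [hx.1, hx.2]⟩
    simpa using this)
  refine ⟨δ / 2, by linarith, fun β' hβ' => ⟨by linarith, fun w h1 h2 => ?_⟩⟩
  refine hsub (a := (w, β')) ?_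
  rw [Metric.mem_thickening_iff]
  refine ⟨_, ⟨w.re, abs_le.1 h1, rfl⟩, ?_⟩
  rw [Prod.dist_eq, max_lt_iff]
  constructor
  · rw [Complex.dist_eq]
    have : w - w.re = (w.im : ℂ) * I := by apply Complex.ext <;> simp
    simp only [this, norm_mul, norm_real, norm_I, mul_one]
    simpa using by linarith
  · have := Metric.mem_ball.1 hβ'; simp only []; linarith

theorem good.mono {ε β : ℂ} {a δ η : ℝ} (h : good ε β a δ) (h0 : 0 < η) (h1 : η ≤ δ) : good ε β a η :=
  ⟨h0, fun w h2 h3 => h.2 w h2 (h3.trans h1)⟩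

namespace Hol
variable {G : Type*} [Group G] (H : Hol (ℂ × ℂ) Ms G)
noncomputable def Y : Hol ℂ Ys G := H.comap (fun t => ((0:ℂ), t)) Ys (by fun_prop) (fun _ => i_mem)

noncomputable def Leta (ε β : ℂ) (a η : ℝ) : G :=
  H.hs (fun w => Ew ε (w, β)) ⟨0, η⟩ (-a) * H.hs (fun w => Ew ε (w, β)) a ⟨0, η⟩
open Classical in
noncomputable def Lam (ε β : ℂ) : G :=
  if h : ∃ δ, good ε β 1 δ then H.Leta ε β 1 (Classical.choose h) else 1

variable {ε : ℂ} (hε : ε = 1 ∨ ε = -1)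
include hε

theorem sect {β : ℂ} {a δ : ℝ} (h : good ε β a δ) :
    MapsTo (fun w => Ew ε (w, β)) (upR a δ) Ms := by
  rintro w ⟨h1, h2, h3, h4⟩
  exact Ew_mem hε (h.2 w h1 (by rwa [abs_of_nonneg h2])) h4

omit hε in
theorem mem_one {a : ℝ} (ha : 0 < a) (δ : ℝ) (h : 0 < δ) : (a:ℂ) ∈ upR a δ ∧ (-a:ℂ) ∈ upR a δ := by
  constructor <;> refine ⟨by simp [abs_of_pos ha], by simp, by simpa using h.le, by simpa using ha.ne'⟩

theorem Leta_star {β : ℂ} {a δ η : ℝ} (ha : 0 < a) (h : good ε β a δ) (h0 : 0 < η) (h1 : η ≤ δ) (η' : ℝ)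
    (h2 : 0 < η') (h3 : η' ≤ δ) :
    H.Leta ε β a η = H.hs (fun w => Ew ε (w, β)) ⟨0, η'⟩ (-a) *
      (H.hs (fun w => Ew ε (w, β)) ⟨0, η'⟩ a)⁻¹ := by
  have st := star_upR (a := a) h2 h3
  have hF : ContinuousOn (fun w => Ew ε (w, β)) (upR a δ) := by fun_prop
  have st1 := star_upR (a := a) h0 h1
  have m1 : ∀ r ∈ Icc (0:ℝ) 1, (⟨0, η⟩ : ℂ) + r • (-a - (⟨0, η⟩ : ℂ)) ∈ upR a δ := fun r hr =>
    st1.add_smul_sub_mem (mem_one ha δ h.1).2 hr.1 hr.2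
  have m2 : ∀ r ∈ Icc (0:ℝ) 1, (a:ℂ) + r • ((⟨0, η⟩ : ℂ) - a) ∈ upR a δ := fun r hr => by
    have := st1.add_smul_sub_mem (mem_one ha δ h.1).1 (t := 1 - r) (by linarith [hr.2])
      (by linarith [hr.1])
    convert this using 1
    module
  have e1 := H.star_seg st hF (sect hε h) m1
  have e2 := H.star_seg st hF (sect hε h) m2
  rw [Leta, ← e1, ← e2]; group

theorem Lam_eq {β : ℂ} {δ η : ℝ} (h : good ε β 1 δ) (h0 : 0 < η) (h1 : η ≤ δ) :
    H.Lam ε β = H.Leta ε β 1 η := by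
  have hex : ∃ δ, good ε β 1 δ := ⟨δ, h⟩
  have hc := Classical.choose_spec hex
  rw [Lam, dif_pos hex]
  set δ' := Classical.choose hex
  have hm : 0 < min η δ' := lt_min h0 hc.1
  rw [H.Leta_star hε one_pos hc hc.1 le_rfl _ hm (min_le_right _ _),
    H.Leta_star hε one_pos h h0 h1 _ hm ((min_le_left _ _).trans h1)]

theorem Leta_loc {β : ℂ} {a δ : ℝ} (ha : 0 < a) (hδ : 0 < δ)
    (hg : ∀ β' ∈ Metric.ball β δ, good ε β' a δ) {β' : ℂ} (hβ' : β' ∈ Metric.ball β δ) :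
    H.Leta ε β' a δ * H.hs (Ew ε) (a, β) (a, β') =
      H.hs (Ew ε) (a, β) (a, β') * H.Leta ε β a δ := by
  have hβ := Metric.mem_ball_self (x := β) hδ
  have gg := hg _ hβ
  have gg' := hg _ hβ'
  have st : StarConvex ℝ ((⟨0, δ⟩ : ℂ), β) (upR a δ ×ˢ Metric.ball β δ) :=
    (star_upR hδ le_rfl).prod ((convex_ball β δ).starConvex hβ)
  have hF : ContinuousOn (Ew ε) (upR a δ ×ˢ Metric.ball β δ) := by fun_prop
  have hm : MapsTo (Ew ε) (upR a δ ×ˢ Metric.ball β δ) Ms := fun p hp => sect hε (hg _ hp.2) hp.1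
  have key : ∀ v ∈ upR a δ, H.hs (Ew ε) (v, β) (v, β') * H.hs (Ew ε) (⟨0, δ⟩, β) (v, β) =
      H.hs (Ew ε) (⟨0, δ⟩, β) (v, β') := fun v hv => by
    refine H.star_seg st hF hm fun r hr => ⟨?_, ?_⟩
    · simpa using hv
    · exact (convex_ball β δ).add_smul_sub_mem hβ hβ' hr
  have key2 : ∀ b ∈ Metric.ball β δ, ∀ v ∈ upR a δ, H.hs (fun w => Ew ε (w, b)) ⟨0, δ⟩ v *
      H.hs (Ew ε) (⟨0, δ⟩, β) (⟨0, δ⟩, b) = H.hs (Ew ε) (⟨0, δ⟩, β) (v, b) := fun b hb v hv => by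
    have := H.star_seg st hF hm (a := (⟨0, δ⟩, b)) (b := (v, b)) fun r hr => ⟨?_, ?_⟩
    · rw [← this]; congr 1; apply H.hs_congr; intro r hr; simp
    · exact (star_upR hδ le_rfl).add_smul_sub_mem hv hr.1 hr.2
    · simpa using hb
  have e1 : ∀ v : ℂ, v ^ 2 = a ^ 2 → H.hs (Ew ε) (v, β) (v, β') =
      H.hs (Ew ε) (a, β) (a, β') := fun v hv => by
    apply H.hs_congr; intro r hr; simp [Ew, hv]
  have m := mem_one ha δ hδ
  have self : H.hs (Ew ε) (⟨0, δ⟩, β) (⟨0, δ⟩, β) = 1 :=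
    H.hs_self (hm ⟨⟨by simpa using ha.le, hδ.le, le_rfl, by simp [Complex.ext_iff, hδ.ne']⟩, hβ⟩)
  rw [H.Leta_star hε ha gg hδ le_rfl δ hδ le_rfl, H.Leta_star hε ha gg' hδ le_rfl δ hδ le_rfl]
  have k1 := key a m.1
  have k2 := key (-a) m.2
  rw [e1 a (by simp)] at k1
  rw [e1 (-a) (by simp)] at k2
  rw [← key2 β hβ _ m.1, ← key2 β' hβ' _ m.1, self] at k1
  rw [← key2 β hβ _ m.2, ← key2 β' hβ' _ m.2, self] at k2
  simp only [mul_one] at k1 k2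
  generalize H.hs (Ew ε) (a, β) (a, β') = k at *
  generalize H.hs (fun w => Ew ε (w, β)) ⟨0, δ⟩ a = x at *
  generalize H.hs (fun w => Ew ε (w, β)) ⟨0, δ⟩ (-a) = y at *
  generalize H.hs (fun w => Ew ε (w, β')) ⟨0, δ⟩ a = x' at *
  generalize H.hs (fun w => Ew ε (w, β')) ⟨0, δ⟩ (-a) = y' at *
  generalize H.hs (Ew ε) (⟨0, δ⟩, β) (⟨0, δ⟩, β') = z at *
  rw [← mul_assoc, k2]
  rw [mul_assoc, mul_assoc, mul_right_inj, inv_mul_eq_iff_eq_mul, ← mul_assoc, ← k1]; group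

theorem Lam_loc {β : ℂ} (h : adm ε β) : ∀ᶠ β' in 𝓝 β,
    H.Lam ε β' * H.hs (fun b => ((0:ℂ), bb ε b)) β β' =
      H.hs (fun b => ((0:ℂ), bb ε b)) β β' * H.Lam ε β := by
  obtain ⟨δ, hδ, hg⟩ := h.good
  filter_upwards [Metric.ball_mem_nhds β hδ] with β' hβ'
  have hβ := Metric.mem_ball_self (x := β) hδ
  have := H.Leta_loc hε one_pos hδ hg hβ'
  rw [← H.Lam_eq hε (hg _ hβ) hδ le_rfl, ← H.Lam_eq hε (hg _ hβ') hδ le_rfl] at this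
  have e : H.hs (fun b => ((0:ℂ), bb ε b)) β β' = H.hs (Ew ε) ((1:ℝ), β) ((1:ℝ), β') := by
    apply H.hs_congr; intro r hr; simp [Ew, Ph]
  rw [e]; exact this

omit hε in
theorem adm_open (ε : ℂ) : IsOpen {β | adm ε β} := by
  rw [isOpen_iff_mem_nhds]
  intro β h
  obtain ⟨δ, hδ, hg⟩ := h.good
  filter_upwards [Metric.ball_mem_nhds β hδ] with β' hβ' x hx
  have := (hg _ hβ').2 (Real.sqrt (1 - x) : ℝ) (by
    rw [ofReal_re, abs_of_nonneg (Real.sqrt_nonneg _), Real.sqrt_le_one]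
    linarith [hx.1]) (by simpa using hδ.le)
  rw [← ofReal_pow, Real.sq_sqrt (by linarith [hx.2])] at this
  simpa using this

omit hε in
theorem adm_Ys {β : ℂ} (h : adm ε β) : bb ε β ∈ Ys := (h 0 (by simp)).1

theorem Lam_path {γ : ℝ → ℂ} (hγ : ContinuousOn γ (Icc 0 1)) (hm : ∀ r ∈ Icc (0:ℝ) 1, adm ε (γ r)) :
    H.Lam ε (γ 1) * H.Y.h (fun r => bb ε (γ r)) = H.Y.h (fun r => bb ε (γ r)) * H.Lam ε (γ 0) := by
  have := (H.Y.comap (bb ε) {β | adm ε β} (by fun_prop) (fun β h => adm_Ys h)).l2g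
    (adm_open ε)
    (fun p q c => H.Lam ε q * c = c * H.Lam ε p) ?_ ?_ ?_ hγ hm
  · exact this
  · intro p q r c d h1 h2
    rw [← mul_assoc, h2, mul_assoc, h1, mul_assoc]
  · intro p q c h1
    rw [eq_inv_mul_iff_mul_eq, ← mul_assoc, ← h1]; group
  · intro β hβ
    exact H.Lam_loc hε hβ

noncomputable def L3 (ε β : ℂ) : G := (H.Y.th3 (bb ε β))⁻¹ * H.Lam ε β * H.Y.th3 (bb ε β)
noncomputable def L1 (ε β : ℂ) : G := (H.Y.th1 (bb ε β))⁻¹ * H.Lam ε β * H.Y.th1 (bb ε β)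

theorem L3_seg {p q : ℂ} (h : ∀ β ∈ segment ℝ p q, adm ε β ∧ bb ε β ∈ D3) :
    H.L3 ε p = H.L3 ε q := by
  have hs : ∀ r ∈ Icc (0:ℝ) 1, p + r • (q - p) ∈ segment ℝ p q := fun r hr => by
    rw [segment_eq_image']; exact ⟨r, hr, rfl⟩
  have h1 := H.Lam_path hε (γ := fun r : ℝ => p + r • (q - p)) (by fun_prop)
    (fun r hr => (h _ (hs r hr)).1)
  have h2 := H.Y.th3_path (γ := fun r : ℝ => bb ε (p + r • (q - p))) (by fun_prop)
    (fun r hr => (h _ (hs r hr)).2)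
  rw [h2] at h1
  simp only [one_smul, zero_smul, add_zero, add_sub_cancel] at h1
  have h3 : H.Lam ε q = H.Y.th3 (bb ε q) * (H.Y.th3 (bb ε p))⁻¹ * H.Lam ε p *
      (H.Y.th3 (bb ε q) * (H.Y.th3 (bb ε p))⁻¹)⁻¹ := by rw [← h1]; group
  rw [L3, L3, h3]; group

theorem L1_seg {p q : ℂ} (h : ∀ β ∈ segment ℝ p q, adm ε β ∧ bb ε β ∈ D1) :
    H.L1 ε p = H.L1 ε q := by
  have hs : ∀ r ∈ Icc (0:ℝ) 1, p + r • (q - p) ∈ segment ℝ p q := fun r hr => by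
    rw [segment_eq_image']; exact ⟨r, hr, rfl⟩
  have h1 := H.Lam_path hε (γ := fun r : ℝ => p + r • (q - p)) (by fun_prop)
    (fun r hr => (h _ (hs r hr)).1)
  have h2 := H.Y.th1_path (γ := fun r : ℝ => bb ε (p + r • (q - p))) (by fun_prop)
    (fun r hr => (h _ (hs r hr)).2)
  rw [h2] at h1
  simp only [one_smul, zero_smul, add_zero, add_sub_cancel] at h1
  have h3 : H.Lam ε q = H.Y.th1 (bb ε q) * (H.Y.th1 (bb ε p))⁻¹ * H.Lam ε p *
      (H.Y.th1 (bb ε q) * (H.Y.th1 (bb ε p))⁻¹)⁻¹ := by rw [← h1]; group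
  rw [L1, L1, h3]; group

omit hε in
theorem L1_L3 {β : ℂ} {j} (h : bb ε β ∈ W j) :
    H.L1 ε β = H.Y.om j * H.L3 ε β * (H.Y.om j)⁻¹ := by
  rw [L1, L3, H.Y.om_eq h]; group
end Hol

theorem star_im {K : Set ℂ} (hK : Convex ℝ K) (s : ℝ) {m : ℂ} (hm : m ∈ K) (h : 0 < s * m.im) :
    StarConvex ℝ m {z | z ∈ K ∧ 0 ≤ s * z.im ∧ z ≠ 1} := by
  rintro z ⟨h1, h2, h3⟩ a b ha hb hab
  refine ⟨hK hm h1 ha hb hab, ?_, ?_⟩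
  · simp; nlinarith [mul_nonneg ha h.le, mul_nonneg hb h2]
  · intro h5
    have e2 := congrArg Complex.im h5
    simp at e2
    rcases ha.eq_or_lt with rfl | ha
    · obtain rfl : b = 1 := by linarith
      simp at h5; exact h3 h5
    · nlinarith [mul_pos ha h, mul_nonneg hb h2, congrArg (s * ·) e2]

theorem mem_seg {p q : ℂ} {r : ℝ} (hr : r ∈ Icc (0:ℝ) 1) : p + r • (q - p) ∈ segment ℝ p q := by
  rw [segment_eq_image']; exact ⟨r, hr, rfl⟩

namespace Hol
variable {G : Type*} [Group G] (H : Hol (ℂ × ℂ) Ms G) {ε : ℂ} (hε : ε = 1 ∨ ε = -1)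

theorem star_rev {V : Type*} [AddCommGroup V] [Module ℝ V] [TopologicalSpace V]
    [IsTopologicalAddGroup V] [ContinuousSMul ℝ V] {E : Type*} [TopologicalSpace E] {X : Set E}
    (H : Hol E X G) {K : Set V} {c : V} (hK : StarConvex ℝ c K)
    {F : V → E} (hF : ContinuousOn F K) (hX : MapsTo F K X) {a : V} (ha : a ∈ K) :
    H.hs F a c = (H.hs F c a)⁻¹ := by
  have hc : c ∈ K := by simpa using hK.add_smul_sub_mem ha (t := 0) le_rfl zero_le_one
  have := H.star_seg hK hF hX (a := a) (b := c) (fun r hr => by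
    have := hK.add_smul_sub_mem ha (t := 1 - r) (by linarith [hr.2]) (by linarith [hr.1])
    convert this using 1; module)
  rw [H.hs_self (hX hc)] at this
  exact eq_inv_of_mul_eq_one_left this
include hε

theorem LL {β : ℂ} (hβ : adm ε β) {K : Set ℂ} (hK : Convex ℝ K) {ρ : ℝ} (hρ : 0 < ρ)
    (hρK : ∀ z : ℂ, |z.im| ≤ ρ * z.re → z.re ≤ 1 + ρ → z ∈ K)
    (hcl : ∀ z ∈ K, z ≠ 1 → Ph ε (z, β) ∈ Ms) {mu ml : ℂ} (hmu : mu ∈ K) (hml : ml ∈ K)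
    (hu : 0 < mu.im) (hl : ml.im < 0) {q : ℝ} (hq : (q:ℂ) ∈ K) (hq1 : 1 < q) :
    H.Lam ε β = (H.hs (fun z => Ph ε (z, β)) mu q * H.hs (fun z => Ph ε (z, β)) 0 mu)⁻¹ *
      (H.hs (fun z => Ph ε (z, β)) ml q * H.hs (fun z => Ph ε (z, β)) 0 ml) := by
  obtain ⟨δ, hδ, hg⟩ := hβ.good
  have hg := hg β (Metric.mem_ball_self hδ)
  set F : ℂ → ℂ × ℂ := fun z => Ph ε (z, β) with hF
  have hFc : Continuous F := by fun_prop
  obtain ⟨η, h0, h1, h2, h3⟩ : ∃ η : ℝ, 0 < η ∧ η ≤ 1 ∧ 2 * η ≤ ρ ∧ η ≤ δ :=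
    ⟨min 1 (min (ρ / 2) δ), by positivity, min_le_left _ _, by
      linarith [(min_le_right 1 (min (ρ / 2) δ)).trans (min_le_left _ _)],
      (min_le_right 1 (min (ρ / 2) δ)).trans (min_le_right _ _)⟩
  have su := star_im hK 1 hmu (by simpa using hu)
  have sl := star_im hK (-1) hml (by simpa using hl)
  have mu' : MapsTo F {z | z ∈ K ∧ 0 ≤ 1 * z.im ∧ z ≠ 1} Ms := fun z hz => hcl z hz.1 hz.2.2
  have ml' : MapsTo F {z | z ∈ K ∧ 0 ≤ -1 * z.im ∧ z ≠ 1} Ms := fun z hz => hcl z hz.1 hz.2.2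
  have mK0 : (0:ℂ) ∈ K := hρK _ (by simp) (by simp; linarith)
  -- the square map
  have hsq : ∀ r ∈ Icc (0:ℝ) 1, ∀ x : ℝ, |x| = 1 - r →
      1 - ((⟨x, r * η⟩ : ℂ)) ^ 2 ∈ K ∧ 1 - ((⟨x, r * η⟩ : ℂ)) ^ 2 ≠ 1 ∧
      (1 - ((⟨x, r * η⟩ : ℂ)) ^ 2).im = - 2 * x * (r * η) := by
    intro r hr x hx
    have hx2 : x * x = (1 - r) ^ 2 := by rw [← hx, ← sq, sq_abs]
    have e1 : (1 - ((⟨x, r * η⟩ : ℂ)) ^ 2).re = 1 - (1 - r) ^ 2 + (r * η) ^ 2 := by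
      simp only [sub_re, one_re, pow_two, mul_re]; linarith
    have e2 : (1 - ((⟨x, r * η⟩ : ℂ)) ^ 2).im = - 2 * x * (r * η) := by
      simp only [sub_im, one_im, pow_two, mul_im]; ring
    have hη2 : η ^ 2 ≤ η := by nlinarith
    have hr2 : r ^ 2 ≤ 1 := by nlinarith [hr.1, hr.2]
    refine ⟨hρK _ ?_ ?_, ?_, e2⟩
    · rw [e1, e2, abs_mul, abs_mul, hx, abs_of_nonneg (mul_nonneg hr.1 h0.le)]
      norm_num
      have a1 : 2 * (1 - r) * (r * η) ≤ 2 * η * r := by nlinarith [hr.1, hr.2, mul_nonneg hr.1 h0.le]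
      have a2 : r ≤ 1 - (1 - r) ^ 2 + (r * η) ^ 2 := by nlinarith [hr.1, hr.2, sq_nonneg (r * η)]
      calc _ ≤ 2 * η * r := a1
        _ ≤ ρ * r := mul_le_mul_of_nonneg_right h2 hr.1
        _ ≤ _ := mul_le_mul_of_nonneg_left a2 hρ.le
    · rw [e1]; nlinarith [sq_nonneg (1 - r), sq_nonneg η, sq_nonneg (r * η)]
    · intro h
      have : (⟨x, r * η⟩ : ℂ) = 0 := by simpa using h
      simp only [Complex.ext_iff, zero_re, zero_im] at this
      rw [this.1] at hx; simp at hx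
      have : r = 1 := by linarith
      nlinarith
  set q0 : ℂ := 1 - (⟨0, η⟩ : ℂ) ^ 2 with hq0
  have q0' : q0 = ((1 + η ^ 2 : ℝ) : ℂ) := by
    apply Complex.ext <;> simp [hq0, pow_two]
  have q0K : q0 ∈ K := by
    have := (hsq 1 (by simp) 0 (by simp)).1
    simpa using this
  have segK : ∀ s : ℝ, ∀ r ∈ Icc (0:ℝ) 1, q0 + r • ((q:ℂ) - q0) ∈ {z | z ∈ K ∧ 0 ≤ s * z.im ∧ z ≠ 1} := by
    intro s r hr
    refine ⟨hK.add_smul_sub_mem q0K hq hr, ?_, ?_⟩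
    · have e : ((η:ℂ) ^ 2).im = 0 := by rw [← ofReal_pow, ofReal_im]
      rw [q0']; simp [e]
    · intro h
      rw [q0'] at h
      have := congrArg Complex.re h
      simp at this
      have : r * q + (1 - r) * (1 + η ^ 2) = 1 := by
        have e : ((η:ℂ) ^ 2).re = η ^ 2 := by rw [← ofReal_pow, ofReal_re]
        rw [e] at this; linarith
      rcases hr.1.eq_or_lt with h' | h'
      · subst h'; nlinarith
      · nlinarith [mul_pos h' (sub_pos.2 hq1), mul_nonneg (sub_nonneg.2 hr.2) (sq_nonneg η)]
  have u1 := H.star_seg su hFc.continuousOn mu' (segK 1)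
  have l1 := H.star_seg sl hFc.continuousOn ml' (segK (-1))
  have u2 := H.star_rev su hFc.continuousOn mu' (a := 0) ⟨mK0, by simp, by simp⟩
  have l2 := H.star_rev sl hFc.continuousOn ml' (a := 0) ⟨mK0, by simp, by simp⟩
  have l3 := H.star_path sl hFc.continuousOn ml' (γ := fun r : ℝ => 1 - ((1:ℂ) + r • ((⟨0, η⟩:ℂ) - 1)) ^ 2)
    (by fun_prop) (by
      intro r hr
      have e : (1:ℂ) + r • ((⟨0, η⟩:ℂ) - 1) = ⟨1 - r, r * η⟩ := by
        apply Complex.ext <;> simp; ring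
      simp only [e]
      obtain ⟨a1, a2, a3⟩ := hsq r hr (1 - r) (abs_of_nonneg (by linarith [hr.2]))
      refine ⟨a1, ?_, a2⟩
      rw [a3]; nlinarith [mul_nonneg (sub_nonneg.2 hr.2) (mul_nonneg hr.1 h0.le)])
  have u3 := H.star_path su hFc.continuousOn mu' (γ := fun r : ℝ => 1 - ((⟨0, η⟩:ℂ) + r • (-1 - (⟨0, η⟩:ℂ))) ^ 2)
    (by fun_prop) (by
      intro r hr
      have e : (⟨0, η⟩:ℂ) + r • (-1 - (⟨0, η⟩:ℂ)) = ⟨-r, (1 - r) * η⟩ := by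
        apply Complex.ext <;> simp; ring
      simp only [e]
      obtain ⟨a1, a2, a3⟩ := hsq (1 - r) ⟨by linarith [hr.2], by linarith [hr.1]⟩ (-r) (by
        rw [abs_neg, abs_of_nonneg hr.1]; ring)
      refine ⟨a1, ?_, a2⟩
      rw [a3]; nlinarith [mul_nonneg (sub_nonneg.2 hr.2) (mul_nonneg hr.1 h0.le)])
  rw [H.Lam_eq hε hg h0 h3, Leta, u2, l2, ← u1, ← l1]
  simp only [zero_smul, add_zero, one_smul, one_pow, sub_self, add_sub_cancel, even_two,
    Even.neg_pow] at l3 u3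
  have e1 : H.hs (fun w => Ew ε (w, β)) ((1:ℝ):ℂ) ⟨0, η⟩ =
      H.h (fun r : ℝ => F (1 - ((1:ℂ) + r • ((⟨0, η⟩:ℂ) - 1)) ^ 2)) := by
    simp [hs, hF, Ew]
  have e2 : H.hs (fun w => Ew ε (w, β)) ⟨0, η⟩ (-((1:ℝ):ℂ)) =
      H.h (fun r : ℝ => F (1 - ((⟨0, η⟩:ℂ) + r • (-1 - (⟨0, η⟩:ℂ))) ^ 2)) := by
    simp [hs, hF, Ew]
  rw [← hq0] at l3 u3
  rw [e1, e2, ← u3, ← l3]; group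

theorem SOS {β : ℂ} (hβ : adm ε β) {p η : ℝ} (hp : 0 < p) (hp1 : p < 1) (hη : 0 < η)
    (hg : good ε β p η) :
    H.Lam ε β = (H.hs (fun z => Ph ε (z, β)) 0 (1 - p ^ 2))⁻¹ * H.Leta ε β p η *
      H.hs (fun z => Ph ε (z, β)) 0 (1 - p ^ 2) := by
  obtain ⟨δ, hδ, hg'⟩ := hβ.good
  have hg' := hg' β (Metric.mem_ball_self hδ)
  set F : ℂ → ℂ × ℂ := fun z => Ph ε (z, β) with hF
  have hFc : Continuous F := by fun_prop
  set E : ℂ → ℂ × ℂ := fun w => Ew ε (w, β) with hE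
  have hEc : Continuous E := by fun_prop
  set σ := min δ η
  have hσ : 0 < σ := lt_min hδ hη
  have st := star_upR (a := 1) hσ (min_le_left δ η)
  rw [H.Lam_eq hε hg' hδ le_rfl, H.Leta_star hε one_pos hg' hδ le_rfl σ hσ (min_le_left _ _),
    H.Leta_star hε hp hg hη le_rfl σ hσ (min_le_right _ _)]
  have hs1 : ∀ r ∈ Icc (0:ℝ) 1, ((1:ℝ):ℂ) + r • ((p:ℂ) - (1:ℝ)) ∈ upR 1 δ := by
    intro r hr
    have e : ((1:ℝ):ℂ) + r • ((p:ℂ) - (1:ℝ)) = ((1 - r * (1 - p) : ℝ) : ℂ) := by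
      simp; ring
    rw [e]
    have h1 : 0 < 1 - r * (1 - p) := by nlinarith [hr.1, hr.2]
    refine ⟨?_, by simp, by simpa using hδ.le, by exact_mod_cast h1.ne'⟩
    rw [ofReal_re, abs_of_pos h1]; nlinarith [hr.1, hr.2]
  have hs2 : ∀ r ∈ Icc (0:ℝ) 1, (-((1:ℝ):ℂ)) + r • ((-(p:ℂ)) - (-((1:ℝ):ℂ))) ∈ upR 1 δ := by
    intro r hr
    have := hs1 r hr
    have e : (-((1:ℝ):ℂ)) + r • ((-(p:ℂ)) - (-((1:ℝ):ℂ))) = -(((1:ℝ):ℂ) + r • ((p:ℂ) - (1:ℝ))) := by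
      module
    rw [e]
    have e3 : ((1:ℝ):ℂ) + r • ((p:ℂ) - (1:ℝ)) = ((1 - r * (1 - p) : ℝ) : ℂ) := by
      simp; ring
    refine ⟨by rw [neg_re, abs_neg]; exact this.1, ?_, ?_, neg_ne_zero.2 this.2.2.2⟩
    · rw [e3]; simp
    · rw [e3]; simpa using hδ.le
  have a1 := H.star_seg st hEc.continuousOn (sect hε hg') hs1
  have a2 := H.star_seg st hEc.continuousOn (sect hε hg') hs2
  have a3 : H.hs E (-((1:ℝ):ℂ)) (-(p:ℂ)) = H.hs E ((1:ℝ):ℂ) p := by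
    apply H.hs_congr
    intro r hr
    simp only [hE, Ew]; congr 2; simp; ring
  have a4 : H.hs E ((1:ℝ):ℂ) p = H.hs F 0 (1 - p ^ 2) := by
    have hcv : Convex ℝ {z : ℂ | z.im = 0 ∧ 0 ≤ z.re ∧ z.re < 1} := by
      have l1 : IsLinearMap ℝ Complex.re := ⟨by simp, by simp⟩
      have l2 : IsLinearMap ℝ Complex.im := ⟨by simp, by simp⟩
      exact (convex_hyperplane l2 0).inter ((convex_halfSpace_ge l1 0).inter
        (convex_halfSpace_lt l1 1))
    have hm : MapsTo F {z : ℂ | z.im = 0 ∧ 0 ≤ z.re ∧ z.re < 1} Ms := by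
      rintro z ⟨h1, h2, h3⟩
      have e : z = (z.re : ℂ) := by apply Complex.ext <;> simp [h1]
      refine (Ph_iff hε _).2 ⟨?_, ?_⟩
      · have := hβ z.re ⟨h2, h3.le⟩; rw [← e] at this; exact this
      · simp only []; rw [e]; exact_mod_cast h3.ne
    have m0 : (0:ℂ) ∈ {z : ℂ | z.im = 0 ∧ 0 ≤ z.re ∧ z.re < 1} := by simp
    have := H.star_path (hcv.starConvex m0)
      hFc.continuousOn hm (γ := fun r : ℝ => 1 - (((1:ℝ):ℂ) + r • ((p:ℂ) - (1:ℝ))) ^ 2)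
      (by fun_prop) (by
        intro r hr
        have e : ((1:ℝ):ℂ) + r • ((p:ℂ) - (1:ℝ)) = ((1 - r * (1 - p) : ℝ) : ℂ) := by
          simp; ring
        simp only [e]
        have h1 : 0 < 1 - r * (1 - p) := by nlinarith [hr.1, hr.2]
        have h2 : 1 - r * (1 - p) ≤ 1 := by nlinarith [hr.1, hr.2]
        have e2 : (1:ℂ) - ((1 - r * (1 - p) : ℝ) : ℂ) ^ 2 = ((1 - (1 - r * (1 - p)) ^ 2 : ℝ) : ℂ) := by
          push_cast; ring
        rw [e2]
        refine ⟨ofReal_im _, ?_, ?_⟩ <;> rw [ofReal_re] <;> nlinarith)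
    simp only [zero_smul, add_zero, one_smul, add_sub_cancel, ofReal_one, one_pow, sub_self] at this
    rw [H.hs_self (hm m0), mul_one] at this
    rw [← this]; simp [hs, hE, hF, Ew]
  rw [← a1, ← a2, a3, a4]; simp only [hE]; group
end Hol

theorem adm_of {ε β : ℂ} (hY : bb ε β ∈ Ys) (hε : ε = 1 ∨ ε = -1)
    (h : (ε * β ^ 2).im ≠ 0 ∨ (ε * β ^ 2).re ≤ 0 ∨ 3 < (ε * β ^ 2).re) : adm ε β := by
  intro x hx
  have h0 : ε * β ^ 2 ≠ 0 := by
    apply mul_ne_zero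
    · rcases hε with rfl | rfl <;> simp
    · exact pow_ne_zero _ (bb_ne hY)
  refine ⟨hY, ?_, ?_⟩
  · simp only []
    intro e
    generalize ε * β ^ 2 = c at *
    have e' : c * ((1 + x + x ^ 2 : ℝ) : ℂ) = 3 := by rw [← e]; push_cast; ring
    have e1 := congrArg Complex.re e'
    have e2 := congrArg Complex.im e'
    rw [mul_re] at e1; rw [mul_im] at e2
    simp only [ofReal_re, ofReal_im, mul_zero, sub_zero, zero_add] at e1 e2
    norm_num at e1 e2
    have hp : 0 < 1 + x + x ^ 2 := by nlinarith [hx.1]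
    have : c.im = 0 := by rcases e2 with h | h <;> [exact h; linarith]
    rcases h with h | h | h
    · exact h this
    · nlinarith
    · nlinarith [hx.1, hx.2]
  · simp only []
    intro e
    generalize ε * β ^ 2 = c at *
    have e' : c * ((1 + x ^ 3 : ℝ) : ℂ) = ((3 * (1 - x) : ℝ) : ℂ) := by push_cast; exact e
    have e1 := congrArg Complex.re e'
    have e2 := congrArg Complex.im e'
    rw [mul_re] at e1; rw [mul_im] at e2
    simp only [ofReal_re, ofReal_im, mul_zero, sub_zero, zero_add, add_zero] at e1 e2
    have hp : 0 < 1 + x ^ 3 := by have := pow_nonneg hx.1 3; linarith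
    have h3 : 0 ≤ x ^ 3 := pow_nonneg hx.1 3
    have : c.im = 0 := by rcases mul_eq_zero.1 e2 with h | h <;> [exact h; linarith]
    rcases h with h | h | h
    · exact h this
    · have : c.re ≠ 0 := fun h' => h0 (by apply Complex.ext <;> simp [*])
      have : c.re < 0 := lt_of_le_of_ne h this
      nlinarith [hx.2]
    · nlinarith [hx.1, hx.2]

theorem clean_side {β : ℂ} (hY : bb 1 β ∈ Ys) {s : ℝ} (hs : 0 < s * (β ^ 2).im) {z : ℂ}
    (h0 : 0 ≤ z.re) (h1 : z.re ≤ 1) (h2 : z.im ^ 2 ≤ 1 / 4) (h3 : 0 ≤ s * z.im) (h4 : z ≠ 1) :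
    Ph 1 (z, β) ∈ Ms := by
  refine (Ph_iff (Or.inl rfl) _).2 ⟨⟨hY, ?_, ?_⟩, h4⟩
  · simp only [one_mul]
    intro e
    have e' : (3:ℂ) * starRingEnd ℂ (β ^ 2) = (1 + z + z ^ 2) * (normSq (β ^ 2) : ℂ) := by
      rw [← e, ← mul_conj]; ring
    have := congrArg Complex.im e'
    generalize β ^ 2 = c at *
    simp [pow_two] at this
    have hn : 0 ≤ normSq c := normSq_nonneg c
    nlinarith [mul_nonneg h3 hn, mul_nonneg (mul_nonneg h3 hn) h0, congrArg (s * ·) this]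
  · simp only [one_mul]
    intro e
    generalize β ^ 2 = c at *
    have e' : (3:ℂ) * starRingEnd ℂ c * (normSq (1 - z) : ℂ) =
        (1 + z ^ 3) * starRingEnd ℂ (1 - z) * (normSq c : ℂ) := by
      rw [← mul_conj, ← mul_conj]
      linear_combination (-1) * starRingEnd ℂ c * starRingEnd ℂ (1 - z) * e
    have := congrArg Complex.im e'
    have hz : 0 < normSq (1 - z) := normSq_pos.2 (sub_ne_zero.2 (Ne.symm h4))
    have hn : 0 ≤ normSq c := normSq_nonneg c
    generalize normSq (1 - z) = N at *
    generalize normSq c = N' at *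
    simp [pow_succ] at this
    have br : 0 ≤ 1 + 3 * z.re ^ 2 - 2 * z.re ^ 3 - z.im ^ 2 - 2 * z.re * z.im ^ 2 := by
      nlinarith [mul_nonneg (mul_nonneg h0 h0) (sub_nonneg.2 h1), mul_nonneg h0 (sub_nonneg.2 h2),
        mul_nonneg h0 h0]
    have k1 : 0 ≤ (s * z.im) * (1 + 3 * z.re ^ 2 - 2 * z.re ^ 3 - z.im ^ 2 - 2 * z.re * z.im ^ 2) * N' :=
      mul_nonneg (mul_nonneg h3 br) hn
    have k2 : 0 < (s * c.im) * N := mul_pos hs hz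
    nlinarith [congrArg (s * ·) this]

theorem clean_real {k β0 : ℝ} (hk : 0 < k) (hβ : β0 ≠ 0) (heq : β0 ^ 2 * (1 + k ^ 3) = 3 * (1 - k))
    (hb1 : β0 ^ 2 < 1) (hY : bb 1 β0 ∈ Ys) {z : ℂ} (h0 : 0 ≤ z.re) (h1 : z.re ≤ 1)
    (h2 : z.im ^ 2 ≤ 1 / 4) (h3 : z ≠ k) (h4 : z ≠ 1) : Ph 1 (z, β0) ∈ Ms := by
  have hpos : 0 < β0 ^ 2 := by positivity
  refine (Ph_iff (Or.inl rfl) _).2 ⟨⟨hY, ?_, ?_⟩, h4⟩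
  · simp only [one_mul, ← ofReal_pow]
    intro e
    have e1 := congrArg Complex.re e
    have e2 := congrArg Complex.im e
    rw [re_ofReal_mul] at e1; rw [im_ofReal_mul] at e2
    simp [pow_two] at e1 e2
    rcases e2 with e2 | e2
    · exact hβ e2
    · have : z.im * (1 + 2 * z.re) = 0 := by linarith
      have : z.im = 0 := by rcases mul_eq_zero.1 this with h | h <;> [exact h; linarith]
      rw [this] at e1
      nlinarith [mul_nonneg h0 (sub_nonneg.2 h1)]
  · simp only [one_mul, ← ofReal_pow]
    intro e
    have e1 := congrArg Complex.re e
    have e2 := congrArg Complex.im e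
    rw [re_ofReal_mul] at e1; rw [im_ofReal_mul] at e2
    simp [pow_succ] at e1 e2
    have hz : z.im = 0 := by
      by_contra hz
      have : z.im * (β0 ^ 2 * (3 * z.re ^ 2 - z.im ^ 2) + 3) = 0 := by linarith
      rcases mul_eq_zero.1 this with h | h
      · exact hz h
      · nlinarith [mul_nonneg hpos.le (sq_nonneg z.re)]
    rw [hz] at e1
    have e3 : (z.re - k) * (β0 ^ 2 * (z.re ^ 2 + z.re * k + k ^ 2) + 3) = 0 := by
      linear_combination e1 - heq
    have : z.re = k := by
      rcases mul_eq_zero.1 e3 with h | h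
      · linarith
      · have : 0 ≤ β0 ^ 2 * (z.re ^ 2 + z.re * k + k ^ 2) := by positivity
        linarith
    exact h3 (Complex.ext (by simpa using this) (by simpa using hz))

namespace Hol
variable {G : Type*} [Group G] (H : Hol (ℂ × ℂ) Ms G)

noncomputable def Sd (s k c : ℝ) (β : ℂ) : G :=
  H.hs (fun z => Ph 1 (z, β)) ⟨k, s / 2⟩ c * H.hs (fun z => Ph 1 (z, β)) 0 ⟨k, s / 2⟩

theorem jside {k β0 p s : ℝ} (hk : 0 < k) (hβ : β0 ≠ 0)
    (heq : β0 ^ 2 * (1 + k ^ 3) = 3 * (1 - k)) (hb1 : β0 ^ 2 < 1) (hY : bb 1 β0 ∈ Ys)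
    (hs : s = 1 ∨ s = -1) (hp : 0 < p) (hpk : p ^ 2 < 1 - k)
    (hg : ∀ β' ∈ Metric.ball (β0:ℂ) p, good 1 β' p p) :
    ∀ᶠ β in 𝓝 (β0:ℂ), 0 < s * (β ^ 2).im →
      H.Lam 1 β = H.hs (fun b => ((0:ℂ), bb 1 b)) (β0:ℂ) β *
      ((H.Sd s k (1 - p ^ 2) β0)⁻¹ * H.Leta 1 β0 p p * H.Sd s k (1 - p ^ 2) β0) *
      (H.hs (fun b => ((0:ℂ), bb 1 b)) (β0:ℂ) β)⁻¹ := by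
  set m : ℂ := ⟨k, s / 2⟩ with hm
  have hss : s * s = 1 := by rcases hs with rfl | rfl <;> norm_num
  have hk1 : k < 1 := by nlinarith
  have hp1 : p < 1 := by nlinarith
  set c : ℂ := ((1 - p ^ 2 : ℝ) : ℂ) with hc
  set R : Set ℂ := {z | 0 ≤ z.re ∧ z.re ≤ 1 - p ^ 2 ∧ 0 ≤ s * z.im ∧ s * z.im ≤ 1 / 2} with hR
  have hRc : Convex ℝ R := by
    have l1 : IsLinearMap ℝ Complex.re := ⟨by simp, by simp⟩
    have l2 : IsLinearMap ℝ (fun z : ℂ => s * z.im) := ⟨fun x y => by simp; ring, fun x y => by simp; ring⟩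
    exact (convex_halfSpace_ge l1 0).inter ((convex_halfSpace_le l1 _).inter
      ((convex_halfSpace_ge l2 0).inter (convex_halfSpace_le l2 _)))
  have hRi : ∀ z ∈ R, 0 ≤ z.re ∧ z.re ≤ 1 ∧ z.im ^ 2 ≤ 1 / 4 ∧ 0 ≤ s * z.im ∧ z ≠ 1 := by
    rintro z ⟨h1, h2, h3, h4⟩
    refine ⟨h1, by nlinarith, ?_, h3, ?_⟩
    · have : z.im ^ 2 = (s * z.im) ^ 2 := by rw [mul_pow, pow_two s, hss, one_mul]
      rw [this]; nlinarith
    · rintro rfl; simp at h2; nlinarith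
  have m0 : (0:ℂ) ∈ R := ⟨by simp, by simpa [-sq_le_one_iff_abs_le_one] using (show (0:ℝ) ≤ 1 - p ^ 2 by nlinarith), by simp, by simp⟩
  have mm : m ∈ R := ⟨by simp [hm, hk.le], by simp [hm]; linarith, by simp [hm]; nlinarith,
    by simp [hm]; nlinarith⟩
  have mc : c ∈ R := ⟨by rw [hc, ofReal_re]; nlinarith, by rw [hc, ofReal_re], by rw [hc, ofReal_im]; simp,
    by rw [hc, ofReal_im]; simp⟩
  -- segments avoid k
  have hsm : 0 < s * m.im := by simp [hm]; nlinarith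
  have av : ∀ v ∈ R, v.im = 0 → v ≠ k → ∀ z ∈ segment ℝ m v, z ∈ R ∧ z ≠ k := by
    intro v hv hvi hvk z hz
    refine ⟨hRc.segment_subset mm hv hz, ?_⟩
    obtain ⟨a, b, ha, hb, hab, rfl⟩ := hz
    intro h
    have e2 := congrArg Complex.im h
    simp [hvi] at e2
    rcases e2 with e2 | e2
    · subst e2
      obtain rfl : b = 1 := by linarith
      simp at h; exact hvk h
    · rw [e2] at hsm; simp at hsm
  have cl : ∀ v ∈ R, v.im = 0 → v ≠ k → ∃ δ > 0, ∀ q ∈ segment ℝ m v ×ˢ Metric.ball (β0:ℂ) δ,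
      Ph 1 q ∈ Ms := by
    intro v hv hvi hvk
    have hcomp : IsCompact (segment ℝ m v ×ˢ ({(β0:ℂ)} : Set ℂ)) := by
      refine IsCompact.prod ?_ isCompact_singleton
      rw [segment_eq_image_lineMap]; exact isCompact_Icc.image (by fun_prop)
    obtain ⟨δ, hδ, hsub⟩ := hcomp.exists_thickening_subset_open
      (isOpen_Ms.preimage (cont_Ph 1)) (by
        rintro ⟨z, b⟩ ⟨h1, h2⟩
        obtain rfl : b = β0 := h2
        obtain ⟨h3, h4⟩ := av v hv hvi hvk z h1
        obtain ⟨r1, r2, r3, r4, r5⟩ := hRi z h3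
        exact clean_real hk hβ heq hb1 hY r1 r2 r3 h4 r5)
    refine ⟨δ, hδ, fun q hq => hsub ?_⟩
    rw [Metric.mem_thickening_iff]
    refine ⟨(q.1, (β0:ℂ)), ⟨hq.1, rfl⟩, ?_⟩
    rw [Prod.dist_eq]
    simpa using hq.2
  obtain ⟨δ1, hδ1, cl1⟩ := cl 0 m0 (by simp) (by exact_mod_cast hk.ne)
  obtain ⟨δ2, hδ2, cl2⟩ := cl c mc (by rw [hc, ofReal_im]) (by
    rw [hc]; exact_mod_cast (show (1 - p ^ 2 : ℝ) ≠ k by linarith))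
  filter_upwards [Metric.ball_mem_nhds _ hδ1, Metric.ball_mem_nhds _ hδ2, Metric.ball_mem_nhds _ hp]
    with β hb1' hb2' hbp hsβ
  have hYβ : bb 1 β ∈ Ys := by
    have := (hg β hbp).2 0 (by simpa using hp.le) (by simpa using hp.le)
    exact this.1
  have hadm : adm 1 β := adm_of hYβ (Or.inl rfl) (Or.inl (by
    rw [one_mul]; rintro h; rw [h] at hsβ; simp at hsβ))
  have q1 := H.quad (K := segment ℝ m 0 ×ˢ Metric.ball (β0:ℂ) δ1) (F := Ph 1)
    ((convex_segment _ _).prod (convex_ball _ _)) (cont_Ph 1).continuousOn cl1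
    (a := (0, (β0:ℂ))) (b := (m, (β0:ℂ))) (c := (0, β)) (d := (m, β))
    ⟨right_mem_segment _ _ _, Metric.mem_ball_self hδ1⟩ ⟨left_mem_segment _ _ _, Metric.mem_ball_self hδ1⟩
    ⟨right_mem_segment _ _ _, hb1'⟩ ⟨left_mem_segment _ _ _, hb1'⟩
  have q2 := H.quad (K := segment ℝ m c ×ˢ Metric.ball (β0:ℂ) δ2) (F := Ph 1)
    ((convex_segment _ _).prod (convex_ball _ _)) (cont_Ph 1).continuousOn cl2
    (a := (m, (β0:ℂ))) (b := (c, (β0:ℂ))) (c := (m, β)) (d := (c, β))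
    ⟨left_mem_segment _ _ _, Metric.mem_ball_self hδ2⟩ ⟨right_mem_segment _ _ _, Metric.mem_ball_self hδ2⟩
    ⟨left_mem_segment _ _ _, hb2'⟩ ⟨right_mem_segment _ _ _, hb2'⟩
  have e1 : ∀ (b u v : ℂ), H.hs (Ph 1) (u, b) (v, b) = H.hs (fun z => Ph 1 (z, b)) u v := by
    intro b u v; apply H.hs_congr; intro r hr; simp
  have e2 : H.hs (Ph 1) (0, (β0:ℂ)) (0, β) = H.hs (fun b => ((0:ℂ), bb 1 b)) (β0:ℂ) β := by
    apply H.hs_congr; intro r hr; simp [Ph]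
  have e3 : H.hs (Ew 1) (p, (β0:ℂ)) (p, β) = H.hs (Ph 1) (c, (β0:ℂ)) (c, β) := by
    apply H.hs_congr; intro r hr; simp [Ew, hc]
  have o := H.Leta_loc (Or.inl rfl) hp hp hg hbp
  rw [e3] at o
  rw [e1, e1, e2] at q1
  rw [e1, e1] at q2
  have sos := H.SOS (Or.inl rfl) hadm hp hp1 hp (hg β hbp)
  have tr := H.tri hRc (F := fun z => Ph 1 (z, β)) (by fun_prop) (by
    intro z hz
    obtain ⟨r1, r2, r3, r4, r5⟩ := hRi z hz
    exact clean_side hYβ hsβ r1 r2 r3 r4 r5) m0 mm mc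
  have hcc : (1 : ℂ) - (p:ℂ) ^ 2 = c := by simp [hc]
  rw [sos, hcc, ← tr]
  unfold Sd
  have hcc' : ((1 - p ^ 2 : ℝ) : ℂ) = c := rfl
  rw [hcc', ← hm]
  generalize H.hs (fun b => ((0:ℂ), bb 1 b)) (β0:ℂ) β = κ at *
  generalize H.hs (Ph 1) (c, (β0:ℂ)) (c, β) = kc at *
  generalize H.hs (Ph 1) (m, (β0:ℂ)) (m, β) = km at *
  have o' : H.Leta 1 β p p = kc * H.Leta 1 β0 p p * kc⁻¹ := by rw [← o]; group
  rw [← mul_inv_eq_iff_eq_mul] at q1 q2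
  rw [o', ← q1, ← q2]; group

theorem jump {k β0 : ℝ} (hk : 0 < k) (hk1 : k < 1) (hβ : β0 ≠ 0)
    (heq : β0 ^ 2 * (1 + k ^ 3) = 3 * (1 - k)) (hb1 : β0 ^ 2 < 1) (hY : bb 1 β0 ∈ Ys) :
    ∃ P : G, ∀ᶠ β in 𝓝 (β0:ℂ),
      ((β ^ 2).im < 0 → H.Lam 1 β = H.hs (fun b => ((0:ℂ), bb 1 b)) (β0:ℂ) β * P *
        (H.hs (fun b => ((0:ℂ), bb 1 b)) (β0:ℂ) β)⁻¹) ∧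
      (0 < (β ^ 2).im → H.Lam 1 β = H.hs (fun b => ((0:ℂ), bb 1 b)) (β0:ℂ) β *
        (H.Lam (-1) (k * β0 : ℝ) * P * (H.Lam (-1) (k * β0 : ℝ))⁻¹) *
        (H.hs (fun b => ((0:ℂ), bb 1 b)) (β0:ℂ) β)⁻¹) := by
  have hpos : 0 < β0 ^ 2 := by positivity
  obtain ⟨p, hp, hpk, hg⟩ : ∃ p : ℝ, 0 < p ∧ p ^ 2 < 1 - k ∧
      ∀ β' ∈ Metric.ball (β0:ℂ) p, good 1 β' p p := by
    have hO : IsOpen ((fun p : ℂ × ℂ => (1 - p.1 ^ 2, p.2)) ⁻¹' Nn 1) :=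
      (isOpen_Nn 1).preimage (by fun_prop)
    obtain ⟨δ, hδ, hb⟩ := Metric.isOpen_iff.1 hO (0, (β0:ℂ)) (by
      refine ⟨hY, ?_, ?_⟩
      · simp only [one_mul, ← ofReal_pow]
        intro h
        have h2 : ((β0 ^ 2 * 3 : ℝ) : ℂ) = ((3 : ℝ) : ℂ) := by push_cast; push_cast at h; linear_combination h
        have h3 := ofReal_injective h2
        linarith
      · simp only [one_mul]
        intro h
        have h2 : ((β0 ^ 2 : ℝ) : ℂ) = 0 := by push_cast; linear_combination h / 2
        have h3 : β0 ^ 2 = 0 := by exact_mod_cast h2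
        linarith)
    refine ⟨min (δ / 3) ((1 - k) / 2), by apply lt_min <;> linarith, ?_, ?_⟩
    · have h1 := min_le_right (δ / 3) ((1 - k) / 2)
      have h2 : 0 < min (δ / 3) ((1 - k) / 2) := by apply lt_min <;> linarith
      nlinarith
    · have h1 := min_le_left (δ / 3) ((1 - k) / 2)
      intro β' hβ'
      refine ⟨by apply lt_min <;> linarith, fun w hw1 hw2 => hb (a := (w, β')) ?_⟩
      rw [Metric.mem_ball, Prod.dist_eq, max_lt_iff]
      constructor
      · simp only [dist_zero_right]
        have := Complex.norm_le_abs_re_add_abs_im w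
        linarith
      · have := Metric.mem_ball.1 hβ'; simp only []; linarith
  have j1 := H.jside hk hβ heq hb1 hY (Or.inl rfl) hp hpk hg
  have j2 := H.jside hk hβ heq hb1 hY (Or.inr rfl) hp hpk hg
  have hbb : bb (-1) (k * β0 : ℝ) = bb 1 β0 := by
    have : ((β0 ^ 2 * (1 + k ^ 3) : ℝ):ℂ) = ((3 * (1 - k) : ℝ) : ℂ) := by rw [heq]
    push_cast at this
    simp only [bb]; push_cast; linear_combination (2 * (β0:ℂ)) * this
  have hp2 : 0 < p ^ 2 := by positivity
  have hmu : k * |1 / 2 / k| ≤ 1 / 2 := by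
    rw [abs_div, abs_of_pos hk]; field_simp; norm_num
  have hml : k * |-1 / 2 / k| ≤ 1 / 2 := by
    rw [abs_div, abs_of_pos hk]; field_simp; norm_num
  have ll := H.LL (ε := -1) (β := (k * β0 : ℝ)) (Or.inr rfl)
    (adm_of (by rw [hbb]; exact hY) (Or.inr rfl) (Or.inr (Or.inl (by
      rw [← ofReal_pow]; simp; rw [← ofReal_mul, ← ofReal_pow, ofReal_re]; positivity))))
    (K := {z | 0 ≤ z.re ∧ k * z.re ≤ 1 - p ^ 2 ∧ k * |z.im| ≤ 1 / 2})
    (by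
      have l1 : IsLinearMap ℝ Complex.re := ⟨by simp, by simp⟩
      have l2 : IsLinearMap ℝ (fun z : ℂ => k * z.re) := ⟨fun x y => by simp; ring, fun x y => by simp; ring⟩
      refine (convex_halfSpace_ge l1 0).inter ((convex_halfSpace_le l2 _).inter ?_)
      intro x hx y hy a b ha hb hab
      have hx' : k * |x.im| ≤ 1 / 2 := hx
      have hy' : k * |y.im| ≤ 1 / 2 := hy
      show k * |(a • x + b • y).im| ≤ 1 / 2
      simp only [add_im, real_smul, im_ofReal_mul]
      have := abs_add_le (a * x.im) (b * y.im)
      rw [abs_mul, abs_mul, abs_of_nonneg ha, abs_of_nonneg hb] at this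
      nlinarith [mul_le_mul_of_nonneg_left this hk.le])
    (ρ := min (1 / 4) (1 - p ^ 2 - k)) (by apply lt_min <;> linarith)
    (by
      intro z h1 h2
      have a1 := min_le_left (1 / 4) (1 - p ^ 2 - k)
      have a2 := min_le_right (1 / 4) (1 - p ^ 2 - k)
      have a3 : 0 < min (1 / 4) (1 - p ^ 2 - k) := by apply lt_min <;> linarith
      have a4 : 0 ≤ z.re := by
        by_contra! h; nlinarith [abs_nonneg z.im]
      refine ⟨a4, by nlinarith, ?_⟩
      nlinarith [abs_nonneg z.im])
    (by
      rintro z ⟨h1, h2, h3⟩ h4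
      have e : Ph (-1) (z, ((k * β0 : ℝ):ℂ)) = Ph 1 (k * z, (β0:ℂ)) := by
        unfold Ph; rw [hbb]; congr 1; push_cast; ring
      rw [e]
      refine clean_real hk hβ heq hb1 hY ?_ ?_ ?_ ?_ ?_
      · simp; positivity
      · simp; linarith
      · simp; rw [← sq_abs, abs_mul, abs_of_pos hk]; nlinarith [mul_nonneg hk.le (abs_nonneg z.im)]
      · intro h; apply h4
        have : (k:ℂ) ≠ 0 := by exact_mod_cast hk.ne'
        field_simp at h; exact h
      · intro h; have := congrArg Complex.re h; simp at this; linarith)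
    (mu := ⟨1, 1 / 2 / k⟩) (ml := ⟨1, -1 / 2 / k⟩) (q := (1 - p ^ 2) / k)
    ⟨by simp, by simp; linarith, hmu⟩
    ⟨by simp, by simp; linarith, hml⟩
    (by simp; positivity) (by simp; exact div_neg_of_neg_of_pos (by norm_num) hk)
    ⟨by rw [ofReal_re]; apply div_nonneg <;> linarith, by rw [ofReal_re]; field_simp; rfl,
      by rw [ofReal_im]; simp⟩
    (by rw [lt_div_iff₀ hk]; linarith)
  have ek : ∀ u v : ℂ, H.hs (fun z => Ph (-1) (z, ((k * β0 : ℝ):ℂ))) u v =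
      H.hs (fun z => Ph 1 (z, (β0:ℂ))) (k * u) (k * v) := by
    intro u v; apply H.hs_congr; intro r hr
    unfold Ph; rw [hbb]; congr 1; simp; ring
  have k0 : (k:ℂ) ≠ 0 := by exact_mod_cast hk.ne'
  have em : ∀ s : ℝ, (k:ℂ) * ⟨1, s / 2 / k⟩ = ⟨k, s / 2⟩ := fun s => by
    apply Complex.ext <;> simp; field_simp
  have ec : (k:ℂ) * (((1 - p ^ 2) / k : ℝ) : ℂ) = ((1 - p ^ 2 : ℝ) : ℂ) := by
    push_cast; field_simp
  rw [ek, ek, ek, ek, em, em, ec, mul_zero] at ll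
  have ll' : H.Lam (-1) (k * β0 : ℝ) = (H.Sd 1 k (1 - p ^ 2) β0)⁻¹ * H.Sd (-1) k (1 - p ^ 2) β0 := ll
  refine ⟨(H.Sd (-1) k (1 - p ^ 2) β0)⁻¹ * H.Leta 1 β0 p p * H.Sd (-1) k (1 - p ^ 2) β0, ?_⟩
  filter_upwards [j1, j2] with β h1 h2
  refine ⟨fun h => h2 (by linarith), fun h => ?_⟩
  rw [h1 (by linarith), ll']; group
end Hol

theorem bb1_re (x y : ℝ) : (bb 1 ⟨x, y⟩).re = 2 * x * (3 - x ^ 2 + 3 * y ^ 2) := by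
  simp [bb, pow_succ]; ring
theorem bb1_im (x y : ℝ) : (bb 1 ⟨x, y⟩).im = 2 * y * (3 - 3 * x ^ 2 + y ^ 2) := by
  simp [bb, pow_succ]; ring
theorem bbm_re (x y : ℝ) : (bb (-1) ⟨x, y⟩).re = 2 * x * (3 + x ^ 2 - 3 * y ^ 2) := by
  simp [bb, pow_succ]; ring
theorem bbm_im (x y : ℝ) : (bb (-1) ⟨x, y⟩).im = 2 * y * (3 + 3 * x ^ 2 - y ^ 2) := by
  simp [bb, pow_succ]; ring
theorem adm1 {β : ℂ} (hY : bb 1 β ∈ Ys) (h : β.im ≠ 0 ∨ 3 < β.re ^ 2) : adm 1 β := by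
  refine adm_of hY (Or.inl rfl) ?_
  have e1 : (1 * β ^ 2).im = 2 * β.re * β.im := by simp [pow_two]; ring
  have e2 : (1 * β ^ 2).re = β.re ^ 2 - β.im ^ 2 := by simp [pow_two]
  rw [e1, e2]
  by_cases hi : β.im = 0
  · right; right; simpa [hi] using h
  · by_cases hr : β.re = 0
    · right; left; rw [hr]; nlinarith [sq_nonneg β.im]
    · left; simp [hi, hr]
theorem admm {β : ℂ} (hY : bb (-1) β ∈ Ys) (h : β.re ≠ 0 ∨ 3 < β.im ^ 2) : adm (-1) β := by
  refine adm_of hY (Or.inr rfl) ?_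
  have e1 : (-1 * β ^ 2).im = -2 * β.re * β.im := by simp [pow_two]; ring
  have e2 : (-1 * β ^ 2).re = β.im ^ 2 - β.re ^ 2 := by simp [pow_two]
  rw [e1, e2]
  by_cases hi : β.re = 0
  · right; right; simpa [hi] using h
  · by_cases hr : β.im = 0
    · right; left; rw [hr]; nlinarith [sq_nonneg β.re]
    · left; simp [hi, hr]
theorem seg_r {p q β : ℂ} (h : β ∈ segment ℝ p q) : ∃ r : ℝ, 0 ≤ r ∧ r ≤ 1 ∧
    β = ⟨p.re + r * (q.re - p.re), p.im + r * (q.im - p.im)⟩ := by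
  rw [segment_eq_image'] at h
  obtain ⟨r, hr, rfl⟩ := h
  exact ⟨r, hr.1, hr.2, by apply Complex.ext <;> simp⟩

namespace Hol
variable {G : Type*} [Group G] (H : Hol (ℂ × ℂ) Ms G)

theorem s3 {a b c d : ℝ} (h : ∀ r : ℝ, 0 ≤ r → r ≤ 1 → ∀ x y : ℝ, x = a + r * (c - a) →
    y = b + r * (d - b) → (y ≠ 0 ∨ 3 < x ^ 2) ∧
      (2 * x * (3 - x ^ 2 + 3 * y ^ 2) < 0 ∨ 2 * y * (3 - 3 * x ^ 2 + y ^ 2) < 0)) :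
    H.L3 1 ⟨a, b⟩ = H.L3 1 ⟨c, d⟩ := by
  refine H.L3_seg (Or.inl rfl) fun β hβ => ?_
  obtain ⟨r, h0, h1, rfl⟩ := seg_r hβ
  obtain ⟨h2, h3⟩ := h r h0 h1 _ _ rfl rfl
  have : bb 1 ⟨a + r * (c - a), b + r * (d - b)⟩ ∈ D3 := by
    unfold D3; rw [mem_ofPred_eq, bb1_re, bb1_im]; exact h3
  exact ⟨adm1 (D3_sub this) h2, this⟩
theorem s1 {a b c d : ℝ} (h : ∀ r : ℝ, 0 ≤ r → r ≤ 1 → ∀ x y : ℝ, x = a + r * (c - a) →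
    y = b + r * (d - b) → (y ≠ 0 ∨ 3 < x ^ 2) ∧ ∀ X Y : ℝ, X = 2 * x * (3 - x ^ 2 + 3 * y ^ 2) →
      Y = 2 * y * (3 - 3 * x ^ 2 + y ^ 2) → (0 < X ∧ X < 4) ∨ (0 < Y ∧ Y < 4) ∨
        (0 < X ∧ 0 < Y) ∨ (4 < X ∧ Y < 4) ∨ (4 < Y ∧ X < 4)) :
    H.L1 1 ⟨a, b⟩ = H.L1 1 ⟨c, d⟩ := by
  refine H.L1_seg (Or.inl rfl) fun β hβ => ?_
  obtain ⟨r, h0, h1, rfl⟩ := seg_r hβ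
  obtain ⟨h2, h3⟩ := h r h0 h1 _ _ rfl rfl
  have : bb 1 ⟨a + r * (c - a), b + r * (d - b)⟩ ∈ D1 := by
    unfold D1; rw [mem_ofPred_eq, bb1_re, bb1_im]
    specialize h3 _ _ rfl rfl
    refine ⟨?_, ?_, ?_⟩
    · rcases h3 with h | h | h | h | h
      · exact Or.inl h.1
      · exact Or.inr h.1
      · exact Or.inl h.1
      · exact Or.inl (by linarith [h.1])
      · exact Or.inr (by linarith [h.1])
    · rintro ⟨h4, h5⟩; rcases h3 with h | h | h | h | h <;> linarith [h.1, h.2]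
    · rintro ⟨h4, h5⟩; rcases h3 with h | h | h | h | h <;> linarith [h.1, h.2]
  exact ⟨adm1 (D1_sub this) h2, this⟩

omit H in
theorem cneg {a c r : ℝ} (ha : a < 0) (hc : c < 0) (h0 : 0 ≤ r) (h1 : r ≤ 1) :
    a + r * (c - a) < 0 := by
  rcases h1.eq_or_lt with rfl | h1
  · linarith
  · nlinarith

theorem q2 {x y : ℝ} (hx : x < 0) (hy : 0 < y) : H.L3 1 ⟨x, y⟩ = H.L3 1 ⟨-1, 1⟩ := by
  refine H.s3 fun r h0 h1 X Y hX hY => ?_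
  have hX' : X < 0 := hX ▸ cneg hx (by norm_num) h0 h1
  have hY' : 0 < Y := by
    have := cneg (a := -y) (c := -1) (by linarith) (by norm_num) h0 h1
    rw [hY]; linarith
  refine ⟨Or.inl hY'.ne', ?_⟩
  by_cases h : X ^ 2 < 3 + 3 * Y ^ 2
  · left; nlinarith [mul_pos_of_neg_of_neg hX' (show -(3 - X ^ 2 + 3 * Y ^ 2) < 0 by linarith)]
  · right; nlinarith [mul_pos hY' (show 0 < -(3 - 3 * X ^ 2 + Y ^ 2) by nlinarith [sq_nonneg Y])]

theorem q3 {a b : ℝ} (h : ∀ r : ℝ, 0 ≤ r → r ≤ 1 → ∀ x y : ℝ, x = a + r * (0 - a) →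
    y = b + r * (-1 - b) → x ≤ 0 ∧ x ^ 2 < 3 + 3 * y ^ 2) (hb : b < 0) :
    H.L3 1 ⟨a, b⟩ = H.L3 1 ⟨0, -1⟩ := by
  refine H.s3 fun r h0 h1 X Y hX hY => ?_
  have hY' : Y < 0 := hY ▸ cneg hb (by norm_num) h0 h1
  obtain ⟨h2, h3⟩ := h r h0 h1 X Y hX hY
  refine ⟨Or.inl hY'.ne, ?_⟩
  rcases h2.eq_or_lt with rfl | h2
  · right; nlinarith [mul_neg_of_neg_of_pos hY' (show 0 < 3 + Y ^ 2 by positivity)]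
  · left; nlinarith [mul_pos_of_neg_of_neg h2 (show -(3 - X ^ 2 + 3 * Y ^ 2) < 0 by linarith)]

theorem q4 {a b : ℝ} (ha : 0 ≤ a) (ha1 : a ^ 2 < 1) (hb : b < 0) :
    H.L3 1 ⟨a, b⟩ = H.L3 1 ⟨0, -1⟩ := by
  refine H.s3 fun r h0 h1 X Y hX hY => ?_
  have hY' : Y < 0 := hY ▸ cneg hb (by norm_num) h0 h1
  have hX' : X ^ 2 < 1 := by
    have : X = (1 - r) * a := by rw [hX]; ring
    rw [this]; nlinarith [sq_nonneg a, mul_nonneg h0 (sq_nonneg a), mul_nonneg h0 (sub_nonneg.2 h1)]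
  refine ⟨Or.inl hY'.ne, Or.inr ?_⟩
  nlinarith [mul_neg_of_neg_of_pos hY' (show 0 < 3 - 3 * X ^ 2 + Y ^ 2 by nlinarith [sq_nonneg Y])]

theorem W_of {x y X Y : ℝ} (hX : X = 2 * x * (3 - x ^ 2 + 3 * y ^ 2))
    (hY : Y = 2 * y * (3 - 3 * x ^ 2 + y ^ 2)) {j} (h : (⟨X, Y⟩ : ℂ) ∈ W j) :
    H.L1 1 ⟨x, y⟩ = H.Y.om j * H.L3 1 ⟨x, y⟩ * (H.Y.om j)⁻¹ := by
  apply H.L1_L3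
  convert h using 1
  apply Complex.ext
  · rw [bb1_re, hX]
  · rw [bb1_im, hY]

theorem hyp {a b c d : ℝ} (hb : b < 0) (hd : d < 0) (h : ∀ r : ℝ, 0 ≤ r → r ≤ 1 → ∀ x y : ℝ,
    x = a + r * (c - a) → y = b + r * (d - b) → x < 0 ∧ 3 + 3 * y ^ 2 < x ^ 2) :
    H.L1 1 ⟨a, b⟩ = H.L1 1 ⟨c, d⟩ := by
  refine H.s1 fun r h0 h1 x y hx hy => ?_
  obtain ⟨h2, h3⟩ := h r h0 h1 x y hx hy
  have hY' : y < 0 := hy ▸ cneg hb hd h0 h1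
  refine ⟨Or.inl hY'.ne, fun X Y hX hY => Or.inr (Or.inr (Or.inl ⟨?_, ?_⟩))⟩
  · rw [hX]; nlinarith [mul_pos_of_neg_of_neg h2 (show (3 - x ^ 2 + 3 * y ^ 2) < 0 by linarith)]
  · rw [hY]; nlinarith [mul_pos_of_neg_of_neg hY' (show (3 - 3 * x ^ 2 + y ^ 2) < 0 by nlinarith [sq_nonneg y])]

theorem rel1 : H.Y.om 0 * H.L3 1 ⟨-1, 1⟩ * (H.Y.om 0)⁻¹ = H.Y.om 1 * H.L3 1 ⟨-1, 1⟩ * (H.Y.om 1)⁻¹ ∧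
    H.Y.om 0 * H.L3 1 ⟨-1, 1⟩ * (H.Y.om 0)⁻¹ = H.Y.om 2 * H.L3 1 ⟨0, -1⟩ * (H.Y.om 2)⁻¹ ∧
    H.Y.om 0 * H.L3 1 ⟨-1, 1⟩ * (H.Y.om 0)⁻¹ = H.Y.om 3 * H.L3 1 ⟨0, -1⟩ * (H.Y.om 3)⁻¹ := by
  have a0 := H.W_of (x := -1.9) (y := 0.05) rfl rfl (j := 0) (by simp [W]; norm_num)
  have a1 := H.W_of (x := -3) (y := 0.05) rfl rfl (j := 1) (by simp [W]; norm_num)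
  have a2 := H.W_of (x := -1.7) (y := -0.1) rfl rfl (j := 2) (by simp [W]; norm_num)
  have a3 := H.W_of (x := -2.4) (y := -1) rfl rfl (j := 3) (by simp [W]; norm_num)
  rw [H.q2 (by norm_num) (by norm_num)] at a0 a1
  rw [H.q3 (fun r h0 h1 x y hx hy => ⟨by nlinarith, by subst hx hy; nlinarith⟩) (by norm_num)] at a2 a3
  have b0 : H.L1 1 ⟨-1.9, 0.05⟩ = H.L1 1 ⟨-1.9, -0.05⟩ := H.s1 fun r h0 h1 x y hx hy => by
    have hx' : x = -1.9 := by linarith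
    have hy2 : y ^ 2 ≤ 0.0025 := by rw [hy]; nlinarith
    subst hx'
    exact ⟨Or.inr (by norm_num), fun X Y hX hY => Or.inl ⟨by rw [hX]; nlinarith, by rw [hX]; nlinarith [sq_nonneg y]⟩⟩
  have b1 : H.L1 1 ⟨-3, 0.05⟩ = H.L1 1 ⟨-3, -0.05⟩ := H.s1 fun r h0 h1 x y hx hy => by
    have hx' : x = -3 := by linarith
    have hy2 : y ^ 2 ≤ 0.0025 := by rw [hy]; nlinarith
    have hy3 : -0.05 ≤ y := by rw [hy]; nlinarith
    subst hx'
    exact ⟨Or.inr (by norm_num), fun X Y hX hY => Or.inr (Or.inr (Or.inr (Or.inl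
      ⟨by rw [hX]; nlinarith, by rw [hY]; nlinarith [sq_nonneg y]⟩)))⟩
  have c01 : H.L1 1 ⟨-1.9, -0.05⟩ = H.L1 1 ⟨-3, -0.05⟩ := H.hyp (by norm_num) (by norm_num)
    fun r h0 h1 x y hx hy => ⟨by nlinarith, by subst hx hy; nlinarith⟩
  have c02 : H.L1 1 ⟨-1.9, -0.05⟩ = H.L1 1 ⟨-1.8, -0.1⟩ := H.hyp (by norm_num) (by norm_num)
    fun r h0 h1 x y hx hy => ⟨by nlinarith, by subst hx hy; nlinarith⟩
  have c13 : H.L1 1 ⟨-3, -0.05⟩ = H.L1 1 ⟨-2.5, -1⟩ := H.hyp (by norm_num) (by norm_num)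
    fun r h0 h1 x y hx hy => ⟨by nlinarith, by subst hx hy; nlinarith⟩
  have d2 : H.L1 1 ⟨-1.8, -0.1⟩ = H.L1 1 ⟨-1.7, -0.1⟩ := H.s1 fun r h0 h1 x y hx hy => by
    have hy' : y = -0.1 := by linarith
    have h5 : 2.8 ≤ x ^ 2 := by rw [hx]; nlinarith
    have h6 : x ^ 2 ≤ 3.3 := by rw [hx]; nlinarith
    subst hy'
    exact ⟨Or.inl (by norm_num), fun X Y hX hY => Or.inr (Or.inl ⟨by rw [hY]; nlinarith, by rw [hY]; nlinarith⟩)⟩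
  have d3 : H.L1 1 ⟨-2.5, -1⟩ = H.L1 1 ⟨-2.4, -1⟩ := H.s1 fun r h0 h1 x y hx hy => by
    have hy' : y = -1 := by linarith
    have h5 : 5.7 ≤ x ^ 2 := by rw [hx]; nlinarith
    have h6 : x ^ 2 ≤ 6.3 := by rw [hx]; nlinarith
    have h7 : x ≤ 0 := by rw [hx]; nlinarith
    have h8 : -3 ≤ x := by rw [hx]; nlinarith
    subst hy'
    refine ⟨Or.inl (by norm_num), fun X Y hX hY => Or.inr (Or.inr (Or.inr (Or.inr ⟨by rw [hY]; nlinarith, ?_⟩)))⟩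
    rw [hX]; nlinarith [mul_nonneg (neg_nonneg.2 h7) (sub_nonneg.2 h6)]
  rw [← a0, ← a1, ← a2, ← a3, b0, b1, ← d2, ← d3, ← c02, ← c13, ← c01]
  simp
end Hol

theorem b0_ex : ∃ b : ℝ, 0 < b ∧ b ^ 2 = 27 / 35 ∧ b < 0.8784 ∧ 0.878 < b := by
  have h : (√(27 / 35)) ^ 2 = (27 / 35 : ℝ) := Real.sq_sqrt (by norm_num)
  have h0 : 0 ≤ √(27 / 35) := Real.sqrt_nonneg _
  exact ⟨√(27 / 35), by positivity, h, by nlinarith, by nlinarith⟩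

theorem ofReal_mk (x : ℝ) : (x : ℂ) = ⟨x, 0⟩ := rfl

namespace Hol
variable {G : Type*} [Group G] (H : Hol (ℂ × ℂ) Ms G)

/-- jump, for a frame on an open set `D` -/
theorem jumpD {D : Set ℂ} (hD : IsOpen D) {th : ℂ → G} (hth : ∀ γ : ℝ → ℂ, ContinuousOn γ (Icc 0 1) →
    MapsTo γ (Icc 0 1) D → H.Y.h γ = th (γ 1) * (th (γ 0))⁻¹) (hDY : D ⊆ Ys)
    {b : ℝ} (hb : b ^ 2 = 27 / 35) (hbD : bb 1 b ∈ D) : ∃ P : G, ∃ δ > 0, ∀ y : ℝ, |y| < δ →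
      (b * y < 0 → (th (bb 1 ⟨b, y⟩))⁻¹ * H.Lam 1 ⟨b, y⟩ * th (bb 1 ⟨b, y⟩) = P) ∧
      (0 < b * y → (th (bb 1 ⟨b, y⟩))⁻¹ * H.Lam 1 ⟨b, y⟩ * th (bb 1 ⟨b, y⟩) =
        ((th (bb (-1) (2 / 3 * b : ℝ)))⁻¹ * H.Lam (-1) (2 / 3 * b : ℝ) * th (bb (-1) (2 / 3 * b : ℝ))) * P *
        ((th (bb (-1) (2 / 3 * b : ℝ)))⁻¹ * H.Lam (-1) (2 / 3 * b : ℝ) * th (bb (-1) (2 / 3 * b : ℝ)))⁻¹) := by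
  have hb0 : b ≠ 0 := by rintro rfl; norm_num at hb
  have heq : b ^ 2 * (1 + (2 / 3) ^ 3) = 3 * (1 - 2 / 3) := by rw [hb]; norm_num
  obtain ⟨P, hP⟩ := H.jump (k := 2 / 3) (by norm_num) (by norm_num) hb0 heq (by rw [hb]; norm_num) (hDY hbD)
  have hbb : bb (-1) (2 / 3 * b : ℝ) = bb 1 b := by
    have : ((b ^ 2 : ℝ):ℂ) = ((27 / 35 : ℝ) : ℂ) := by rw [hb]
    push_cast at this
    simp only [bb]; push_cast; linear_combination (2 * (b:ℂ)) * (1 + 8 / 27) * this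
  rw [hbb]
  refine ⟨(th (bb 1 b))⁻¹ * P * th (bb 1 b), ?_⟩
  obtain ⟨δ, hδ, h1⟩ := Metric.eventually_nhds_iff_ball.1 (hP.and
    ((hD.preimage (cont_bb 1)).mem_nhds hbD))
  refine ⟨δ, hδ, fun y hy => ?_⟩
  have hball : (⟨b, y⟩ : ℂ) ∈ Metric.ball (b:ℂ) δ := by
    rw [Metric.mem_ball, dist_eq]
    have : (⟨b, y⟩ : ℂ) - b = (y:ℂ) * I := by apply Complex.ext <;> simp
    rw [this]; simpa using hy
  obtain ⟨⟨h2, h3⟩, -⟩ := h1 _ hball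
  have hκ : H.hs (fun b => ((0:ℂ), bb 1 b)) (b:ℂ) ⟨b, y⟩ = th (bb 1 ⟨b, y⟩) * (th (bb 1 b))⁻¹ := by
    generalize (⟨b, y⟩ : ℂ) = v at hball
    have hb' : ∀ r ∈ Icc (0:ℝ) 1, bb 1 ((b:ℂ) + r • (v - (b:ℂ))) ∈ D := by
      intro r hr
      have h5 := (convex_ball (b:ℂ) δ).segment_subset (Metric.mem_ball_self hδ) hball (mem_seg hr)
      exact (h1 _ h5).2
    have h6 := hth (fun r : ℝ => bb 1 ((b:ℂ) + r • (v - (b:ℂ)))) (by fun_prop) hb'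
    simp only [one_smul, zero_smul, add_zero, add_sub_cancel] at h6
    exact h6
  have e : ((⟨b, y⟩ : ℂ) ^ 2).im = 2 * (b * y) := by simp [pow_two]; ring
  rw [e, hκ] at h2 h3
  constructor
  · intro h; rw [h2 (by linarith)]; group
  · intro h; rw [h3 (by linarith)]; group

theorem rel2 : H.L3 1 ⟨0, -1⟩ = H.L3 (-1) ⟨-1, 0⟩ * H.L3 1 ⟨-1, 1⟩ * (H.L3 (-1) ⟨-1, 0⟩)⁻¹ := by
  obtain ⟨b, hb0, hb, hb1, hb2⟩ := b0_ex
  obtain ⟨P, δ, hδ, h⟩ := H.jumpD isOpen_D3 (th := H.Y.th3) (fun γ h1 h2 => H.Y.th3_path h1 h2) D3_sub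
    (b := -b) (by rw [neg_sq, hb]) (by
      left; rw [ofReal_mk, bb1_re]; nlinarith)
  have hm := min_le_left δ 1
  have h0 : 0 < min δ 1 := by apply lt_min <;> linarith
  obtain ⟨h1, -⟩ := h (min δ 1 / 2) (by rw [abs_of_pos (by linarith)]; linarith)
  obtain ⟨-, h2⟩ := h (-(min δ 1 / 2)) (by rw [abs_neg, abs_of_pos (by linarith)]; linarith)
  specialize h1 (by nlinarith)
  specialize h2 (by nlinarith)
  change H.L3 1 _ = _ at h1
  change H.L3 1 _ = H.L3 (-1) _ * P * (H.L3 (-1) _)⁻¹ at h2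
  rw [H.q2 (by linarith) (by linarith)] at h1
  rw [H.q3 (fun r h0 h1 x y hx hy => ⟨by nlinarith, by
    have : x = (1 - r) * (-b) := by rw [hx]; ring
    rw [this]; nlinarith [sq_nonneg y, mul_nonneg h0 (sub_nonneg.2 h1)]⟩) (by linarith), ← h1] at h2
  have h3 : H.L3 (-1) (2 / 3 * -b : ℝ) = H.L3 (-1) ⟨-1, 0⟩ := by
    refine H.L3_seg (Or.inr rfl) fun β hβ => ?_
    obtain ⟨r, h0, h1, rfl⟩ := seg_r hβ
    have h4 := cneg (a := 2 / 3 * -b) (c := -1) (by linarith) (by norm_num) h0 h1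
    simp only [ofReal_re, ofReal_im, sub_zero, mul_zero, add_zero]
    have : bb (-1) ⟨2 / 3 * -b + r * (-1 - 2 / 3 * -b), 0⟩ ∈ D3 := by
      left; rw [bbm_re]; nlinarith [mul_neg_of_neg_of_pos h4 (show 0 < 3 + (2 / 3 * -b + r * (-1 - 2 / 3 * -b)) ^ 2 by positivity)]
    exact ⟨admm (D3_sub this) (Or.inl h4.ne), this⟩
  rw [h3] at h2
  exact h2

theorem rel3 : H.Y.om 2 * H.L3 1 ⟨-1, 1⟩ * (H.Y.om 2)⁻¹ =
    H.Y.om 0 * (H.L3 (-1) ⟨1, -1⟩ * H.L3 1 ⟨0, -1⟩ * (H.L3 (-1) ⟨1, -1⟩)⁻¹) * (H.Y.om 0)⁻¹ := by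
  obtain ⟨b, hb0, hb, hb1, hb2⟩ := b0_ex
  have hD : bb 1 b ∈ D1 := by
    unfold D1; rw [mem_ofPred_eq, ofReal_mk, bb1_re, bb1_im]
    refine ⟨Or.inl (by nlinarith), by rintro ⟨h, -⟩; nlinarith, by rintro ⟨h, -⟩; norm_num at h⟩
  obtain ⟨P, δ, hδ, h⟩ := H.jumpD isOpen_D1 (th := H.Y.th1) (fun γ h1 h2 => H.Y.th1_path h1 h2) D1_sub
    hb hD
  set m := min δ 0.01 with hm
  have hm1 := min_le_left δ 0.01
  have hm2 := min_le_right δ 0.01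
  have h0 : 0 < m := by apply lt_min <;> linarith
  obtain ⟨-, h1⟩ := h (m / 2) (by rw [abs_of_pos (by linarith)]; linarith)
  obtain ⟨h2, -⟩ := h (-(m / 2)) (by rw [abs_neg, abs_of_pos (by linarith)]; linarith)
  specialize h1 (by positivity)
  specialize h2 (by nlinarith)
  change H.L1 1 _ = _ at h2
  change H.L1 1 _ = H.L1 (-1) _ * P * (H.L1 (-1) _)⁻¹ at h1
  have e1 := H.W_of (x := -0.05) (y := 0.1) rfl rfl (j := 2) (by simp [W]; norm_num)
  rw [H.q2 (by norm_num) (by norm_num)] at e1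
  have e2 : H.L1 1 ⟨b, m / 2⟩ = H.L1 1 ⟨-0.05, 0.1⟩ := H.s1 fun r h0 h1 x y hx hy => by
    have g1 : x ^ 2 < 1 := by
      have : -0.05 ≤ x := by rw [hx]; nlinarith
      have : x ≤ b := by rw [hx]; nlinarith
      nlinarith
    have g2 : 0 < y := by rw [hy]; nlinarith
    have g3 : y ≤ 0.1 := by rw [hy]; nlinarith
    refine ⟨Or.inl g2.ne', fun X Y hX hY => Or.inr (Or.inl ⟨?_, ?_⟩)⟩
    · rw [hY]; have := mul_pos g2 (show 0 < 3 - 3 * x ^ 2 + y ^ 2 by nlinarith [sq_nonneg y]); linarith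
    · rw [hY]; have := mul_nonneg g2.le (sq_nonneg x); nlinarith [sq_nonneg y]
  have e3 := H.W_of (x := b) (y := -(m / 2)) rfl rfl (j := 0) (by
    have hmm : m ^ 2 ≤ 0.0001 := by nlinarith
    refine ⟨?_, ?_, ?_⟩ <;> simp only [hb]
    · nlinarith [sq_nonneg m]
    · nlinarith [sq_nonneg m]
    · nlinarith [sq_nonneg m])
  rw [H.q4 hb0.le (by rw [hb]; norm_num) (by linarith)] at e3
  have e4 : H.L1 (-1) (2 / 3 * b : ℝ) = H.Y.om 0 * H.L3 (-1) ⟨1, -1⟩ * (H.Y.om 0)⁻¹ := by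
    have f1 : H.L1 (-1) (2 / 3 * b : ℝ) = H.L1 (-1) ⟨2 / 3 * b, -0.1⟩ := by
      refine H.L1_seg (Or.inr rfl) fun β hβ => ?_
      obtain ⟨r, h0, h1, rfl⟩ := seg_r hβ
      simp only [ofReal_re, ofReal_im, sub_self, mul_zero, add_zero, zero_add, sub_zero]
      have : bb (-1) ⟨2 / 3 * b, r * -0.1⟩ ∈ D1 := by
        unfold D1; rw [mem_ofPred_eq, bbm_re, bbm_im]
        have hr2 : r ^ 2 ≤ 1 := by nlinarith
        have g1 : 0 < 2 * (2 / 3 * b) * (3 + (2 / 3 * b) ^ 2 - 3 * (r * -0.1) ^ 2) := by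
          apply mul_pos (by linarith); nlinarith
        refine ⟨Or.inl g1, ?_, ?_⟩
        · rintro ⟨h, -⟩; rw [mul_pow, hb] at h; nlinarith [sq_nonneg r, mul_nonneg hb0.le (sq_nonneg r)]
        · rintro ⟨h, h'⟩; linarith
      exact ⟨admm (D1_sub this) (Or.inl (by positivity)), this⟩
    have f2 := H.L1_L3 (ε := -1) (β := ⟨2 / 3 * b, -0.1⟩) (j := 0) (by
      refine ⟨?_, ?_, ?_⟩ <;> simp only [bbm_re, bbm_im]
      · apply mul_pos (by linarith); nlinarith
      · rw [mul_pow, hb]; nlinarith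
      · nlinarith)
    have f3 : H.L3 (-1) ⟨2 / 3 * b, -0.1⟩ = H.L3 (-1) ⟨1, -1⟩ := by
      refine H.L3_seg (Or.inr rfl) fun β hβ => ?_
      obtain ⟨r, h0, h1, rfl⟩ := seg_r hβ
      simp only []
      have hy := cneg (a := -0.1) (c := -1) (by norm_num) (by norm_num) h0 h1
      have hx := cneg (a := -(2 / 3 * b)) (c := -1) (by linarith) (by norm_num) h0 h1
      generalize hX : (2 / 3 * b + r * (1 - 2 / 3 * b)) = X at *
      generalize (-0.1 + r * (-1 - -0.1)) = Y at *
      have hx' : 0 < X := by rw [← hX]; linarith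
      have : bb (-1) ⟨X, Y⟩ ∈ D3 := by
        unfold D3; rw [mem_ofPred_eq, bbm_re, bbm_im]
        by_cases h : 3 + X ^ 2 < 3 * Y ^ 2
        · left; have := mul_neg_of_pos_of_neg hx' (show 3 + X ^ 2 - 3 * Y ^ 2 < 0 by linarith); linarith
        · right; have := mul_neg_of_neg_of_pos hy (show 0 < 3 + 3 * X ^ 2 - Y ^ 2 by nlinarith [sq_nonneg X]); linarith
      exact ⟨admm (D3_sub this) (Or.inl hx'.ne'), this⟩
    rw [f1, f2, f3]
  rw [← e1, ← e2, h1, e4, ← h2, e3]; group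
end Hol

noncomputable def tau (p : ℂ × ℂ) : ℂ × ℂ := (I * starRingEnd ℂ p.1, I * starRingEnd ℂ p.2)

theorem bb_tau (ε : ℂ) (hε : ε = 1 ∨ ε = -1) (u : ℂ) :
    bb (-ε) (I * starRingEnd ℂ u) = I * starRingEnd ℂ (bb ε u) := by
  have h : starRingEnd ℂ ε = ε := by rcases hε with rfl | rfl <;> simp
  simp only [bb, map_sub, map_mul, map_pow, h, mul_pow]
  have : starRingEnd ℂ 6 = 6 := map_ofNat _ 6
  have h2 : starRingEnd ℂ 2 = 2 := map_ofNat _ 2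
  rw [this, h2, I_pow_three]; ring
theorem Ic_inj {u v : ℂ} : I * starRingEnd ℂ u = I * starRingEnd ℂ v ↔ u = v := by
  rw [mul_right_inj' I_ne_zero, (starRingEnd ℂ).injective.eq_iff]
theorem tau_Ys {t : ℂ} : I * starRingEnd ℂ t ∈ Ys ↔ t ∈ Ys := by
  have h4 : I * starRingEnd ℂ 4 = 4 * I := by rw [map_ofNat]; ring
  have h4i : I * starRingEnd ℂ (4 * I) = 4 := by
    rw [map_mul, map_ofNat, conj_I]; linear_combination (-4) * I_mul_I
  have h0 : I * starRingEnd ℂ 0 = 0 := by simp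
  unfold Ys
  simp only [mem_ofPred_eq, ne_eq]
  constructor
  · rintro ⟨h1, h2, h3⟩
    exact ⟨fun h => h1 (by rw [h, h0]), fun h => h3 (by rw [h, h4]), fun h => h2 (by rw [h, h4i])⟩
  · rintro ⟨h1, h2, h3⟩
    exact ⟨fun h => h1 (by rwa [← h0, Ic_inj] at h), fun h => h3 (by rwa [← h4i, Ic_inj] at h),
      fun h => h2 (by rwa [← h4, Ic_inj] at h)⟩
theorem tau_Ms {p : ℂ × ℂ} (h : p ∈ Ms) : tau p ∈ Ms := by
  obtain ⟨h1, h2, h3⟩ := h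
  refine ⟨tau_Ys.2 h1, ?_, ?_⟩
  · have := bb_tau (-1) (Or.inr rfl) p.1
    rw [neg_neg] at this
    simp only [tau, this, ne_eq, Ic_inj]; exact h3
  · simp only [tau, bb_tau 1 (Or.inl rfl), ne_eq, Ic_inj]; exact h2
theorem cont_tau : Continuous tau := by
  unfold tau
  exact (continuous_const.mul (continuous_conj.comp continuous_fst)).prodMk
    (continuous_const.mul (continuous_conj.comp continuous_snd))

namespace Hol
variable {G : Type*} [Group G] (H : Hol (ℂ × ℂ) Ms G)

noncomputable def T : Hol (ℂ × ℂ) Ms G := H.comap tau Ms cont_tau.continuousOn (fun _ h => tau_Ms h)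

theorem T_hs {V : Type*} [AddCommGroup V] [Module ℝ V] (F : V → ℂ × ℂ) (a b : V) :
    H.T.hs F a b = H.hs (fun v => tau (F v)) a b := rfl
theorem TY_hs (a b : ℂ) : H.T.Y.hs id a b =
    H.Y.hs id (I * starRingEnd ℂ a) (I * starRingEnd ℂ b) := by
  refine H.congr' _ _ fun r hr => ?_
  simp only [tau, id]
  congr 1
  · simp
  · simp [real_smul]; ring
theorem T_th3 (t : ℂ) : H.T.Y.th3 t = H.Y.th3 (I * starRingEnd ℂ t) := by
  rw [th3, TY_hs, th3]; congr 1; apply Complex.ext <;> simp [t3]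
theorem T_th1 (t : ℂ) : H.T.Y.th1 t = H.Y.th1 (I * starRingEnd ℂ t) := by
  rw [th1, TY_hs, th1]; congr 1; apply Complex.ext <;> simp [t1]
theorem T_om : H.T.Y.om 0 = H.Y.om 2 ∧ H.T.Y.om 1 = H.Y.om 3 ∧ H.T.Y.om 2 = H.Y.om 0 ∧
    H.T.Y.om 3 = H.Y.om 1 := by
  simp only [om, T_th3, T_th1]
  refine ⟨?_, ?_, ?_, ?_⟩ <;> congr 2 <;> (congr 1; apply Complex.ext <;> simp [sW])

theorem T_Lam {ε β : ℂ} (hε : ε = 1 ∨ ε = -1) (h : adm ε β) (h' : adm (-ε) (I * starRingEnd ℂ β)) :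
    H.T.Lam ε β = (H.Lam (-ε) (I * starRingEnd ℂ β))⁻¹ := by
  have hε' : -ε = 1 ∨ -ε = -1 := by rcases hε with rfl | rfl <;> simp
  obtain ⟨δ, hδ, hg⟩ := h.good
  obtain ⟨δ', hδ', hg'⟩ := h'.good
  have hg := hg _ (Metric.mem_ball_self hδ)
  have hg' := hg' _ (Metric.mem_ball_self hδ')
  have hm : 0 < min δ δ' := lt_min hδ hδ'
  set η := min δ δ'
  rw [H.T.Lam_eq hε hg hm (min_le_left _ _), H.Lam_eq hε' hg' hm (min_le_right _ _), Leta, Leta]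
  rw [T_hs, T_hs]
  set β' := I * starRingEnd ℂ β
  have e : ∀ (a b a' b' : ℂ), a' = - starRingEnd ℂ a → b' = - starRingEnd ℂ b →
      H.hs (fun w => tau (Ew ε (w, β))) a b = H.hs (fun w => Ew (-ε) (w, β')) a' b' := by
    rintro a b _ _ rfl rfl
    apply H.hs_congr
    intro r hr
    simp only [Ew, Ph, tau, β', bb_tau ε hε]
    congr 1
    simp [real_smul]; ring
  rw [e ⟨0, η⟩ (-(1:ℝ)) ⟨0, η⟩ (1:ℝ) (by apply Complex.ext <;> simp) (by simp),
    e (1:ℝ) ⟨0, η⟩ (-(1:ℝ)) ⟨0, η⟩ (by simp) (by apply Complex.ext <;> simp)]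
  have hst := star_upR (a := 1) hm (min_le_right δ δ')
  have hX : MapsTo (fun w => Ew (-ε) (w, β')) (upR 1 δ') Ms := by
    rintro w ⟨h1, h2, h3, h4⟩
    exact Ew_mem hε' (hg'.2 w h1 (by rwa [abs_of_nonneg h2])) h4
  rw [H.star_rev hst (F := fun w => Ew (-ε) (w, β')) (by fun_prop) hX (a := (1:ℝ)) (by simp [upR, hδ'.le]),
    H.star_rev hst (F := fun w => Ew (-ε) (w, β')) (by fun_prop) hX (a := -(1:ℝ)) (by simp [upR, hδ'.le])]
  group
theorem T_L3 {ε β : ℂ} (hε : ε = 1 ∨ ε = -1) (h : adm ε β) (h' : adm (-ε) (I * starRingEnd ℂ β)) :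
    H.T.L3 ε β = (H.L3 (-ε) (I * starRingEnd ℂ β))⁻¹ := by
  rw [L3, L3, H.T_Lam hε h h', T_th3, bb_tau _ hε]; group

noncomputable def eA := H.L3 (-1) ⟨-1, 0⟩
noncomputable def eB := H.L3 1 ⟨0, -1⟩
noncomputable def ebu := H.L3 1 ⟨-1, 1⟩
noncomputable def ear := H.L3 (-1) ⟨1, -1⟩

theorem T_e : H.T.ebu = H.ear⁻¹ ∧ H.T.eB = H.eA⁻¹ ∧ H.T.eA = H.eB⁻¹ := by
  have d3 : ∀ z : ℂ, z.re < 0 ∨ z.im < 0 → z ∈ Ys := fun z h => D3_sub h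
  have a1 : adm (-1) ⟨-1, 0⟩ := admm (d3 _ (by rw [bbm_re, bbm_im]; norm_num)) (by simp)
  have a2 : adm 1 ⟨0, -1⟩ := adm1 (d3 _ (by rw [bb1_re, bb1_im]; norm_num)) (by simp)
  have a3 : adm 1 ⟨-1, 1⟩ := adm1 (d3 _ (by rw [bb1_re, bb1_im]; norm_num)) (by simp)
  have a4 : adm (-1) ⟨1, -1⟩ := admm (d3 _ (by rw [bbm_re, bbm_im]; norm_num)) (by simp)
  have e1 : I * starRingEnd ℂ ⟨-1, 1⟩ = ⟨1, -1⟩ := by apply Complex.ext <;> simp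
  have e2 : I * starRingEnd ℂ ⟨0, -1⟩ = ⟨-1, 0⟩ := by apply Complex.ext <;> simp
  have e3 : I * starRingEnd ℂ ⟨-1, 0⟩ = ⟨0, -1⟩ := by apply Complex.ext <;> simp
  unfold ebu ear eB eA
  refine ⟨?_, ?_, ?_⟩
  · rw [H.T_L3 (Or.inl rfl) a3 (by rw [e1]; exact a4), e1]
  · rw [H.T_L3 (Or.inl rfl) a2 (by rw [e2]; exact a1), e2]
  · rw [H.T_L3 (Or.inr rfl) a1 (by rw [e3, neg_neg]; exact a2), e3, neg_neg]

theorem rels (hA : H.eA * H.eA = 1) (hB : H.eB * H.eB = 1) :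
    let A := H.eA; let B := H.eB; let X := (H.Y.om 0)⁻¹ * H.Y.om 2
    let g := (H.Y.om 0)⁻¹ * H.Y.om 1; let g' := (H.Y.om 2)⁻¹ * H.Y.om 3
    H.ebu = A * B * A ∧ H.ear = B * A * B ∧ (A * B) ^ 6 = 1 ∧
    (∀ c, c = (A * B)⁻¹ * X ∨ c = g ∨ c = g' → Commute c A ∧ Commute c B) := by
  intro A B X g g'
  obtain ⟨t0, t1, t2, t3⟩ := H.T_om
  obtain ⟨f1, f2, f3⟩ := H.T_e
  have r1 := H.rel1
  have r1' := H.T.rel1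
  have r2 := H.rel2
  have r2' := H.T.rel2
  have r3 := H.rel3
  change H.eB = A * H.ebu * A⁻¹ at r2
  change H.T.eB = H.T.eA * H.T.ebu * H.T.eA⁻¹ at r2'
  change _ * H.ebu * _ = _ * H.ebu * _ ∧ _ * H.ebu * _ = _ * B * _ ∧ _ * H.ebu * _ = _ * B * _ at r1
  change _ * H.T.ebu * _ = _ * H.T.ebu * _ ∧ _ * H.T.ebu * _ = _ * H.T.eB * _ ∧
    _ * H.T.ebu * _ = _ * H.T.eB * _ at r1'
  change _ * H.ebu * _ = _ * (H.ear * B * H.ear⁻¹) * _ at r3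
  rw [f1, f2, f3] at r2'
  rw [f1, f2, t0, t1, t2, t3] at r1'
  have iA : A⁻¹ = A := inv_eq_of_mul_eq_one_right hA
  have iB : B⁻¹ = B := inv_eq_of_mul_eq_one_right hB
  have hbu : H.ebu = A * B * A := by
    change B = _ at r2
    rw [r2, iA]; change _ = A * (A * _ * A) * A
    rw [mul_assoc, mul_assoc, mul_assoc, show A * A = 1 from hA, mul_one, ← mul_assoc, show A * A = 1 from hA, one_mul]
  have har : H.ear = B * A * B := by
    change A⁻¹ = B⁻¹ * _ * B⁻¹⁻¹ at r2'
    have : H.ear = B * A * B⁻¹ := by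
      have h := congrArg (·⁻¹) r2'
      simp only [inv_inv, mul_inv_rev] at h
      rw [h]; group
    rw [this, iB]
  rw [hbu] at r1 r3
  rw [har] at r1' r3
  have AA : ∀ x, A * (A * x) = x := fun x => by rw [← mul_assoc, show A * A = 1 from hA, one_mul]
  have BB : ∀ x, B * (B * x) = x := fun x => by rw [← mul_assoc, show B * B = 1 from hB, one_mul]
  have hA1 : A * A = 1 := hA
  have hB1 : B * B = 1 := hB
  have conj : ∀ x y u v : G, x * u * x⁻¹ = y * v * y⁻¹ → SemiconjBy (y⁻¹ * x) u v := by
    intro x y u v h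
    show y⁻¹ * x * u = v * (y⁻¹ * x)
    have : x * u = y * v * y⁻¹ * x := by rw [← h]; group
    rw [mul_assoc, this]; group
  have cinv : ∀ u v w : G, SemiconjBy u v⁻¹ w⁻¹ → SemiconjBy u v w := fun u v w h => by
    have := h.inv_right; simpa using this
  have g1 : Commute g (A * B * A) := conj _ _ _ _ r1.1.symm
  have X1 : SemiconjBy X B (A * B * A) := conj _ _ _ _ r1.2.1.symm
  have g2 : Commute g' B := conj _ _ _ _ (r1.2.2.symm.trans r1.2.1)
  have g3 : Commute g' (B * A * B) := cinv _ _ _ (conj _ _ _ _ r1'.1.symm)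
  have X2 : SemiconjBy X (B * A * B) A := cinv _ _ _ (conj _ _ _ _ r1'.2.1)
  have g4 : Commute g A := cinv _ _ _ (conj _ _ _ _ (r1'.2.2.symm.trans r1'.2.1))
  have X3 : SemiconjBy X (A * B * A) (B * A * B * B * (B * A * B)⁻¹) := conj _ _ _ _ r3
  have eAB : A = B * (B * A * B) * B := by simp only [mul_assoc, BB, hB1, mul_one]
  have eBA : B = A * (A * B * A) * A := by simp only [mul_assoc, AA, hA1, mul_one]
  have X4 : SemiconjBy X A (A * B * A * A * (A * B * A)) := by
    have := (X1.mul_right X2).mul_right X1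
    rwa [← eAB] at this
  have X5 := (X4.mul_right X1).mul_right X4
  have e6 : A * B * A * A * (A * B * A) * (A * B * A) * (A * B * A * A * (A * B * A)) = A * B * A * B * A * B * A := by
    simp only [mul_assoc, AA, BB]
  have e7 : B * A * B * B * (B * A * B)⁻¹ = B * A * B * A * B := by
    simp only [mul_inv_rev, iA, iB, mul_assoc, AA, BB]
  rw [e7] at X3
  rw [e6] at X5
  have e8 : A * B * A * B * A * B * A = B * A * B * A * B := mul_right_cancel (X5.eq.symm.trans X3.eq)
  have s1 : SemiconjBy ((A * B)⁻¹) (A * B * A) B := by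
    show _ = _
    simp only [mul_inv_rev, iA, iB, mul_assoc, AA, BB]
  have s2 : SemiconjBy ((A * B)⁻¹) (A * B * A * A * (A * B * A)) A := by
    show _ = _
    simp only [mul_inv_rev, iA, iB, mul_assoc, AA, BB]
  refine ⟨hbu, har, ?_, ?_⟩
  · have : (A * B) ^ 6 = (A * B * A * B * A * B * A) * (B * A * B * A * B) := by
      simp only [pow_succ, pow_zero, one_mul, mul_assoc]
    rw [this, e8]; simp only [mul_assoc, AA, BB, hB1]
  · rintro c (rfl | rfl | rfl)
    · exact ⟨s2.mul_left X4, s1.mul_left X1⟩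
    · refine ⟨g4, ?_⟩
      have := (g4.mul_right g1).mul_right g4
      rwa [← eBA] at this
    · refine ⟨?_, g2⟩
      have := (g2.mul_right g3).mul_right g2
      rwa [← eAB] at this
end Hol

theorem fin_bb (ε : ℂ) (hε : ε = 1 ∨ ε = -1) (c : ℂ) : {β | bb ε β = c}.Finite := by
  open Polynomial in
  have h : (C 6 * X - C (2 * ε) * X ^ 3 - C c : ℂ[X]) ≠ 0 := by
    intro h
    have := congrArg (fun p => p.coeff 3) h
    simp [coeff_X, coeff_C] at this
    rcases hε with rfl | rfl <;> simp at this
  refine (Polynomial.finite_setOf_isRoot h).subset fun β hβ => ?_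
  have hβ' : bb ε β = c := hβ
  simp [Polynomial.IsRoot, ← hβ', bb]

theorem fin_notY (ε : ℂ) (hε : ε = 1 ∨ ε = -1) : {β | bb ε β ∉ Ys}.Finite := by
  refine (((fin_bb ε hε 0).union (fin_bb ε hε 4)).union (fin_bb ε hε (4 * I))).subset fun β hβ => ?_
  have hβ' : bb ε β ∉ Ys := hβ
  simp only [Ys, mem_ofPred_eq, not_and_or, not_not] at hβ'
  simp only [mem_union, mem_ofPred_eq]; tauto

theorem two_seg {C F : Set ℂ} (hC : Convex ℝ C) (hCo : IsOpen C) (hF : F.Finite) {p q : ℂ}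
    (hp : p ∈ C \ F) (hq : q ∈ C \ F) :
    ∃ m, segment ℝ p m ⊆ C \ F ∧ segment ℝ m q ⊆ C \ F := by
  have hO : IsOpen (C \ F) := hCo.sdiff hF.isClosed
  obtain ⟨ρ, hρ, hb⟩ := Metric.isOpen_iff.1 hO q hq
  rcases eq_or_ne p q with rfl | hpq
  · exact ⟨p, by simpa using hp, by simpa using hp⟩
  set v : ℂ := I * (q - p)
  have hv : 0 < ‖v‖ := by simpa [v, sub_eq_zero] using hpq.symm
  -- bad parameters
  have hbad : {s : ℝ | ∃ z ∈ F, z ∈ segment ℝ p (q + s • v)}.Finite := by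
    have : {s : ℝ | ∃ z ∈ F, z ∈ segment ℝ p (q + s • v)} ⊆
        (fun z : ℂ => ((z - p) / (q - p)).im / ((z - p) / (q - p)).re) '' F := by
      rintro s ⟨z, hz, hz'⟩
      refine ⟨z, hz, ?_⟩
      rw [segment_eq_image'] at hz'
      obtain ⟨r, hr, rfl⟩ := hz'
      have hr0 : r ≠ 0 := by
        rintro rfl; simp at hz; exact hp.2 hz
      have hqp : q - p ≠ 0 := sub_ne_zero.2 hpq.symm
      have e : (p + r • (q + s • v - p) - p) / (q - p) = r * (1 + s * I) := by
        field_simp; simp only [real_smul, v]; ring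
      simp only [e]
      simp
      field_simp
    exact (hF.image _).subset this
  have hinf : (Ioo (0:ℝ) (ρ / ‖v‖)).Infinite := Ioo_infinite (by positivity)
  obtain ⟨s, hs, hs'⟩ := (hinf.sdiff hbad).nonempty
  have hm : q + s • v ∈ Metric.ball q ρ := by
    rw [Metric.mem_ball, dist_eq, add_sub_cancel_left, norm_smul, Real.norm_of_nonneg hs.1.le]
    have := hs.2
    rwa [lt_div_iff₀ hv] at this
  refine ⟨q + s • v, ?_, ?_⟩
  · intro z hz
    exact ⟨hC.segment_subset hp.1 (hb hm).1 hz, fun h => hs' ⟨z, h, hz⟩⟩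
  · exact ((convex_ball q ρ).segment_subset hm (Metric.mem_ball_self hρ)).trans hb

namespace Hol
variable {G : Type*} [Group G] (H : Hol (ℂ × ℂ) Ms G)

def Cl (S : Subgroup G) (ε β : ℂ) : Prop :=
  (H.Y.gY (bb ε β))⁻¹ * H.Lam ε β * H.Y.gY (bb ε β) ∈ S

theorem Cl_seg {S : Subgroup G} (hS : ∀ j, (H.Y.om 0)⁻¹ * H.Y.om j ∈ S) {ε : ℂ}
    (hε : ε = 1 ∨ ε = -1) {p q : ℂ} (h : ∀ β ∈ segment ℝ p q, adm ε β) (hp : H.Cl S ε p) :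
    H.Cl S ε q := by
  have h1 := H.Lam_path hε (γ := fun r : ℝ => p + r • (q - p)) (by fun_prop)
    (fun r hr => h _ (mem_seg hr))
  have h2 := H.Y.gY_gen S hS (γ := fun r : ℝ => bb ε (p + r • (q - p))) (by fun_prop)
    (fun r hr => adm_Ys (h _ (mem_seg hr)))
  simp only [one_smul, zero_smul, add_zero, add_sub_cancel] at h1 h2
  unfold Cl at *
  have := S.mul_mem (S.mul_mem h2 hp) (S.inv_mem h2)
  convert this using 1
  generalize H.Y.h _ = c at *
  have : H.Lam ε q = c * H.Lam ε p * c⁻¹ := by rw [eq_mul_inv_iff_mul_eq, h1]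
  rw [this]; group

theorem Cl_piece {S : Subgroup G} (hS : ∀ j, (H.Y.om 0)⁻¹ * H.Y.om j ∈ S) {ε : ℂ}
    (hε : ε = 1 ∨ ε = -1) {C : Set ℂ} (hC : Convex ℝ C) (hCo : IsOpen C)
    (ha : ∀ β ∈ C, bb ε β ∈ Ys → adm ε β) {p : ℂ} (hpC : p ∈ C) (hpY : bb ε p ∈ Ys)
    (hp : H.Cl S ε p) {q : ℂ} (hq : q ∈ C) (hqY : bb ε q ∈ Ys) : H.Cl S ε q := by
  obtain ⟨m, h1, h2⟩ := two_seg hC hCo (fin_notY ε hε) (p := p) (q := q) ⟨hpC, by simpa using hpY⟩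
    ⟨hq, by simpa using hqY⟩
  have ha' : ∀ β ∈ C \ {β | bb ε β ∉ Ys}, adm ε β := fun β h => ha β h.1 (not_not.1 h.2)
  exact H.Cl_seg hS hε (fun β hβ => ha' β (h2 hβ)) (H.Cl_seg hS hε (fun β hβ => ha' β (h1 hβ)) hp)

theorem Cl_L3 {S : Subgroup G} {ε β : ℂ} (h : bb ε β ∈ D3) (h3 : H.L3 ε β ∈ S) : H.Cl S ε β := by
  unfold Cl; rw [H.Y.gY3 h]; exact h3

theorem Cl_all {S : Subgroup G} (hS : ∀ j, (H.Y.om 0)⁻¹ * H.Y.om j ∈ S)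
    (hA : H.eA ∈ S) (hB : H.eB ∈ S) (hbu : H.ebu ∈ S) (har : H.ear ∈ S) :
    (∀ β, bb 1 β ∈ Ys → (β.im ≠ 0 ∨ 3 < β.re ^ 2) → H.Cl S 1 β) ∧
    (∀ β, bb (-1) β ∈ Ys → (β.re ≠ 0 ∨ 3 < β.im ^ 2) → H.Cl S (-1) β) := by
  have l1 : IsLinearMap ℝ Complex.re := ⟨by simp, by simp⟩
  have l2 : IsLinearMap ℝ Complex.im := ⟨by simp, by simp⟩
  have s3 : √3 ^ 2 = 3 := Real.sq_sqrt (by norm_num)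
  have s0 : 0 ≤ √3 := Real.sqrt_nonneg _
  have ex : ∀ x : ℝ, 3 < x ^ 2 ↔ x < -√3 ∨ √3 < x := by
    intro x; constructor
    · intro h; by_contra! h'; nlinarith
    · rintro (h | h) <;> nlinarith
  have s2 : √3 < 3 := by nlinarith
  constructor
  · have up : ∀ β, 0 < β.im → bb 1 β ∈ Ys → H.Cl S 1 β := fun β h hY => by
      have m : bb 1 ⟨-1, 1⟩ ∈ D3 := by left; rw [bb1_re]; norm_num
      exact H.Cl_piece hS (Or.inl rfl) (convex_halfSpace_gt l2 0) (isOpen_lt continuous_const continuous_im)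
        (fun β h hY => adm1 hY (Or.inl (ne_of_gt h))) (p := ⟨-1, 1⟩) (show (0:ℝ) < 1 by norm_num) (D3_sub m)
        (H.Cl_L3 m hbu) h hY
    have dn : ∀ β, β.im < 0 → bb 1 β ∈ Ys → H.Cl S 1 β := fun β h hY => by
      have m : bb 1 ⟨0, -1⟩ ∈ D3 := by right; rw [bb1_im]; norm_num
      exact H.Cl_piece hS (Or.inl rfl) (convex_halfSpace_lt l2 0) (isOpen_lt continuous_im continuous_const)
        (fun β h hY => adm1 hY (Or.inl (ne_of_lt h))) (p := ⟨0, -1⟩) (show (-1:ℝ) < 0 by norm_num) (D3_sub m)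
        (H.Cl_L3 m hB) h hY
    rintro β hY (h | h)
    · rcases lt_or_gt_of_ne h with h | h
      · exact dn β h hY
      · exact up β h hY
    · rcases (ex _).1 h with h | h
      · have m : bb 1 ⟨-3, 1⟩ ∈ D3 := by right; rw [bb1_im]; norm_num
        exact H.Cl_piece hS (Or.inl rfl) (convex_halfSpace_lt l1 (-√3)) (isOpen_lt continuous_re continuous_const)
          (fun β h hY => adm1 hY (Or.inr ((ex _).2 (Or.inl h)))) (p := ⟨-3, 1⟩)
          (show (-3:ℝ) < -√3 by linarith) (D3_sub m) (up _ (by norm_num) (D3_sub m)) h hY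
      · have m : bb 1 ⟨3, 1⟩ ∈ D3 := by left; rw [bb1_re]; norm_num
        exact H.Cl_piece hS (Or.inl rfl) (convex_halfSpace_gt l1 (√3)) (isOpen_lt continuous_const continuous_re)
          (fun β h hY => adm1 hY (Or.inr ((ex _).2 (Or.inr h)))) (p := ⟨3, 1⟩)
          s2 (D3_sub m) (up _ (by norm_num) (D3_sub m)) h hY
  · have up : ∀ β, 0 < β.re → bb (-1) β ∈ Ys → H.Cl S (-1) β := fun β h hY => by
      have m : bb (-1) ⟨1, -1⟩ ∈ D3 := by right; rw [bbm_im]; norm_num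
      exact H.Cl_piece hS (Or.inr rfl) (convex_halfSpace_gt l1 0) (isOpen_lt continuous_const continuous_re)
        (fun β h hY => admm hY (Or.inl (ne_of_gt h))) (p := ⟨1, -1⟩) (show (0:ℝ) < 1 by norm_num) (D3_sub m)
        (H.Cl_L3 m har) h hY
    have dn : ∀ β, β.re < 0 → bb (-1) β ∈ Ys → H.Cl S (-1) β := fun β h hY => by
      have m : bb (-1) ⟨-1, 0⟩ ∈ D3 := by left; rw [bbm_re]; norm_num
      exact H.Cl_piece hS (Or.inr rfl) (convex_halfSpace_lt l1 0) (isOpen_lt continuous_re continuous_const)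
        (fun β h hY => admm hY (Or.inl (ne_of_lt h))) (p := ⟨-1, 0⟩) (show (-1:ℝ) < 0 by norm_num) (D3_sub m)
        (H.Cl_L3 m hA) h hY
    rintro β hY (h | h)
    · rcases lt_or_gt_of_ne h with h | h
      · exact dn β h hY
      · exact up β h hY
    · rcases (ex _).1 h with h | h
      · have m : bb (-1) ⟨1, -3⟩ ∈ D3 := by left; rw [bbm_re]; norm_num
        exact H.Cl_piece hS (Or.inr rfl) (convex_halfSpace_lt l2 (-√3)) (isOpen_lt continuous_im continuous_const)
          (fun β h hY => admm hY (Or.inr ((ex _).2 (Or.inl h)))) (p := ⟨1, -3⟩)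
          (show (-3:ℝ) < -√3 by linarith) (D3_sub m) (up _ (by norm_num) (D3_sub m)) h hY
      · have m : bb (-1) ⟨1, 3⟩ ∈ D3 := by left; rw [bbm_re]; norm_num
        exact H.Cl_piece hS (Or.inr rfl) (convex_halfSpace_gt l2 (√3)) (isOpen_lt continuous_const continuous_im)
          (fun β h hY => admm hY (Or.inr ((ex _).2 (Or.inr h)))) (p := ⟨1, 3⟩)
          s2 (D3_sub m) (up _ (by norm_num) (D3_sub m)) h hY
end Hol

theorem fibre_ne {t u : ℂ} (ht : t ∈ Ys) (h : (u, t) ∉ Ms) : ∃ ε : ℂ, (ε = 1 ∨ ε = -1) ∧ bb ε u = t := by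
  by_contra! hc
  exact h ⟨ht, fun e => hc 1 (Or.inl rfl) e.symm, fun e => hc (-1) (Or.inr rfl) e.symm⟩

theorem fibre_fin {t : ℂ} (ht : t ∈ Ys) : {u | (u, t) ∉ Ms}.Finite := by
  refine ((fin_bb 1 (Or.inl rfl) t).union (fin_bb (-1) (Or.inr rfl) t)).subset fun u hu => ?_
  obtain ⟨ε, rfl | rfl, h⟩ := fibre_ne ht hu
  · exact Or.inl h
  · exact Or.inr h

theorem fibre_open (t : ℂ) : IsOpen {u | (u, t) ∈ Ms} := isOpen_Ms.preimage (by fun_prop)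

def cone (e : ℝ) : Set ℂ := {z | |z.im| ≤ e * z.re}
theorem convex_cone (e : ℝ) : Convex ℝ (cone e) := by
  intro z hz w hw a b ha hb _
  simp only [cone, mem_ofPred_eq, abs_le] at *
  simp
  constructor <;> nlinarith [mul_le_mul_of_nonneg_left hz.1 ha, mul_le_mul_of_nonneg_left hz.2 ha,
    mul_le_mul_of_nonneg_left hw.1 hb, mul_le_mul_of_nonneg_left hw.2 hb]

theorem cone_ex {R : Set ℂ} (hR : R.Finite) (h0 : 0 ∉ R)
    (hr : ∀ β ∈ R, ∀ x : ℝ, 0 ≤ x → x < 1 → β * x ∉ R) :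
    ∃ e > 0, ∀ β ∈ R, ∀ z ∈ cone e, β * z ∈ R → z = 1 := by
  have key : ∀ β ∈ R, ∀ β' ∈ R, ∀ᶠ e in 𝓝[>] (0:ℝ), β' / β ∈ cone e → β' / β = 1 := by
    intro β hβ β' hβ'
    have hβ0 : β ≠ 0 := fun h => h0 (h ▸ hβ)
    have hβ0' : β' ≠ 0 := fun h => h0 (h ▸ hβ')
    by_cases hi : (β' / β).im = 0
    · obtain ⟨x, hx⟩ : ∃ x : ℝ, β' / β = x := ⟨(β' / β).re, by apply Complex.ext <;> simp [hi]⟩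
      have hx' : β' = β * x := by rw [← hx]; field_simp
      filter_upwards [self_mem_nhdsWithin] with e he hc
      rw [hx] at hc ⊢
      simp [cone] at hc
      have he : 0 < e := he
      have hx0 : 0 ≤ x := nonneg_of_mul_nonneg_right hc he
      rcases lt_trichotomy x 1 with h | h | h
      · exact absurd hβ' (hx' ▸ hr β hβ x hx0 h)
      · simp [h]
      · refine absurd hβ ?_
        have := hr β' hβ' x⁻¹ (inv_nonneg.2 hx0) (inv_lt_one_of_one_lt₀ h)
        have hx1 : (x:ℂ) ≠ 0 := by exact_mod_cast (by linarith : x ≠ 0)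
        rwa [hx', ofReal_inv, mul_assoc, mul_inv_cancel₀ hx1, mul_one] at this
    · have : Tendsto (fun e : ℝ => e * (β' / β).re) (𝓝[>] 0) (𝓝 (0 * (β' / β).re)) :=
        (tendsto_id.mul_const _).mono_left nhdsWithin_le_nhds
      rw [zero_mul] at this
      filter_upwards [this.eventually (gt_mem_nhds (abs_pos.2 hi))] with e he hc
      exact absurd he (not_lt.2 hc)
  have key2 : ∀ᶠ e in 𝓝[>] (0:ℝ), ∀ β ∈ R, ∀ β' ∈ R, β' / β ∈ cone e → β' / β = 1 := by
    rw [eventually_all_finite hR]; intro β hβ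
    rw [eventually_all_finite hR]; intro β' hβ'
    exact key β hβ β' hβ'
  obtain ⟨e, h1, h2⟩ := (key2.and self_mem_nhdsWithin).exists
  refine ⟨e, h2, fun β hβ z hz hz' => ?_⟩
  have hβ0 : β ≠ 0 := fun h => h0 (h ▸ hβ)
  have := h1 β hβ (β * z) hz'
  rw [mul_div_cancel_left₀ _ hβ0] at this
  exact this hz

namespace Hol
variable {G : Type*} [Group G] (H : Hol (ℂ × ℂ) Ms G)

noncomputable def Fb (t : ℂ) : Hol ℂ {u | (u, t) ∈ Ms} G :=
  H.comap (fun u => (u, t)) _ (by fun_prop) (fun _ h => h)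

theorem Fb_Ph {ε β t : ℂ} (h : bb ε β = t) (a b : ℂ) :
    H.hs (fun z => Ph ε (z, β)) a b = (H.Fb t).hs id (β * a) (β * b) := by
  subst h
  unfold hs Fb comap
  simp only [id, Ph]
  congr 1; ext1 r; congr 1
  simp only [real_smul]; ring

open Classical in
noncomputable def sg (e : ℝ) (t u : ℂ) : G :=
  if segment ℝ 0 u ⊆ {u | (u, t) ∈ Ms} then (H.Fb t).hs id 0 u else
    (H.Fb t).hs id (u * (1 + e * I)) u * (H.Fb t).hs id 0 (u * (1 + e * I))

theorem stepB {t : ℂ} (ht : t ∈ Ys) {S : Subgroup G}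
    (hr : ∀ ε : ℂ, (ε = 1 ∨ ε = -1) → ∀ β, bb ε β = t → adm ε β ∧ H.Cl S ε β) :
    ∃ σ : ℂ → G, σ 0 = H.Y.gY t ∧ ∀ p, (p, t) ∈ Ms → ∀ᶠ q in 𝓝 p,
      (σ q)⁻¹ * (H.Fb t).hs id p q * σ p ∈ S := by
  set R : Set ℂ := {u | (u, t) ∉ Ms} with hRdef
  have h0 : (0:ℂ) ∉ R := not_not.2 (i_mem ht)
  have hR : ∀ β ∈ R, ∀ x : ℝ, 0 ≤ x → x < 1 → β * x ∉ R := by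
    intro β hβ x hx hx1 h
    obtain ⟨ε, hε, rfl⟩ := fibre_ne ht hβ
    have := (Ph_iff hε (x, β)).2 ⟨(hr ε hε β rfl).1 x ⟨hx, hx1.le⟩, by
      simpa using hx1.ne⟩
    exact h this
  obtain ⟨e, he, hcone⟩ := cone_ex (fibre_fin ht) h0 hR
  set K := H.Fb t with hK
  have hO := fibre_open t
  refine ⟨fun u => H.sg e t u * H.Y.gY t, ?_, fun p hp => ?_⟩
  · show H.sg e t 0 * _ = _
    rw [sg, if_pos (by simpa using i_mem ht), K.hs_self (F := id) (i_mem ht), one_mul]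
  by_cases hs : segment ℝ 0 p ⊆ {u | (u, t) ∈ Ms}
  · -- off shadow
    obtain ⟨δ, hδ, hsub⟩ := (segment_eq_image' ℝ (0:ℂ) p ▸ isCompact_Icc.image (by fun_prop) :
      IsCompact (segment ℝ 0 p)).exists_thickening_subset_open hO hs
    have hcv : Convex ℝ (Metric.thickening δ (segment ℝ 0 p)) := (convex_segment _ _).thickening δ
    have hin := Metric.self_subset_thickening hδ (segment ℝ 0 p)
    have m0 := hin (left_mem_segment ℝ 0 p)
    have mp := hin (right_mem_segment ℝ 0 p)
    filter_upwards [Metric.isOpen_thickening.mem_nhds mp] with q hq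
    have h1 : H.sg e t p = K.hs id 0 p := if_pos hs
    have h2 : H.sg e t q = K.hs id 0 q := if_pos ((hcv.segment_subset m0 hq).trans hsub)
    rw [h1, h2, ← K.tri hcv continuousOn_id hsub m0 mp hq]
    convert S.one_mem using 1; group
  -- on shadow
  obtain ⟨β, hβ, x, hx1, rfl⟩ : ∃ β ∈ R, ∃ x : ℝ, 1 < x ∧ p = β * x := by
    obtain ⟨β, h1, h2⟩ := not_subset.1 hs
    rw [segment_eq_image'] at h1
    obtain ⟨r, hr, rfl⟩ := h1
    simp only [sub_zero, zero_add] at h2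
    have hr0 : r ≠ 0 := by rintro rfl; exact h2 (by simpa using i_mem ht)
    have hr1 : r ≠ 1 := by rintro rfl; exact h2 (by simpa using hp)
    refine ⟨_, h2, r⁻¹, ?_, ?_⟩
    · exact (one_lt_inv₀ (lt_of_le_of_ne hr.1 hr0.symm)).2 (lt_of_le_of_ne hr.2 hr1)
    · have : (r:ℂ) ≠ 0 := by exact_mod_cast hr0
      rw [real_smul, ofReal_inv]; field_simp
  obtain ⟨ε, hε, hbt⟩ := fibre_ne ht hβ
  obtain ⟨hadm, hCl⟩ := hr ε hε β hbt
  have hβ0 : β ≠ 0 := fun h => h0 (h ▸ hβ)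
  have hcl : ∀ z ∈ cone e, z ≠ 1 → (β * z, t) ∈ Ms := fun z hz h1 => by
    by_contra h; exact h1 (hcone β hβ z hz h)
  set F : ℂ → ℂ := fun z => β * z with hF
  have hFc : ∀ s, ContinuousOn F s := fun s => by fun_prop
  have toF : ∀ a b, K.hs id (β * a) (β * b) = K.hs F a b := fun a b => by
    apply K.hs_congr; intro r _; simp only [hF, id, real_smul]; ring
  set mu : ℂ := ⟨1, e⟩
  set ml : ℂ := ⟨1, -e⟩
  have hmu : mu ∈ cone e := by simp [cone, mu, abs_of_pos he]
  have hml : ml ∈ cone e := by simp [cone, ml, abs_of_pos he]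
  have su := star_im (convex_cone e) 1 hmu (by simpa [mu] using he)
  have sl := star_im (convex_cone e) (-1) hml (by simpa [ml] using he)
  have mu' : MapsTo F {z | z ∈ cone e ∧ 0 ≤ 1 * z.im ∧ z ≠ 1} {u | (u, t) ∈ Ms} :=
    fun z hz => hcl z hz.1 hz.2.2
  have ml' : MapsTo F {z | z ∈ cone e ∧ 0 ≤ -1 * z.im ∧ z ≠ 1} {u | (u, t) ∈ Ms} :=
    fun z hz => hcl z hz.1 hz.2.2
  have hx0 : 0 < x := by linarith
  have c0 : (0:ℂ) ∈ cone e := by simp [cone]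
  have segz : ∀ z : ℂ, ∀ r : ℝ, (0:ℂ) + r • (z - 0) = r * z := fun z r => by simp
  have im_seg : ∀ s : ℝ, s = 1 ∨ s = -1 → ∀ z ∈ cone e, 0 < s * z.im → ∀ r ∈ Icc (0:ℝ) 1,
      (0:ℂ) + r • (z - 0) ∈ {z | z ∈ cone e ∧ 0 ≤ s * z.im ∧ z ≠ 1} := by
    intro s hs z hz h r hr
    refine ⟨(convex_cone e).add_smul_sub_mem c0 hz hr, ?_, ?_⟩
    · simp only [segz]; simp; nlinarith [mul_nonneg hr.1 h.le]
    · intro h1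
      rw [segz] at h1
      have a1 := congrArg Complex.re h1
      have a2 := congrArg Complex.im h1
      simp at a1 a2
      rcases a2 with a2 | a2
      · rw [a2] at a1; simp at a1
      · rw [a2] at h; simp at h
  have LU := H.LL hε hadm (convex_cone e) he (fun z hz _ => hz) (fun z hz h1 => by
    have := hcl z hz h1; rw [← hbt] at this; exact this) hmu hml (by simpa [mu] using he)
    (by simpa [ml] using he) (q := x) (by simp [cone]; positivity) hx1
  simp only [H.Fb_Ph hbt] at LU
  rw [← hK] at LU
  simp only [toF] at LU
  have ru := K.star_rev su (hFc _) mu' (a := 0) ⟨c0, by simp, by simp⟩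
  have rl := K.star_rev sl (hFc _) ml' (a := 0) ⟨c0, by simp, by simp⟩
  rw [ru, rl] at LU
  -- upper formula on the axis
  have axis : ∀ y : ℝ, 1 < y → H.sg e t (β * y) = K.hs F mu y * (K.hs F mu 0)⁻¹ := by
    intro y hy
    have hy0 : 0 < y := by linarith
    have hn : ¬ segment ℝ 0 (β * y) ⊆ {u | (u, t) ∈ Ms} := by
      intro h
      refine hβ (h ?_)
      rw [segment_eq_image']
      refine ⟨y⁻¹, ⟨by positivity, (inv_lt_one_of_one_lt₀ hy).le⟩, ?_⟩
      have : (y:ℂ) ≠ 0 := by exact_mod_cast hy0.ne'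
      simp; field_simp
    rw [sg, if_neg hn, ← hK]
    have e1 : β * (y:ℂ) * (1 + e * I) = β * (y * (1 + e * I)) := by ring
    have e2 : (0:ℂ) = β * 0 := by simp
    rw [e1, e2, toF, toF]
    set m : ℂ := y * (1 + e * I)
    have mre : m.re = y := by simp [m]
    have mim : m.im = y * e := by simp [m]
    have hm : m ∈ cone e := by
      rw [cone, mem_ofPred_eq, mre, mim, abs_of_pos (by positivity)]; linarith
    have hyc : (y:ℂ) ∈ cone e := by simp [cone]; positivity
    have f1 := K.star_seg su (hFc _) mu' (im_seg 1 (Or.inl rfl) m hm (by rw [mim]; positivity))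
    have f2 := K.star_seg su (hFc _) mu' (a := m) (b := y) (fun r hr => by
      refine ⟨(convex_cone e).add_smul_sub_mem hm hyc hr, ?_, ?_⟩
      · simp [mim]; nlinarith [mul_pos hy0 he, hr.2]
      · intro h
        have := congrArg Complex.re h
        simp [mre] at this; linarith)
    rw [← f2, ← f1]; group
  have off : ∀ s : ℝ, s = 1 ∨ s = -1 → ∀ z ∈ cone e, 0 < s * z.im →
      H.sg e t (β * z) = K.hs F 0 z := by
    intro s hs z hz h
    have : segment ℝ 0 (β * z) ⊆ {u | (u, t) ∈ Ms} := by
      rw [segment_eq_image']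
      rintro _ ⟨r, hr, rfl⟩
      have := im_seg s hs z hz h r hr
      have := hcl _ this.1 this.2.2
      convert this using 2
      simp; ring
    rw [sg, if_pos this, ← hK, ← toF, mul_zero]
  have hnb : ∀ᶠ q in 𝓝 (β * x), q / β ∈ cone e ∧ 1 < (q / β).re := by
    have hc : Continuous (fun q : ℂ => q / β) := by fun_prop
    have hc0 : β * x / β = x := by field_simp
    have o1 : IsOpen {z : ℂ | |z.im| < e * z.re} :=
      isOpen_lt (by fun_prop) (by fun_prop)
    have o2 : IsOpen {z : ℂ | 1 < z.re} := isOpen_lt (by fun_prop) (by fun_prop)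
    have := hc.continuousAt.preimage_mem_nhds ((o1.inter o2).mem_nhds (x := β * x / β) (by
      rw [hc0]; exact ⟨by simp; positivity, by simpa using hx1⟩))
    filter_upwards [this] with q hq
    exact ⟨(le_of_lt hq.1 : |(q / β).im| ≤ _), hq.2⟩
  filter_upwards [hnb] with q hq
  obtain ⟨z, rfl⟩ : ∃ z, q = β * z := ⟨q / β, by field_simp⟩
  rw [mul_div_cancel_left₀ _ hβ0] at hq
  obtain ⟨hz, hz1⟩ := hq
  rw [axis x hx1, toF]
  have hxc : (x:ℂ) ∈ cone e := by simp [cone]; positivity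
  have sside : ∀ s : ℝ, 0 ≤ s * z.im → ∀ r ∈ Icc (0:ℝ) 1, (x:ℂ) + r • (z - x) ∈
      {z | z ∈ cone e ∧ 0 ≤ s * z.im ∧ z ≠ 1} := by
    intro s h r hr
    refine ⟨(convex_cone e).add_smul_sub_mem hxc hz hr, ?_, ?_⟩
    · simp; nlinarith [mul_nonneg hr.1 h]
    · intro h
      have := congrArg Complex.re h
      simp at this
      nlinarith [mul_nonneg hr.1 (sub_nonneg.2 hz1.le), mul_nonneg (sub_nonneg.2 hr.2) (sub_nonneg.2 hx1.le), hr.1, hr.2]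
  rcases le_or_gt 0 z.im with h | h
  · have g1 : H.sg e t (β * z) = K.hs F mu z * (K.hs F mu 0)⁻¹ := by
      rcases h.eq_or_lt with h | h
      · have ez : z = (z.re : ℂ) := by apply Complex.ext <;> simp [← h]
        rw [ez]; exact axis _ hz1
      · rw [off 1 (Or.inl rfl) z hz (by simpa using h), ← K.star_seg su (hFc _) mu'
          (im_seg 1 (Or.inl rfl) z hz (by simpa using h))]; group
    have g2 := K.star_seg su (hFc _) mu' (sside 1 (by simpa using h))
    rw [g1, ← g2]
    convert S.one_mem using 1; group
  · have g1 : H.sg e t (β * z) = K.hs F ml z * (K.hs F ml 0)⁻¹ := by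
      rw [off (-1) (Or.inr rfl) z hz (by simpa using h), ← K.star_seg sl (hFc _) ml'
          (im_seg (-1) (Or.inr rfl) z hz (by simpa using h))]; group
    have g2 := K.star_seg sl (hFc _) ml' (sside (-1) (by simpa using h.le))
    rw [g1, ← g2]
    unfold Cl at hCl
    rw [hbt, LU] at hCl
    convert S.inv_mem hCl using 1; group
end Hol

theorem path_ex {E : Type*} [TopologicalSpace E] {X : Set E} {a b : E} (h : JoinedIn X a b) :
    ∃ c : ℝ → E, Continuous c ∧ (∀ r, c r ∈ X) ∧ c 0 = a ∧ c 1 = b := by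
  obtain ⟨γ, hγ⟩ := h
  refine ⟨γ.extend, γ.continuous_extend, fun r => ?_, γ.extend_zero, γ.extend_one⟩
  obtain ⟨s, hs⟩ : γ.extend r ∈ range γ := by rw [← γ.extend_range]; exact mem_range_self r
  rw [← hs]; exact hγ s

theorem fibre_path {t u : ℂ} (hu : (u, t) ∈ Ms) :
    ∃ c : ℝ → ℂ, Continuous c ∧ (∀ r, (c r, t) ∈ Ms) ∧ c 0 = 0 ∧ c 1 = u := by
  have h := (fibre_fin hu.1).countable.isPathConnected_compl_of_one_lt_rank
    (by rw [Complex.rank_real_complex]; norm_num)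
  obtain ⟨c, h1, h2, h3⟩ := path_ex (h.joinedIn 0 (not_not.2 (i_mem hu.1)) u (not_not.2 hu))
  exact ⟨c, h1, fun r => not_not.1 (h2 r), h3⟩

namespace Hol
variable {G : Type*} [Group G] (H : Hol (ℂ × ℂ) Ms G)

theorem slide {c : ℝ → ℂ} (hc : ContinuousOn c (Icc 0 1)) {t : ℂ} (hm : ∀ r ∈ Icc (0:ℝ) 1, (c r, t) ∈ Ms) :
    ∀ᶠ t' in 𝓝 t, (∀ r ∈ Icc (0:ℝ) 1, (c r, t') ∈ Ms) ∧
      H.h (fun r => (c r, t')) = H.hs (fun v => (c 1, v)) t t' * H.h (fun r => (c r, t)) *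
        (H.hs (fun v => (c 0, v)) t t')⁻¹ := by
  have hK : IsCompact ((fun r => (c r, t)) '' Icc 0 1) := isCompact_Icc.image_of_continuousOn
    (hc.prodMk continuousOn_const)
  obtain ⟨δ, hδ, hsub⟩ := hK.exists_thickening_subset_open isOpen_Ms (by
    rintro _ ⟨r, hr, rfl⟩; exact hm r hr)
  have hin : ∀ r ∈ Icc (0:ℝ) 1, ∀ s ∈ Metric.ball t δ, (c r, s) ∈ Ms := by
    intro r hr s hs
    refine hsub (a := (c r, s)) ?_
    rw [Metric.mem_thickening_iff]
    exact ⟨_, ⟨r, hr, rfl⟩, by simpa [Prod.dist_eq, hδ] using hs⟩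
  filter_upwards [Metric.ball_mem_nhds t hδ] with t' ht'
  refine ⟨fun r hr => hin r hr _ ht', ?_⟩
  have := H.sqOn (fun p : ℝ × ℝ => (c p.2, t + p.1 • (t' - t))) ?_ ?_
  · simp only [one_smul, zero_smul, add_zero, add_sub_cancel] at this
    rw [eq_mul_inv_iff_mul_eq]; exact this
  · exact (hc.comp continuousOn_snd (fun p hp => hp.2)).prodMk (by fun_prop)
  · rintro ⟨x, y⟩ ⟨hx, hy⟩
    exact hin y hy _ ((convex_ball t δ).add_smul_sub_mem (Metric.mem_ball_self hδ) ht' hx)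

def Q (S : Subgroup G) (t : ℂ) : Prop := ∃ σ : ℂ → G, σ 0 = H.Y.gY t ∧
  ∀ γ : ℝ → ℂ, ContinuousOn γ (Icc 0 1) → (∀ r ∈ Icc (0:ℝ) 1, (γ r, t) ∈ Ms) →
    (σ (γ 1))⁻¹ * H.h (fun r => (γ r, t)) * σ (γ 0) ∈ S

variable {S : Subgroup G} (hS : ∀ j, (H.Y.om 0)⁻¹ * H.Y.om j ∈ S)
    (hA : H.eA ∈ S) (hB : H.eB ∈ S) (hbu : H.ebu ∈ S) (har : H.ear ∈ S)
include hS hA hB hbu har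

theorem Q_gen {t : ℂ} (ht : t ∈ Ys) (h1 : t.re ≠ 0) (h2 : t.im ≠ 0) : H.Q S t := by
  obtain ⟨c1, c2⟩ := H.Cl_all hS hA hB hbu har
  obtain ⟨σ, h3, h4⟩ := H.stepB ht (S := S) (by
    rintro ε (rfl | rfl) β rfl
    · have : β.im ≠ 0 := fun h => h2 (by
        have : β = (β.re : ℂ) := by apply Complex.ext <;> simp [h]
        rw [this, bb]; simp [pow_succ])
      exact ⟨adm1 ht (Or.inl this), c1 β ht (Or.inl this)⟩
    · have : β.re ≠ 0 := fun h => h1 (by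
        have : β = (β.im : ℂ) * I := by apply Complex.ext <;> simp [h]
        rw [this, bb]; simp [pow_succ])
      exact ⟨admm ht (Or.inl this), c2 β ht (Or.inl this)⟩)
  refine ⟨σ, h3, fun γ hγ hm => ?_⟩
  exact (H.Fb t).local_to_global (fibre_open t) S σ h4 hγ hm

theorem gY_seg {t : ℂ} (ht : t ∈ Ys) : ∀ᶠ t' in 𝓝 t, t' ∈ Ys ∧
    (H.Y.gY t')⁻¹ * H.hs (fun v => ((0:ℂ), v)) t t' * H.Y.gY t ∈ S := by
  obtain ⟨ε, hε, hb⟩ := Metric.isOpen_iff.1 isOpen_Ys _ ht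
  filter_upwards [Metric.ball_mem_nhds t hε] with t' ht'
  refine ⟨hb ht', ?_⟩
  have := H.Y.gY_gen S hS (γ := fun r : ℝ => t + r • (t' - t)) (by fun_prop)
    (fun r hr => hb ((convex_ball t ε).add_smul_sub_mem (Metric.mem_ball_self hε) ht' hr))
  simp only [zero_smul, one_smul, add_zero, add_sub_cancel] at this
  exact this

theorem stepC {t : ℂ} (ht : t ∈ Ys) {γ c c' : ℝ → ℂ} (hγ : ContinuousOn γ (Icc 0 1))
    (hm : ∀ r ∈ Icc (0:ℝ) 1, (γ r, t) ∈ Ms) (hc : Continuous c) (hc' : Continuous c')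
    (mc : ∀ r, (c r, t) ∈ Ms) (mc' : ∀ r, (c' r, t) ∈ Ms) (c0 : c 0 = 0) (c0' : c' 0 = 0)
    (c1 : c 1 = γ 0) (c1' : c' 1 = γ 1) :
    (H.h (fun r => (c' r, t)) * H.Y.gY t)⁻¹ * H.h (fun r => (γ r, t)) *
      (H.h (fun r => (c r, t)) * H.Y.gY t) ∈ S := by
  have ev := (H.slide hγ hm).and ((H.slide hc.continuousOn fun r _ => mc r).and
    ((H.slide hc'.continuousOn fun r _ => mc' r).and (H.gY_seg hS hA hB hbu har ht)))
  have tend : Tendsto (fun s : ℝ => t + s * (1 + I)) (𝓝[>] 0) (𝓝 t) := by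
    have : Tendsto (fun s : ℝ => t + s * (1 + I)) (𝓝 0) (𝓝 (t + (0:ℝ) * (1 + I))) :=
      Continuous.tendsto (by fun_prop) 0
    simp only [ofReal_zero, zero_mul, add_zero] at this
    exact this.mono_left nhdsWithin_le_nhds
  have ne : ∀ x : ℝ, ∀ᶠ s in 𝓝[>] (0:ℝ), x + s ≠ 0 := fun x => by
    rcases le_or_gt 0 x with h | h
    · filter_upwards [self_mem_nhdsWithin] with s hs
      have : 0 < s := hs
      linarith
    · filter_upwards [mem_nhdsWithin_of_mem_nhds (gt_mem_nhds (show (0:ℝ) < -x by linarith))] with s hs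
      have : s < -x := hs
      linarith
  obtain ⟨s, ⟨⟨m1, e1⟩, ⟨m2, e2⟩, ⟨m3, e3⟩, ht', e4⟩, n1, n2⟩ :=
    ((tend.eventually ev).and ((ne t.re).and (ne t.im))).exists
  set t' : ℂ := t + s * (1 + I)
  obtain ⟨σ, h3, h4⟩ := H.Q_gen hS hA hB hbu har ht' (by simpa [t'] using n1) (by simpa [t'] using n2)
  have q1 := h4 γ hγ m1
  have q2 := h4 c hc.continuousOn m2
  have q3 := h4 c' hc'.continuousOn m3
  rw [e1] at q1
  rw [e2] at q2
  rw [e3] at q3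
  rw [c1, c0, h3] at q2
  rw [c1', c0', h3] at q3
  have := S.mul_mem (S.mul_mem (S.mul_mem (S.mul_mem (S.inv_mem e4) (S.inv_mem q3)) q1) q2) e4
  convert this using 1; group

theorem Q_all {t : ℂ} (ht : t ∈ Ys) : H.Q S t := by
  have : ∀ u : ℂ, ∃ c : ℝ → ℂ, (u, t) ∈ Ms → Continuous c ∧ (∀ r, (c r, t) ∈ Ms) ∧ c 0 = 0 ∧ c 1 = u := by
    intro u
    by_cases hu : (u, t) ∈ Ms
    · obtain ⟨c, hc⟩ := fibre_path hu; exact ⟨c, fun _ => hc⟩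
    · exact ⟨0, fun h => absurd h hu⟩
  choose c hc using this
  classical
  refine ⟨fun u => if u = 0 then H.Y.gY t else H.h (fun r => (c u r, t)) * H.Y.gY t, by simp, ?_⟩
  have key : ∀ u, (u, t) ∈ Ms → ∃ c : ℝ → ℂ, (Continuous c ∧ (∀ r, (c r, t) ∈ Ms) ∧ c 0 = 0 ∧ c 1 = u) ∧
      (if u = 0 then H.Y.gY t else H.h (fun r => (‹ℂ → ℝ → ℂ› u r, t)) * H.Y.gY t) =
        H.h (fun r => (c r, t)) * H.Y.gY t := by
    intro u hu
    by_cases h : u = 0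
    · refine ⟨fun _ => 0, ⟨continuous_const, fun _ => i_mem ht, rfl, h.symm⟩, ?_⟩
      rw [if_pos h, H.const' _ (i_mem ht), one_mul]
    · exact ⟨c u, hc u hu, if_neg h⟩
  intro γ hγ hm
  obtain ⟨c0, ⟨a1, a2, a3, a4⟩, a5⟩ := key (γ 0) (hm 0 (by simp))
  obtain ⟨c1, ⟨b1, b2, b3, b4⟩, b5⟩ := key (γ 1) (hm 1 (by simp))
  simp only []
  rw [a5, b5]
  exact H.stepC hS hA hB hbu har ht hγ hm a1 b1 a2 b2 a3 b3 a4 b4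

theorem gen : ∃ g : ℂ × ℂ → G, (∀ t ∈ Ys, g (0, t) = H.Y.gY t) ∧
    ∀ γ : ℝ → ℂ × ℂ, ContinuousOn γ (Icc 0 1) → (∀ r ∈ Icc (0:ℝ) 1, γ r ∈ Ms) →
      (g (γ 1))⁻¹ * H.h γ * g (γ 0) ∈ S := by
  have : ∀ t, ∃ σ : ℂ → G, t ∈ Ys → σ 0 = H.Y.gY t ∧
    ∀ γ : ℝ → ℂ, ContinuousOn γ (Icc 0 1) → (∀ r ∈ Icc (0:ℝ) 1, (γ r, t) ∈ Ms) →
    (σ (γ 1))⁻¹ * H.h (fun r => (γ r, t)) * σ (γ 0) ∈ S := fun t => by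
    by_cases ht : t ∈ Ys
    · obtain ⟨σ, h⟩ := H.Q_all hS hA hB hbu har ht; exact ⟨σ, fun _ => h⟩
    · exact ⟨1, fun h => absurd h ht⟩
  choose σ hσ using this
  refine ⟨fun p => σ p.2 p.1, fun t ht => (hσ t ht).1, fun γ hγ hm => ?_⟩
  refine H.local_to_global isOpen_Ms S (fun p => σ p.2 p.1) ?_ hγ hm
  rintro ⟨u, t⟩ hp
  obtain ⟨c, hc, mc, c0, c1⟩ := fibre_path hp
  obtain ⟨δ, hδ, hb⟩ := Metric.isOpen_iff.1 isOpen_Ms _ hp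
  have ev := (H.slide hc.continuousOn fun r _ => mc r).and (H.gY_seg hS hA hB hbu har hp.1)
  filter_upwards [continuous_snd.continuousAt.eventually ev, Metric.ball_mem_nhds _ hδ] with p' h1 h2
  obtain ⟨u', t'⟩ := p'
  obtain ⟨⟨m, e⟩, ht', e4⟩ := h1
  simp only [] at *
  have hcv := convex_ball ((u, t) : ℂ × ℂ) δ
  have mid : (u, t') ∈ Metric.ball ((u, t) : ℂ × ℂ) δ := by
    rw [Metric.mem_ball, Prod.dist_eq, max_lt_iff] at h2 ⊢
    exact ⟨by simpa using hδ, h2.2⟩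
  have self := Metric.mem_ball_self (x := ((u, t) : ℂ × ℂ)) hδ
  have T := H.tri hcv continuousOn_id hb self mid h2
  have f1 : H.hs id (u, t) (u, t') = H.hs (fun v => (c 1, v)) t t' := by
    apply H.hs_congr; intro r _; simp [c1]
  have f2 := (hσ t' ht').2 (fun r : ℝ => u + r • (u' - u)) (by fun_prop) (fun r hr => by
    have := hb (hcv.add_smul_sub_mem mid h2 hr)
    simpa using this)
  have f2' : H.hs id (u, t') (u', t') = H.h (fun r : ℝ => (u + r • (u' - u), t')) := by
    unfold hs; congr 1; ext1 r; simp
  have q1 := (hσ t' ht').2 c hc.continuousOn m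
  have q2 := (hσ t hp.1).2 c hc.continuousOn fun r _ => mc r
  rw [c0, (hσ t' ht').1, e] at q1
  rw [c0, (hσ t hp.1).1] at q2
  rw [← T, f1, f2']
  simp only [zero_smul, one_smul, add_zero, add_sub_cancel] at f2
  rw [c1] at *
  rw [c0] at *
  have := S.mul_mem (S.mul_mem (S.mul_mem f2 q1) e4) (S.inv_mem q2)
  convert this using 1; group
end Hol

structure Cov {Z E : Type*} [TopologicalSpace Z] [TopologicalSpace E] (q : Z → E) (X : Set E)
    (D : Type*) where
  cov : IsCoveringMapOn q X
  T : E → D → Z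
  T' : Z → D
  qT : ∀ a ∈ X, ∀ d, q (T a d) = a
  TT' : ∀ z, q z ∈ X → T (q z) (T' z) = z
  T'T : ∀ a ∈ X, ∀ d, T' (T a d) = d

namespace Cov
variable {Z E D : Type*} [TopologicalSpace Z] [TopologicalSpace E] {q : Z → E} {X : Set E}
  (C : Cov q X D)

def ok (X : Set E) (γ : ℝ → E) : Prop :=
  ContinuousOn γ (Icc 0 1) ∧ ∀ r ∈ Icc (0:ℝ) 1, γ r ∈ X

noncomputable def cl (γ : ℝ → E) (r : ℝ) : E := γ (projIcc (0:ℝ) 1 zero_le_one r)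
theorem cl_eq (γ : ℝ → E) {r : ℝ} (h : r ∈ Icc (0:ℝ) 1) : cl γ r = γ r := by
  simp [cl, projIcc_of_mem _ h]
theorem cl_cont {γ : ℝ → E} (h : ContinuousOn γ (Icc 0 1)) : Continuous (cl γ) :=
  h.comp_continuous (by fun_prop) fun r => Subtype.coe_prop _

include C in
theorem lift_ex {γ : ℝ → E} (h : ok X γ) {s : ℝ} (hs : s ∈ Icc (0:ℝ) 1) {z : Z}
    (hz : q z = γ s) : ∃ γ' : ℝ → Z, Continuous γ' ∧ (∀ r ∈ Icc (0:ℝ) 1, q (γ' r) = γ r) ∧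
      γ' s = z := by
  obtain ⟨F, ⟨h1, h2⟩, -⟩ := C.cov.existsUnique_continuousMap_lifts ⟨cl γ, cl_cont h.1⟩
    (a₀ := s) (e₀ := z) (by simp [cl_eq _ hs, hz]) (fun a => h.2 _ (Subtype.coe_prop _))
  refine ⟨F, F.continuous, fun r hr => ?_, h1⟩
  have := congrFun h2 r
  simpa [cl_eq _ hr] using this

include C in
theorem lift_un {a b : ℝ → Z} (ha : ContinuousOn a (Icc 0 1)) (hb : ContinuousOn b (Icc 0 1))
    (hm : ∀ r ∈ Icc (0:ℝ) 1, q (a r) ∈ X) (h : ∀ r ∈ Icc (0:ℝ) 1, q (a r) = q (b r))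
    {s : ℝ} (hs : s ∈ Icc (0:ℝ) 1) (hab : a s = b s) : ∀ r ∈ Icc (0:ℝ) 1, a r = b r := by
  have hq : ContinuousOn (fun r => q (a r)) (Icc 0 1) := fun r hr =>
    (C.cov.continuousAt (hm r hr)).comp_continuousWithinAt (f := a) (ha r hr)
  obtain ⟨F, -, hF⟩ := C.cov.existsUnique_continuousMap_lifts
    ⟨cl (fun r => q (a r)), cl_cont hq⟩
    (a₀ := s) (e₀ := a s) (by simp [cl_eq _ hs]) (fun r => hm _ (Subtype.coe_prop _))
  have e1 := hF ⟨cl a, cl_cont ha⟩ ⟨by simp [cl_eq _ hs], rfl⟩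
  have e2 := hF ⟨cl b, cl_cont hb⟩ ⟨by simp [cl_eq _ hs, hab], by
    funext r; exact (h _ (Subtype.coe_prop _)).symm⟩
  intro r hr
  have := congrArg (fun F : C(ℝ, Z) => F r) (e1.trans e2.symm)
  simpa [cl_eq _ hr] using this

variable {Γ : Type*} [Group Γ] (HZ : Hol Z (q ⁻¹' X) Γ)

def Rel (γ : ℝ → E) (p p' : D × Γ) : Prop := ∃ γ' : ℝ → Z, ContinuousOn γ' (Icc 0 1) ∧
  (∀ r ∈ Icc (0:ℝ) 1, q (γ' r) = γ r) ∧ p.1 = C.T' (γ' 0) ∧ p'.1 = C.T' (γ' 1) ∧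
  p'.2 = HZ.h γ' * p.2

theorem i0 : (0:ℝ) ∈ Icc (0:ℝ) 1 := by simp
theorem i1 : (1:ℝ) ∈ Icc (0:ℝ) 1 := by simp

theorem inj {z z' : Z} (h : q z = q z') (hX : q z ∈ X) (h' : C.T' z = C.T' z') : z = z' := by
  rw [← C.TT' z hX, ← C.TT' z' (h ▸ hX), h, h']

theorem rel_ex {γ : ℝ → E} (h : ok X γ) (p) : ∃ p', C.Rel HZ γ p p' := by
  obtain ⟨γ', h1, h2, h3⟩ := C.lift_ex h i0 (z := C.T (γ 0) p.1) (C.qT _ (h.2 _ i0) _)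
  exact ⟨(C.T' (γ' 1), HZ.h γ' * p.2), γ', h1.continuousOn, h2,
    by rw [h3, C.T'T _ (h.2 _ i0)], rfl, rfl⟩
theorem rel_ex' {γ : ℝ → E} (h : ok X γ) (p) : ∃ p', C.Rel HZ γ p' p := by
  obtain ⟨γ', h1, h2, h3⟩ := C.lift_ex h i1 (z := C.T (γ 1) p.1) (C.qT _ (h.2 _ i1) _)
  exact ⟨(C.T' (γ' 0), (HZ.h γ')⁻¹ * p.2), γ', h1.continuousOn, h2, rfl,
    by rw [h3, C.T'T _ (h.2 _ i1)], by simp⟩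
theorem rel_un {γ : ℝ → E} (h : ok X γ) {p p' p'' : D × Γ} (h1 : C.Rel HZ γ p p')
    (h2 : C.Rel HZ γ p p'') : p' = p'' := by
  obtain ⟨a, a1, a2, a3, a4, a5⟩ := h1
  obtain ⟨b, b1, b2, b3, b4, b5⟩ := h2
  have hq : ∀ r ∈ Icc (0:ℝ) 1, q (a r) = q (b r) := fun r hr => by rw [a2 r hr, b2 r hr]
  have := C.lift_un a1 b1 (fun r hr => by rw [a2 r hr]; exact h.2 r hr) hq i0
    (C.inj (hq 0 i0) (by rw [a2 0 i0]; exact h.2 0 i0) (by rw [← a3, ← b3]))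
  ext
  · rw [a4, b4, this 1 i1]
  · rw [a5, b5, HZ.congr' a b this]
theorem rel_un' {γ : ℝ → E} (h : ok X γ) {p p' p'' : D × Γ} (h1 : C.Rel HZ γ p' p)
    (h2 : C.Rel HZ γ p'' p) : p' = p'' := by
  obtain ⟨a, a1, a2, a3, a4, a5⟩ := h1
  obtain ⟨b, b1, b2, b3, b4, b5⟩ := h2
  have hq : ∀ r ∈ Icc (0:ℝ) 1, q (a r) = q (b r) := fun r hr => by rw [a2 r hr, b2 r hr]
  have := C.lift_un a1 b1 (fun r hr => by rw [a2 r hr]; exact h.2 r hr) hq i1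
    (C.inj (hq 1 i1) (by rw [a2 1 i1]; exact h.2 1 i1) (by rw [← a4, ← b4]))
  ext
  · rw [a3, b3, this 0 i0]
  · rw [a5, HZ.congr' a b this] at b5
    simpa using b5

open Classical in
noncomputable def hh (γ : ℝ → E) : Equiv.Perm (D × Γ) := if h : ok X γ then
  { toFun := fun p => (C.rel_ex HZ h p).choose
    invFun := fun p => (C.rel_ex' HZ h p).choose
    left_inv := fun p => C.rel_un' HZ h (C.rel_ex' HZ h _).choose_spec (C.rel_ex HZ h p).choose_spec
    right_inv := fun p => C.rel_un HZ h (C.rel_ex HZ h _).choose_spec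
      (C.rel_ex' HZ h p).choose_spec } else 1

theorem hh_app {γ' : ℝ → Z} {γ : ℝ → E} (hc : ContinuousOn γ' (Icc 0 1))
    (hq : ∀ r ∈ Icc (0:ℝ) 1, q (γ' r) = γ r) (hm : ∀ r ∈ Icc (0:ℝ) 1, γ r ∈ X) (g : Γ) :
    C.hh HZ γ (C.T' (γ' 0), g) = (C.T' (γ' 1), HZ.h γ' * g) := by
  have h : ok X γ := by
    refine ⟨fun r hr => ?_, hm⟩
    refine ((C.cov.continuousAt (hq r hr ▸ hm r hr)).comp_continuousWithinAt (f := γ')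
      (hc r hr)).congr (fun s hs => (hq s hs).symm) (hq r hr).symm
  rw [hh, dif_pos h]
  exact C.rel_un HZ h (C.rel_ex HZ h _).choose_spec ⟨γ', hc, hq, rfl, rfl, rfl⟩

noncomputable def hol : Hol E X (Equiv.Perm (D × Γ)) where
  h := C.hh HZ
  congr' γ γ' h := by
    have e : ok X γ ↔ ok X γ' := by
      unfold ok
      rw [continuousOn_congr h]
      exact and_congr Iff.rfl (forall₂_congr fun r hr => by rw [h r hr])
    have e' : C.Rel HZ γ = C.Rel HZ γ' := by
      funext p p'
      unfold Rel
      simp only [eq_iff_iff]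
      exact exists_congr fun a => and_congr Iff.rfl (and_congr
        (forall₂_congr fun r hr => by rw [h r hr]) Iff.rfl)
    by_cases hγ : ok X γ
    · ext1 p
      rw [hh, dif_pos hγ, hh, dif_pos (e.1 hγ)]
      refine C.rel_un HZ hγ (C.rel_ex HZ hγ _).choose_spec ?_
      rw [e']
      exact (C.rel_ex HZ (e.1 hγ) _).choose_spec
    · rw [hh, dif_neg hγ, hh, dif_neg (fun h => hγ (e.2 h))]
  const' x hx := by
    ext1 p
    have hq := C.qT x hx p.1
    have := C.hh_app HZ (γ' := fun _ => C.T x p.1) (γ := fun _ => x) continuousOn_const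
      (fun r _ => hq) (fun r _ => hx) p.2
    simp only [C.T'T _ hx] at this
    rw [HZ.const' _ (by rw [mem_preimage, hq]; exact hx)] at this
    simpa using this
  sq' F hF hX := by
    ext1 p
    obtain ⟨F', ⟨h1, h2⟩, -⟩ := C.cov.existsUnique_continuousMap_lifts ⟨F, hF⟩
      (a₀ := (0, 0)) (e₀ := C.T (F (0, 0)) p.1) (C.qT _ (hX _) _) hX
    have h3 : ∀ x, q (F' x) = F x := fun x => congrFun h2 x
    have hp : p = (C.T' (F' (0, 0)), p.2) := by rw [h1, C.T'T _ (hX _)]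
    have key := HZ.sq' F' F'.continuous (fun x => by rw [mem_preimage, h3]; exact hX x)
    have c : ∀ u : ℝ → ℝ × ℝ, Continuous u → ContinuousOn (fun r => F' (u r)) (Icc 0 1) :=
      fun u hu => (F'.continuous.comp hu).continuousOn
    rw [hp, Equiv.Perm.mul_apply, Equiv.Perm.mul_apply,
      C.hh_app HZ (c (fun r => (r, 0)) (by fun_prop)) (fun r _ => h3 _) (fun r _ => hX _),
      C.hh_app HZ (c (fun r => (1, r)) (by fun_prop)) (fun r _ => h3 _) (fun r _ => hX _),
      C.hh_app HZ (c (fun r => (0, r)) (by fun_prop)) (fun r _ => h3 _) (fun r _ => hX _),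
      C.hh_app HZ (c (fun r => (r, 1)) (by fun_prop)) (fun r _ => h3 _) (fun r _ => hX _),
      ← mul_assoc, ← mul_assoc, key]

theorem hol_app {γ' : ℝ → Z} {γ : ℝ → E} (hc : ContinuousOn γ' (Icc 0 1))
    (hq : ∀ r ∈ Icc (0:ℝ) 1, q (γ' r) = γ r) (hm : ∀ r ∈ Icc (0:ℝ) 1, γ r ∈ X) (g : Γ) :
    (C.hol HZ).h γ (C.T' (γ' 0), g) = (C.T' (γ' 1), HZ.h γ' * g) := C.hh_app HZ hc hq hm g
end Cov

abbrev F3 := FreeGroup (Fin 3)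
def kk : Fin 4 → F3 := ![1, .of 0, .of 1, .of 1 * .of 2]
open Classical in
noncomputable def kf (t : ℂ) : F3 := if h : ∃ j, t ∈ W j then kk h.choose else 1
theorem W_disj {t : ℂ} {i j} (hi : t ∈ W i) (hj : t ∈ W j) : i = j := by
  fin_cases i <;> fin_cases j <;> first | rfl | (simp [W] at hi hj; exfalso; linarith)
theorem kf_eq {t : ℂ} {j} (h : t ∈ W j) : kf t = kk j := by
  have h' : ∃ j, t ∈ W j := ⟨j, h⟩
  rw [kf, dif_pos h', W_disj h h'.choose_spec]
theorem isOpen_W (j) : IsOpen (W j) := by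
  fin_cases j
  · exact (isOpen_lt continuous_const continuous_re).inter
      ((isOpen_lt continuous_re continuous_const).inter (isOpen_lt continuous_im continuous_const))
  · exact (isOpen_lt continuous_const continuous_re).inter
      (isOpen_lt continuous_im continuous_const)
  · exact (isOpen_lt continuous_const continuous_im).inter
      ((isOpen_lt continuous_im continuous_const).inter (isOpen_lt continuous_re continuous_const))
  · exact (isOpen_lt continuous_const continuous_im).inter
      (isOpen_lt continuous_re continuous_const)

@[reducible] def dF3 : TopologicalSpace F3 := ⊥
def Dd (b : Bool) : Set Ys := {t | (t:ℂ) ∈ if b then D3 else D1}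
noncomputable def cch (i j : Bool) (t : Ys) : F3 :=
  if i = j then 1 else if i then kf t else (kf t)⁻¹
open Classical in
noncomputable def core : @FiberBundleCore Bool Ys _ F3 dF3 :=
  letI := dF3
  haveI : DiscreteTopology F3 := ⟨rfl⟩
  { baseSet := Dd
    isOpen_baseSet := fun i => by
      cases i
      · exact isOpen_D1.preimage continuous_subtype_val
      · exact isOpen_D3.preimage continuous_subtype_val
    indexAt := fun t => if (t:ℂ) ∈ D3 then true else false
    mem_baseSet_at := fun t => by
      by_cases h : (t:ℂ) ∈ D3
      · simpa [h, Dd] using h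
      · have := Ys_sub t.2
        simp only [h, Dd]
        simp; tauto
    coordChange := fun i j t x => cch i j t * x
    coordChange_self := fun i t _ x => by simp [cch]
    continuousOn_coordChange := fun i j => by
      have : ContinuousOn (cch i j) (Dd i ∩ Dd j) := by
        by_cases hij : i = j
        · subst hij
          exact (continuousOn_const (c := 1)).congr fun t _ => by simp [cch]
        · intro t ht
          have h31 : (t:ℂ) ∈ D3 ∧ (t:ℂ) ∈ D1 := by
            revert ht; cases i <;> cases j <;> simp_all [Dd]
          obtain ⟨l, hl⟩ := W_mem h31.1 h31.2
          apply ContinuousAt.continuousWithinAt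
          refine (continuousAt_const (y := cch i j t)).congr ?_
          filter_upwards [((isOpen_W l).preimage continuous_subtype_val).mem_nhds hl] with s hs
          simp only [cch, kf_eq hl, kf_eq (t := s) hs]
      exact (continuous_mul).comp_continuousOn ((this.comp continuousOn_fst
        (fun x hx => hx.1)).prodMk continuousOn_snd)
    coordChange_comp := fun i j k t _ x => by
      cases i <;> cases j <;> cases k <;> simp [cch] }

noncomputable def trivH {E : Type*} [TopologicalSpace E] (X : Set E) : Hol E X Unit :=
  ⟨fun _ => (), fun _ _ _ => rfl, fun _ _ => rfl, fun _ _ _ => rfl⟩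

open Classical in
noncomputable def toYs (t : ℂ) : Ys := if h : t ∈ Ys then ⟨t, h⟩ else ⟨t3, D3_sub t3_mem⟩
theorem toYs_of {t : ℂ} (h : t ∈ Ys) : toYs t = ⟨t, h⟩ := dif_pos h
theorem toYs_cont : ContinuousOn toYs Ys := by
  rw [continuousOn_iff_continuous_restrict]
  have : Ys.domRestrict toYs = id := by
    funext t; exact toYs_of t.2
  rw [this]; exact continuous_id

theorem t1_mem : t1 ∈ D1 := by
  simp [t1, D1]
theorem exists_hF : ∃ K : Hol ℂ Ys (Equiv.Perm (F3 × Unit)),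
    ∀ j x, K.om j x = (kk j * x.1, ()) := by
  letI := dF3
  haveI : DiscreteTopology F3 := ⟨rfl⟩
  let C : Cov (core.proj) univ F3 :=
    { cov := (isCoveringMap_iff_isCoveringMapOn_univ).1 (FiberBundle.isCoveringMap (F := F3))
      T := fun a d => ⟨a, d⟩
      T' := fun z => z.2
      qT := fun _ _ _ => rfl
      TT' := fun _ _ => rfl
      T'T := fun _ _ _ => rfl }
  let K : Hol ℂ Ys (Equiv.Perm (F3 × Unit)) :=
    (C.hol (trivH _)).comap toYs Ys toYs_cont (fun _ _ => mem_univ _)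
  have key : ∀ (i : Bool) (p q : ℂ), (∀ r ∈ Icc (0:ℝ) 1,
      p + r • (q - p) ∈ if i then D3 else D1) → ∀ x,
      K.hs id p q (cch i (core.indexAt (toYs p)) (toYs p) * x, ()) =
        (cch i (core.indexAt (toYs q)) (toYs q) * x, ()) := by
    intro i p q h x
    have hsub : (if i then D3 else D1) ⊆ Ys := by
      cases i
      · exact D1_sub
      · exact D3_sub
    let γ : ℝ → Ys := fun r => toYs (p + r • (q - p))
    have hγ : ContinuousOn γ (Icc 0 1) :=
      toYs_cont.comp (by fun_prop) (fun r hr => hsub (h r hr))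
    have hb : ∀ r ∈ Icc (0:ℝ) 1, γ r ∈ core.baseSet i := fun r hr => by
      change γ r ∈ Dd i
      simp only [γ, toYs_of (hsub (h r hr))]; exact h r hr
    have h1 := C.hol_app (trivH _) (γ := γ) (γ' := fun r =>
      (core.localTriv i).toOpenPartialHomeomorph.symm (γ r, x))
      ((core.localTriv i).toOpenPartialHomeomorph.continuousOn_symm.comp
        (hγ.prodMk continuousOn_const) (fun r hr => by
          exact (core.mem_localTriv_target i _).2 (hb r hr)))
      (fun r hr => rfl) (fun _ _ => mem_univ _) ()
    have e : ∀ r, C.T' ((core.localTriv i).toOpenPartialHomeomorph.symm (γ r, x)) =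
      cch i (core.indexAt (γ r)) (γ r) * x := fun r => rfl
    simp only [e] at h1
    have e0 : γ 0 = toYs p := by simp [γ]
    have e1 : γ 1 = toYs q := by simp [γ]
    rw [e0, e1] at h1
    exact h1
  refine ⟨K, fun j x => ?_⟩
  have m3 := sW_mem j
  have i3 : core.indexAt (toYs t3) = true := if_pos (by rw [toYs_of (D3_sub t3_mem)]; exact t3_mem)
  have i1 : core.indexAt (toYs t1) = false := if_neg (by
    rw [toYs_of (D1_sub t1_mem)]; simp [t1, D3])
  have ij : core.indexAt (toYs (sW j)) = true := if_pos (by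
    rw [toYs_of (D3_sub (W_sub3 j m3))]; exact W_sub3 j m3)
  have seg : ∀ {D : Set ℂ} {c p : ℂ}, StarConvex ℝ c D → p ∈ D → ∀ r ∈ Icc (0:ℝ) 1,
      c + r • (p - c) ∈ D := fun hD hp r hr => by
    exact hD.add_smul_sub_mem hp hr.1 hr.2
  have k3 := key true t3 (sW j) (seg star_D3 (W_sub3 j m3)) x.1
  have k1 := key false t1 (sW j) (seg star_D1 (W_sub1 j m3)) (kk j * x.1)
  rw [i3, ij] at k3
  rw [i1, ij] at k1
  have ek : kf (toYs (sW j)) = kk j := by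
    rw [toYs_of (D3_sub (W_sub3 j m3))]; exact kf_eq m3
  simp [cch, ek] at k3 k1
  rw [Hol.om, Equiv.Perm.mul_apply, Equiv.Perm.inv_eq_iff_eq]
  exact k3.trans k1.symm

section
variable {E : Type*} [TopologicalSpace E] {X : Set E}
open Cov (ok i0 i1)

def pth (γ : ℝ → E) (h : ok X γ) : Path (⟨γ 0, h.2 0 i0⟩ : X) ⟨γ 1, h.2 1 i1⟩ where
  toFun r := ⟨γ r, h.2 r r.2⟩
  continuous_toFun := by
    refine Continuous.subtype_mk ?_ _
    exact h.1.comp_continuous continuous_subtype_val (fun r => r.2)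
  source' := by simp
  target' := by simp

variable [PathConnectedSpace X] (x0 : X)
noncomputable def kap (v : X) : Path x0 v := PathConnectedSpace.somePath x0 v
open Classical in
noncomputable def hUh (γ : ℝ → E) : FundamentalGroup X x0 := if h : ok X γ then
  FundamentalGroup.fromPath (Path.Homotopic.Quotient.mk
    (((kap x0 _).trans (pth γ h)).trans (kap x0 _).symm)) else 1

theorem hUh_ok {γ : ℝ → E} (h : ok X γ) {a b : X} (p : Path a b) (ha : a = γ 0) (hb : b = γ 1)
    (hp : ∀ r, (p r : E) = γ r) : hUh x0 γ = FundamentalGroup.fromPath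
      (Path.Homotopic.Quotient.mk (((kap x0 a).trans p).trans (kap x0 b).symm)) := by
  obtain rfl : a = ⟨γ 0, h.2 0 i0⟩ := Subtype.ext ha
  obtain rfl : b = ⟨γ 1, h.2 1 i1⟩ := Subtype.ext hb
  have : p = pth γ h := by ext r; exact hp r
  rw [hUh, dif_pos h, this]

theorem hU_mul {a b c : X} (p : Path a b) (q : Path b c) :
    FundamentalGroup.fromPath (Path.Homotopic.Quotient.mk (((kap x0 b).trans q).trans (kap x0 c).symm)) *
    FundamentalGroup.fromPath (Path.Homotopic.Quotient.mk (((kap x0 a).trans p).trans (kap x0 b).symm)) =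
    FundamentalGroup.fromPath (Path.Homotopic.Quotient.mk (((kap x0 a).trans (p.trans q)).trans
      (kap x0 c).symm)) := by
  rw [FundamentalGroup.mul_def]
  congr 1
  change (Path.Homotopic.Quotient.mk _).trans (Path.Homotopic.Quotient.mk _) = _
  simp only [Path.Homotopic.Quotient.mk_trans, Path.Homotopic.Quotient.mk_symm, Path.Homotopic.Quotient.trans_assoc]
  congr 2
  rw [← Path.Homotopic.Quotient.trans_assoc, Path.Homotopic.Quotient.symm_trans, Path.Homotopic.Quotient.refl_trans]

theorem lift_sq (F : ℝ × ℝ → E) (hF : Continuous F) (hX : ∀ p, F p ∈ X) {a b : ℝ × ℝ}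
    (p q : Path a b) : Path.Homotopic.Quotient.mk (p.map (f := fun x => (⟨F x, hX x⟩ : X))
      (hF.subtype_mk _)) = Path.Homotopic.Quotient.mk (q.map (hF.subtype_mk _)) :=
  (Path.Homotopic.Quotient.eq).2
    ((SimplyConnectedSpace.paths_homotopic p q).map ⟨_, hF.subtype_mk _⟩)

def sgp (a b : ℝ × ℝ) : Path a b where
  toFun r := a + (r:ℝ) • (b - a)
  source' := by simp
  target' := by simp

noncomputable def hUo : Hol E X (FundamentalGroup X x0) where
  h := hUh x0
  congr' γ γ' h := by
    have e : ok X γ ↔ ok X γ' := by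
      unfold ok
      rw [continuousOn_congr h]
      exact and_congr Iff.rfl (forall₂_congr fun r hr => by rw [h r hr])
    by_cases hγ : ok X γ
    · rw [hUh, dif_pos hγ, hUh_ok x0 (e.1 hγ) (pth γ hγ) (h 0 i0) (h 1 i1) fun r => h r r.2]
    · rw [hUh, dif_neg hγ, hUh, dif_neg (fun h => hγ (e.2 h))]
  const' x hx := by
    rw [hUh_ok x0 ⟨continuousOn_const, fun _ _ => hx⟩ (Path.refl (⟨x, hx⟩ : X)) rfl rfl
      (fun _ => rfl), FundamentalGroup.one_def]
    congr 1
    simp only [Path.Homotopic.Quotient.mk_trans, Path.Homotopic.Quotient.mk_symm,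
      Path.Homotopic.Quotient.mk_refl, Path.Homotopic.Quotient.trans_refl,
      Path.Homotopic.Quotient.trans_symm]
  sq' F hF hX := by
    have key : ∀ (u : ℝ → ℝ × ℝ) (a b : ℝ × ℝ), (∀ r, u r = a + r • (b - a)) →
        hUh x0 (fun r => F (u r)) = FundamentalGroup.fromPath (Path.Homotopic.Quotient.mk
          (((kap x0 _).trans ((sgp a b).map (f := fun x => (⟨F x, hX x⟩ : X))
            (hF.subtype_mk _))).trans (kap x0 _).symm)) := by
      intro u a b h
      obtain rfl := funext h
      exact hUh_ok x0 ⟨by fun_prop, fun _ _ => hX _⟩ _ (by simp) (by simp) (fun r => rfl)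
    rw [key (fun r => (1, r)) (1, 0) (1, 1) (by simp), key (fun r => (r, 0)) (0, 0) (1, 0) (by simp),
      key (fun r => (r, 1)) (0, 1) (1, 1) (by simp), key (fun r => (0, r)) (0, 0) (0, 1) (by simp),
      hU_mul, hU_mul, ← Path.map_trans, ← Path.map_trans]
    have := lift_sq F hF hX ((sgp (0, 0) (1, 0)).trans (sgp (1, 0) (1, 1)))
      ((sgp (0, 0) (0, 1)).trans (sgp (0, 1) (1, 1)))
    congr 1
    simp only [Path.Homotopic.Quotient.mk_trans (kap x0 _ |>.trans _),
      Path.Homotopic.Quotient.mk_trans (kap x0 _), this]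

theorem hU_surj (g : FundamentalGroup X x0) : ∃ γ : ℝ → E, ok X γ ∧ γ 0 = x0 ∧ γ 1 = x0 ∧
    (hUo x0).h γ = g := by
  obtain ⟨p, hp⟩ := Path.Homotopic.Quotient.mk_surjective (FundamentalGroup.toPath g)
  let q := ((kap x0 x0).symm.trans p).trans (kap x0 x0)
  refine ⟨fun r => (q.extend r : E), ⟨by fun_prop, fun r _ => Subtype.coe_prop _⟩, by simp,
    by simp, ?_⟩
  change hUh x0 _ = g
  rw [hUh_ok x0 ⟨by fun_prop, fun r _ => Subtype.coe_prop _⟩ q (by simp) (by simp) (by simp)]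
  have : g = FundamentalGroup.fromPath (Path.Homotopic.Quotient.mk p) := by rw [hp]
  rw [this]
  congr 1
  simp only [q, Path.Homotopic.Quotient.mk_trans, Path.Homotopic.Quotient.mk_symm,
    Path.Homotopic.Quotient.trans_assoc]
  rw [Path.Homotopic.Quotient.trans_symm, Path.Homotopic.Quotient.trans_refl,
    ← Path.Homotopic.Quotient.trans_assoc, Path.Homotopic.Quotient.trans_symm,
    Path.Homotopic.Quotient.refl_trans]

namespace Hol
variable {G : Type*} [Group G] (K : Hol E X G)
omit [PathConnectedSpace X]
noncomputable def kp {a b : X} (p : Path a b) : G := K.h (fun r => (p.extend r : E))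
theorem kp_hom {a b : X} {p q : Path a b} (h : p.Homotopic q) : K.kp p = K.kp q := by
  obtain ⟨H⟩ := h
  have := K.sq' (fun x => (H (projIcc 0 1 zero_le_one x.1, projIcc 0 1 zero_le_one x.2) : E))
    (by fun_prop) (fun x => Subtype.coe_prop _)
  simp only [projIcc_left, projIcc_right] at this
  have e : ∀ s : unitInterval, (s, (0 : unitInterval)) = (s, 0) := fun _ => rfl
  have e0 : (⟨0, left_mem_Icc.2 zero_le_one⟩ : Icc (0:ℝ) 1) = (0 : unitInterval) := rfl
  have e1 : (⟨1, right_mem_Icc.2 zero_le_one⟩ : Icc (0:ℝ) 1) = (1 : unitInterval) := rfl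
  simp only [e0, e1, H.source, H.target, H.apply_zero, H.apply_one] at this
  rw [K.const' _ a.2, K.const' _ b.2, mul_one, one_mul] at this
  exact this.symm
theorem kp_trans {a b c : X} (p : Path a b) (q : Path b c) :
    K.kp (p.trans q) = K.kp q * K.kp p := by
  have := K.tri (K := univ) convex_univ (F := fun r : ℝ => ((p.trans q).extend r : E))
    (a := 0) (b := 1/2) (c := 1) (by fun_prop) (fun _ _ => Subtype.coe_prop _) trivial trivial
    trivial
  rw [← K.h_eq_hs] at this
  rw [kp, ← this]
  congr 1
  · refine K.congr' _ _ fun r hr => ?_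
    have h2 : (1/2 : ℝ) ≤ 1/2 + r • (1 - 1/2) := by simp; linarith [hr.1]
    beta_reduce
    rw [Path.extend_trans_of_half_le _ _ h2]
    congr 2; simp only [smul_eq_mul]; ring
  · refine K.congr' _ _ fun r hr => ?_
    have h2 : (0:ℝ) + r • (1/2 - 0) ≤ 1/2 := by simp; linarith [hr.2]
    beta_reduce
    rw [Path.extend_trans_of_le_half _ _ h2]
    congr 2; simp only [smul_eq_mul]; ring
theorem kp_refl (a : X) : K.kp (Path.refl a) = 1 := by
  rw [kp, ← K.const' _ a.2]; simp
theorem kp_symm {a b : X} (p : Path a b) : K.kp p.symm = (K.kp p)⁻¹ := by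
  rw [eq_inv_iff_mul_eq_one, ← kp_trans, ← K.kp_refl a]
  exact (K.kp_hom ⟨Path.Homotopy.reflTransSymm p⟩).symm
noncomputable def phi : FundamentalGroup X x0 →* G where
  toFun g := Quotient.lift (fun p : Path x0 x0 => K.kp p) (fun _ _ h => K.kp_hom h)
    (FundamentalGroup.toPath g)
  map_one' := K.kp_refl x0
  map_mul' g g' := by
    obtain ⟨p, hp⟩ := Path.Homotopic.Quotient.mk_surjective (FundamentalGroup.toPath g)
    obtain ⟨p', hp'⟩ := Path.Homotopic.Quotient.mk_surjective (FundamentalGroup.toPath g')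
    have e : g = FundamentalGroup.fromPath (Path.Homotopic.Quotient.mk p) := by rw [hp]
    have e' : g' = FundamentalGroup.fromPath (Path.Homotopic.Quotient.mk p') := by rw [hp']
    rw [e, e', FundamentalGroup.mul_def]
    exact K.kp_trans p' p
variable [PathConnectedSpace X]
open Classical in
noncomputable def nn (v : E) : G := if h : v ∈ X then K.kp (kap x0 ⟨v, h⟩) else 1
theorem phi_hU {γ : ℝ → E} (h : ok X γ) :
    K.phi x0 ((hUo x0).h γ) = (K.nn x0 (γ 1))⁻¹ * K.h γ * K.nn x0 (γ 0) := by
  change K.phi x0 (hUh x0 γ) = _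
  rw [hUh, dif_pos h]
  change K.kp _ = _
  rw [kp_trans, kp_trans, kp_symm, nn, nn, dif_pos (h.2 0 i0), dif_pos (h.2 1 i1), mul_assoc]
  congr 2
  refine K.congr' _ _ fun r hr => ?_
  simp [Path.extend, pth, IccExtend, projIcc_of_mem _ hr]
end Hol
end

noncomputable def qp (p : ℂ × ℂ) : ℂ × ℂ := (p.1 * p.2, f p)
@[fun_prop] theorem cont_f : Continuous f := by unfold f; fun_prop
@[fun_prop] theorem cont_qp : Continuous qp := by unfold qp; fun_prop
abbrev UU : Set (ℂ × ℂ) := U ({0, 4, 4 * Complex.I} : Set ℂ)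
theorem mem_UU {p : ℂ × ℂ} : p ∈ UU ↔ f p ∈ Ys := by
  simp [U, Ys]
theorem qp_iff {p : ℂ × ℂ} : qp p ∈ Ms ↔ p ∈ UU ∧ p.1 ^ 6 ≠ p.2 ^ 6 := by
  rw [mem_UU]
  simp only [Ms, qp, mem_ofPred_eq]
  refine and_congr Iff.rfl ?_
  have : (p.1 ^ 6 - p.2 ^ 6) ^ 2 = (f p - bb 1 (p.1 * p.2)) * (f p - bb (-1) (p.1 * p.2)) := by
    unfold f bb; ring
  rw [← sub_ne_zero, ← sub_ne_zero (b := bb (-1) _), ← mul_ne_zero_iff, ← this,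
    ← sub_ne_zero (b := p.2 ^ 6)]
  simp

def act (d : rootsOfUnity 6 ℂ × Bool) (p : ℂ × ℂ) : ℂ × ℂ :=
  if d.2 then ((d.1 : ℂˣ) * p.1, ((d.1 : ℂˣ)⁻¹ : ℂˣ) * p.2) else
    ((d.1 : ℂˣ) * p.2, ((d.1 : ℂˣ)⁻¹ : ℂˣ) * p.1)
theorem ru (z : rootsOfUnity 6 ℂ) : ((z : ℂˣ) : ℂ) ^ 6 = 1 := by
  have := z.2
  rw [_root_.mem_rootsOfUnity] at this
  have h := congrArg Units.val this
  simpa using h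
theorem ru' (z : rootsOfUnity 6 ℂ) : (((z : ℂˣ)⁻¹ : ℂˣ) : ℂ) ^ 6 = 1 := by
  exact ru z⁻¹
theorem qp_sw {a c : ℂ} (h : a * c = 1) (h1 : a ^ 6 = 1) (h2 : c ^ 6 = 1) (x y : ℂ) :
    qp (a * x, c * y) = qp (x, y) ∧ qp (a * y, c * x) = qp (x, y) := by
  simp only [qp, f, Prod.mk.injEq, mul_pow, h1, h2]
  refine ⟨⟨?_, ?_⟩, ?_, ?_⟩
  · linear_combination x * y * h
  · linear_combination 6 * x * y * h
  · linear_combination x * y * h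
  · linear_combination 6 * x * y * h
theorem qp_act (d p) : qp (act d p) = qp p := by
  obtain ⟨z, b⟩ := d
  have := qp_sw (a := ((z : ℂˣ) : ℂ)) (c := (((z : ℂˣ)⁻¹ : ℂˣ) : ℂ)) (by simp) (ru z) (ru' z) p.1 p.2
  cases b
  · exact this.2
  · exact this.1
@[fun_prop] theorem cont_act (d) : Continuous (act d) := by
  unfold act; split_ifs <;> fun_prop
theorem act_inj {p : ℂ × ℂ} (h : p.1 ^ 6 ≠ p.2 ^ 6) : Function.Injective (fun d => act d p) := by
  rintro ⟨z, b⟩ ⟨w, c⟩ e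
  have inv : ∀ {z w : rootsOfUnity 6 ℂ} {x : ℂ}, x ≠ 0 → ((z : ℂˣ):ℂ) * x = (w : ℂˣ) * x → z = w := by
    intro z w x hx h
    exact Subtype.ext (Units.ext (mul_right_cancel₀ hx h))
  have inv' : ∀ {z w : rootsOfUnity 6 ℂ} {x : ℂ}, x ≠ 0 →
      (((z : ℂˣ)⁻¹ : ℂˣ):ℂ) * x = ((w : ℂˣ)⁻¹ : ℂˣ) * x → z = w := by
    intro z w x hx h
    exact Subtype.ext (inv_injective (Units.ext (mul_right_cancel₀ hx h)))
  have hne : p.1 ≠ 0 ∨ p.2 ≠ 0 := by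
    by_contra! hc; exact h (by rw [hc.1, hc.2])
  cases b <;> cases c <;> simp only [act, Bool.false_eq_true, if_true, if_false, Prod.mk.injEq] at e
  · rcases hne with h0 | h0
    · rw [inv' h0 e.2]
    · rw [inv h0 e.1]
  · have := congrArg (· ^ 6) e.1
    simp only [mul_pow, ru, one_mul] at this
    exact absurd this.symm h
  · have := congrArg (· ^ 6) e.1
    simp only [mul_pow, ru, one_mul] at this
    exact absurd this h
  · rcases hne with h0 | h0
    · rw [inv h0 e.1]
    · rw [inv' h0 e.2]
theorem ru_ex {x y : ℂ} (hx : x ≠ 0) (h : y ^ 6 = x ^ 6) : ∃ z : rootsOfUnity 6 ℂ, y = (z : ℂˣ) * x := by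
  have hy : y ≠ 0 := by
    rintro rfl; exact hx (by simpa using h.symm)
  refine ⟨⟨Units.mk0 (y / x) (div_ne_zero hy hx), ?_⟩, by simp [hx]⟩
  rw [_root_.mem_rootsOfUnity]
  ext
  simp [div_pow, h, hx]
theorem act_surj {p p' : ℂ × ℂ} (h : p.1 ^ 6 ≠ p.2 ^ 6) (he : qp p' = qp p) :
    ∃ d, act d p = p' := by
  obtain ⟨x, y⟩ := p
  obtain ⟨x', y'⟩ := p'
  simp only [qp, f, Prod.mk.injEq] at he h
  obtain ⟨e1, e2⟩ := he
  have e3 : (x' ^ 6 - x ^ 6) * (x' ^ 6 - y ^ 6) = 0 := by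
    have h6 : x' ^ 6 * y' ^ 6 = x ^ 6 * y ^ 6 := by rw [← mul_pow, e1, mul_pow]
    linear_combination x' ^ 6 * e2 - 6 * x' ^ 6 * e1 - h6
  have main : ∀ {x y : ℂ}, x ^ 6 ≠ y ^ 6 → x' * y' = x * y → x' ^ 6 = x ^ 6 → y' ^ 6 = y ^ 6 →
      ∃ z : rootsOfUnity 6 ℂ, (((z : ℂˣ) : ℂ) * x, (((z : ℂˣ)⁻¹ : ℂˣ) : ℂ) * y) = (x', y') := by
    intro x y h e1 e4 e5
    by_cases hx : x = 0
    · have hy : y ≠ 0 := by rintro rfl; exact h (by rw [hx])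
      obtain ⟨z, hz⟩ := ru_ex hy e5
      refine ⟨z⁻¹, ?_⟩
      rw [hx] at e4 ⊢
      have : x' = 0 := by simpa using e4
      simp [this, hz]
    · obtain ⟨z, hz⟩ := ru_ex hx e4
      refine ⟨z, ?_⟩
      have hx' : x' ≠ 0 := by rw [hz]; simp [hx]
      ext
      · exact hz.symm
      · refine mul_left_cancel₀ hx' ?_
        rw [e1]; simp only []
        rw [hz]
        have : ((z : ℂˣ) : ℂ) * (((z : ℂˣ)⁻¹ : ℂˣ) : ℂ) = 1 := by simp
        linear_combination x * y * this
  rcases mul_eq_zero.1 e3 with e | e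
  · obtain ⟨z, hz⟩ := main h e1 (sub_eq_zero.1 e) (by linear_combination e2 - 6 * e1 - e)
    exact ⟨(z, true), hz⟩
  · obtain ⟨z, hz⟩ := main (Ne.symm h) (by rw [e1, mul_comm]) (sub_eq_zero.1 e)
      (by linear_combination e2 - 6 * e1 - e)
    exact ⟨(z, false), hz⟩
theorem qp_surj {a : ℂ × ℂ} (ha : a ∈ Ms) : ∃ p, qp p = a := by
  obtain ⟨u, t⟩ := a
  obtain ⟨d, hd⟩ := IsAlgClosed.exists_pow_nat_eq ((t - 6 * u) ^ 2 - 4 * u ^ 6) (n := 2) (by norm_num)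
  have key : ∀ d : ℂ, d ^ 2 = (t - 6 * u) ^ 2 - 4 * u ^ 6 → t - 6 * u + d ≠ 0 → ∃ p, qp p = (u, t) := by
    intro d hd h0
    obtain ⟨x, hx⟩ := IsAlgClosed.exists_pow_nat_eq ((t - 6 * u + d) / 2) (n := 6) (by norm_num)
    have hx0 : x ≠ 0 := by
      rintro rfl; apply h0
      have : (t - 6 * u + d) / 2 = 0 := by rw [← hx]; simp
      linear_combination 2 * this
    refine ⟨(x, u / x), ?_⟩
    have h6 : u ^ 6 = x ^ 6 * ((t - 6 * u - d) / 2) := by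
      rw [hx]; linear_combination hd / 4
    simp only [qp, f, Prod.mk.injEq]
    refine ⟨by field_simp, ?_⟩
    rw [div_pow, h6, mul_div_cancel_left₀ _ (pow_ne_zero 6 hx0), hx]
    field_simp
    ring
  by_cases h : t - 6 * u + d = 0
  · refine key (-d) (by rw [neg_sq, hd]) fun h' => ?_
    have e1 : t - 6 * u = 0 := by linear_combination (h + h') / 2
    have e2 : d = 0 := by linear_combination (h - h') / 2
    rw [e1, e2] at hd
    have e3 : u = 0 := by
      have : u ^ 6 = 0 := by linear_combination hd / 4
      simpa using this
    refine ha.1.1 ?_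
    simpa [e3] using e1
  · exact key d hd h

theorem qp_closed : IsClosedMap qp := by
  refine IsProperMap.isClosedMap ?_
  rw [isProperMap_iff_isCompact_preimage]
  refine ⟨cont_qp, fun {K} hK => ?_⟩
  refine Metric.isCompact_of_isClosed_isBounded (hK.isClosed.preimage cont_qp) ?_
  obtain ⟨R, hR⟩ := hK.isBounded.subset_closedBall 0
  have hR' : ∀ p ∈ qp ⁻¹' K, ‖p.1 * p.2‖ ≤ R ∧ ‖f p‖ ≤ R := fun p hp => by
    have := hR hp
    rw [mem_closedBall_zero_iff, Prod.norm_def] at this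
    exact ⟨(le_max_left _ _).trans this, (le_max_right _ _).trans this⟩
  have main : ∀ x y : ℂ, ‖x * y‖ ≤ R → ‖x ^ 6 + y ^ 6 + 6 * (x * y)‖ ≤ R →
      ‖x‖ ≤ 7 * R + R ^ 6 + 1 := by
    intro x y h1 h2
    have hR0 : 0 ≤ R := (norm_nonneg _).trans h1
    by_contra! hc
    have h60 : 0 ≤ R ^ 6 := by positivity
    have h3 : ‖x‖ ≤ ‖x ^ 6‖ := by
      rw [norm_pow]; exact le_self_pow₀ (by linarith) (by norm_num)
    have h4 : ‖x ^ 6‖ ≤ ‖x ^ 6 + y ^ 6 + 6 * (x * y)‖ + ‖y ^ 6‖ + 6 * ‖x * y‖ := by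
      have e : x ^ 6 = (x ^ 6 + y ^ 6 + 6 * (x * y)) - y ^ 6 - 6 * (x * y) := by ring
      have e6 : 6 * ‖x * y‖ = ‖6 * (x * y)‖ := by rw [norm_mul]; simp
      rw [e6]
      conv_lhs => rw [e]
      exact (norm_sub_le _ _).trans (add_le_add_left (norm_sub_le _ _) _)
    have h5 : ‖x ^ 6‖ * ‖y ^ 6‖ ≤ R ^ 6 := by
      rw [← norm_mul, ← mul_pow, norm_pow]; exact pow_le_pow_left₀ (norm_nonneg _) h1 6
    nlinarith
  refine (Metric.isBounded_closedBall (x := (0 : ℂ × ℂ)) (r := 7 * R + R ^ 6 + 1)).subset ?_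
  intro p hp
  obtain ⟨h1, h2⟩ := hR' p hp
  rw [mem_closedBall_zero_iff, Prod.norm_def]
  refine max_le (main p.1 p.2 h1 ?_) (main p.2 p.1 (by rwa [mul_comm]) ?_)
  · convert h2 using 2; unfold f; ring
  · convert h2 using 2; unfold f; ring

theorem qp_lh : IsLocalHomeomorphOn qp (qp ⁻¹' Ms) := by
  intro p hp
  have hd := (qp_iff.1 hp).2
  obtain ⟨x, y⟩ := p
  simp only at hd
  have hdet : y * (6 * y ^ 5 + 6 * x) - x * (6 * x ^ 5 + 6 * y) ≠ 0 := by
    intro h; apply hd; linear_combination -h / 6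
  let L1 : ℂ × ℂ →L[ℂ] ℂ := ContinuousLinearMap.fst ℂ ℂ ℂ
  let L2 : ℂ × ℂ →L[ℂ] ℂ := ContinuousLinearMap.snd ℂ ℂ ℂ
  let A : ℂ × ℂ →L[ℂ] ℂ × ℂ := (y • L1 + x • L2).prod
    ((6 * x ^ 5 + 6 * y) • L1 + (6 * y ^ 5 + 6 * x) • L2)
  let dd := (y * (6 * y ^ 5 + 6 * x) - x * (6 * x ^ 5 + 6 * y))⁻¹
  let B : ℂ × ℂ →L[ℂ] ℂ × ℂ := ((dd * (6 * y ^ 5 + 6 * x)) • L1 - (dd * x) • L2).prod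
    ((dd * y) • L2 - (dd * (6 * x ^ 5 + 6 * y)) • L1)
  have hdd : dd * (y * (6 * y ^ 5 + 6 * x) - x * (6 * x ^ 5 + 6 * y)) = 1 := inv_mul_cancel₀ hdet
  let A' : (ℂ × ℂ) ≃L[ℂ] ℂ × ℂ := ContinuousLinearEquiv.equivOfInverse A B
    (by
      rintro ⟨a, b⟩
      simp only [A, B, L1, L2, ContinuousLinearMap.prod_apply, ContinuousLinearMap.add_apply,
        ContinuousLinearMap.sub_apply, ContinuousLinearMap.smul_apply, smul_eq_mul,
        ContinuousLinearMap.coe_fst', ContinuousLinearMap.coe_snd']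
      ext
      · simp only []; linear_combination a * hdd
      · simp only []; linear_combination b * hdd)
    (by
      rintro ⟨a, b⟩
      simp only [A, B, L1, L2, ContinuousLinearMap.prod_apply, ContinuousLinearMap.add_apply,
        ContinuousLinearMap.sub_apply, ContinuousLinearMap.smul_apply, smul_eq_mul,
        ContinuousLinearMap.coe_fst', ContinuousLinearMap.coe_snd']
      ext
      · simp only []; linear_combination a * hdd
      · simp only []; linear_combination b * hdd)
  have h1 : HasStrictFDerivAt (fun p : ℂ × ℂ => p.1) L1 (x, y) := hasStrictFDerivAt_fst
  have h2 : HasStrictFDerivAt (fun p : ℂ × ℂ => p.2) L2 (x, y) := hasStrictFDerivAt_snd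
  have hA : HasStrictFDerivAt qp (A' : ℂ × ℂ →L[ℂ] ℂ × ℂ) (x, y) := by
    have e := (h1.mul h2).prodMk (((h1.pow 6).add (h2.pow 6)).add ((h1.const_mul 6).mul h2))
    refine e.congr_fderiv ?_
    ext <;> simp [A', A, L1, L2] <;> ring
  exact ⟨hA.toOpenPartialHomeomorph qp, hA.mem_toOpenPartialHomeomorph_source, rfl⟩

abbrev Dk := rootsOfUnity 6 ℂ × Bool
theorem fib (a : ℂ × ℂ) (ha : a ∈ Ms) : Nonempty (Dk ≃ qp ⁻¹' {a}) := by
  obtain ⟨p, hp⟩ := qp_surj ha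
  have h := (qp_iff.1 (hp ▸ ha)).2
  refine ⟨Equiv.ofBijective (fun d => ⟨act d p, by simp [qp_act, hp]⟩) ⟨fun d d' e => ?_, ?_⟩⟩
  · exact act_inj h (congrArg Subtype.val e)
  · rintro ⟨p', hp'⟩
    obtain ⟨d, hd⟩ := act_surj h (p' := p') (by rw [hp']; exact hp.symm)
    exact ⟨d, Subtype.ext hd⟩

open Classical in
noncomputable def Cq : Cov qp Ms Dk where
  cov := qp_closed.isCoveringMapOn_of_isLocalHomeomorphOn (fun a ha => by
    obtain ⟨e⟩ := fib a ha
    exact @Set.toFinite _ _ (Finite.of_equiv _ e)) qp_lh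
  T a d := if h : a ∈ Ms then ((fib a h).some d).1 else 0
  T' z := if h : qp z ∈ Ms then (fib _ h).some.symm ⟨z, rfl⟩ else (1, true)
  qT a ha d := by rw [dif_pos ha]; exact ((fib a ha).some d).2
  TT' z hz := by rw [dif_pos hz, dif_pos hz]; simp
  T'T a ha d := by
    rw [dif_pos ha]
    have h := ((fib a ha).some d).2
    generalize e : (fib a ha).some d = z at h ⊢
    obtain ⟨z, hz⟩ := z
    obtain rfl : qp z = a := hz
    simp only []
    rw [dif_pos ha, Equiv.symm_apply_eq]; exact e.symm

open Cov (ok i0 i1)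

section
variable [PathConnectedSpace UU] (x0 : UU) (K : Hol ℂ Ys (Equiv.Perm (F3 × Unit)))
abbrev Ga (x0 : UU) := FundamentalGroup UU x0
theorem qU : qp ⁻¹' Ms ⊆ UU := fun _ hp => (qp_iff.1 hp).1
noncomputable def KU : Hol (ℂ × ℂ) UU (Equiv.Perm (F3 × Unit)) :=
  K.comap f UU cont_f.continuousOn (fun _ h => mem_UU.1 h)
noncomputable def HZ : Hol (ℂ × ℂ) (qp ⁻¹' Ms) (Ga x0) :=
  (hUo x0).comap id _ continuousOn_id qU
noncomputable def HH : Hol (ℂ × ℂ) Ms (Equiv.Perm (Dk × Ga x0) × Equiv.Perm (F3 × Unit)) :=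
  (Cq.hol (HZ x0)).prod (K.comap Prod.snd Ms continuousOn_snd (fun _ h => h.1))
abbrev GG (x0 : UU) := Equiv.Perm (Dk × Ga x0) × Equiv.Perm (F3 × Unit)

def Tr (c : GG x0) (v v' : ℂ × ℂ) (e : Ga x0) : Prop :=
  (∀ x, c.1 (Cq.T' v, x) = (Cq.T' v', e * x)) ∧
    c.2 = (KU K).nn x0 v' * (KU K).phi x0 e * ((KU K).nn x0 v)⁻¹

variable {x0 K}
theorem Tr.mul {c c' : GG x0} {v v' v'' : ℂ × ℂ} {e e' : Ga x0} (h : Tr x0 K c v v' e)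
    (h' : Tr x0 K c' v' v'' e') : Tr x0 K (c' * c) v v'' (e' * e) := by
  refine ⟨fun x => ?_, ?_⟩
  · rw [Prod.fst_mul, Equiv.Perm.mul_apply, h.1, h'.1, mul_assoc]
  · rw [Prod.snd_mul, h.2, h'.2, map_mul]; group
theorem Tr.inv {c : GG x0} {v v' : ℂ × ℂ} {e : Ga x0} (h : Tr x0 K c v v' e) :
    Tr x0 K c⁻¹ v' v e⁻¹ := by
  refine ⟨fun x => ?_, ?_⟩
  · rw [Prod.fst_inv, Equiv.Perm.inv_eq_iff_eq, h.1, mul_inv_cancel_left]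
  · rw [Prod.snd_inv, h.2, map_inv]; group
theorem Tr.path {γ : ℝ → ℂ × ℂ} {γ' : ℝ → ℂ × ℂ} (hc : ContinuousOn γ' (Icc 0 1))
    (hq : ∀ r ∈ Icc (0:ℝ) 1, qp (γ' r) = γ r) (hm : ∀ r ∈ Icc (0:ℝ) 1, γ r ∈ Ms) :
    Tr x0 K ((HH x0 K).h γ) (γ' 0) (γ' 1) ((hUo x0).h γ') := by
  have hok : ok UU γ' := ⟨hc, fun r hr => qU (by rw [mem_preimage, hq r hr]; exact hm r hr)⟩
  refine ⟨fun x => Cq.hol_app (HZ x0) hc hq hm x, ?_⟩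
  rw [(KU K).phi_hU x0 hok]
  have : ((HH x0 K).h γ).2 = (KU K).h γ' := K.congr' _ _ fun r hr => by
    rw [← hq r hr]; rfl
  rw [this]; group

variable (x0 K) in
def TP (c : GG x0) (v v' : ℂ × ℂ) : Prop := ∀ d, ∃ e, Tr x0 K c (act d v) (act d v') e
theorem TP.mul {c c' : GG x0} {v v' v'' : ℂ × ℂ} (h : TP x0 K c v v')
    (h' : TP x0 K c' v' v'') : TP x0 K (c' * c) v v'' := fun d => by
  obtain ⟨e, he⟩ := h d
  obtain ⟨e', he'⟩ := h' d
  exact ⟨_, he.mul he'⟩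
theorem TP.inv {c : GG x0} {v v' : ℂ × ℂ} (h : TP x0 K c v v') : TP x0 K c⁻¹ v' v := fun d => by
  obtain ⟨e, he⟩ := h d
  exact ⟨_, he.inv⟩
theorem TP.path {γ : ℝ → ℂ × ℂ} {γ' : ℝ → ℂ × ℂ} (hc : ContinuousOn γ' (Icc 0 1))
    (hq : ∀ r ∈ Icc (0:ℝ) 1, qp (γ' r) = γ r) (hm : ∀ r ∈ Icc (0:ℝ) 1, γ r ∈ Ms) :
    TP x0 K ((HH x0 K).h γ) (γ' 0) (γ' 1) := fun d =>
  ⟨_, Tr.path (γ' := fun r => act d (γ' r)) ((cont_act d).comp_continuousOn hc)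
    (fun r hr => by rw [qp_act]; exact hq r hr) hm⟩
theorem act_act (d d' : Dk) : ∃ d'', ∀ p, act d (act d' p) = act d'' p := by
  obtain ⟨z, b⟩ := d
  obtain ⟨w, c⟩ := d'
  cases b
  · refine ⟨(z * w⁻¹, !c), fun p => ?_⟩
    cases c <;> simp [act, mul_assoc, mul_comm, mul_left_comm]
  · refine ⟨(z * w, c), fun p => ?_⟩
    cases c <;> simp [act, mul_assoc, mul_comm, mul_left_comm]
theorem TP.act {c : GG x0} {v v' : ℂ × ℂ} (h : TP x0 K c v v') (d : Dk) :
    TP x0 K c (act d v) (act d v') := fun d' => by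
  obtain ⟨d'', hd⟩ := act_act d' d
  rw [hd, hd]; exact h d''
theorem TP.Tr {c : GG x0} {v v' : ℂ × ℂ} (h : TP x0 K c v v') : ∃ e, Tr x0 K c v v' e := by
  have := h (1, true)
  simpa [_root_.act] using this
theorem TP.sw {c : GG x0} {x y x' y' : ℂ} (h : TP x0 K c (x, y) (x', y')) :
    TP x0 K c (y, x) (y', x') := by
  have := h.act (1, false)
  simpa [_root_.act] using this

theorem T'_ex {v : ℂ × ℂ} (hv : qp v ∈ Ms) (d : Dk) : ∃ d', d = Cq.T' (act d' v) := by
  obtain ⟨d', hd'⟩ := act_surj (qp_iff.1 hv).2 (p' := Cq.T (qp v) d) (Cq.qT _ hv _)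
  exact ⟨d', by rw [hd', Cq.T'T _ hv]⟩
theorem one_of {c : GG x0} {v : ℂ × ℂ} (hv : qp v ∈ Ms)
    (h : ∀ d, Tr x0 K c (act d v) (act d v) 1) : c = 1 := by
  refine Prod.ext (Equiv.ext fun p => ?_) ?_
  · obtain ⟨d, x⟩ := p
    obtain ⟨d', rfl⟩ := T'_ex hv d
    rw [(h d').1, one_mul]; rfl
  · rw [(h (1, true)).2, map_one, mul_one, mul_inv_cancel]; rfl
end

open Cov (ok i0 i1)

noncomputable def Qw (w : ℂ) : ℂ := ((1 - w ^ 2) ^ 2 + (1 - w ^ 2) + 4) * ((1 - w ^ 2) ^ 3 - 3 * (1 - w ^ 2) + 4)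
noncomputable def Pw (w : ℂ) : ℂ := 1 + 3 * w ^ 2 + w * (Qw w) ^ (((2:ℕ):ℂ)⁻¹)
noncomputable def gw (w : ℂ) : ℂ := (Pw w) ^ (((6:ℕ):ℂ)⁻¹)
noncomputable def Eh (β ν w : ℂ) : ℂ × ℂ := (ν * gw w, β * (1 - w ^ 2) / (ν * gw w))
def Ow : Set ℂ := {w | Qw w ∈ slitPlane ∧ Pw w ∈ slitPlane}

theorem gw6 (w) : gw w ^ 6 = Pw w := Complex.cpow_nat_inv_pow _ (by norm_num)
theorem Pw_mul (w) : Pw w * Pw (-w) = (1 - w ^ 2) ^ 6 := by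
  have e : Qw (-w) = Qw w := by simp [Qw]
  have h : ((Qw w) ^ (((2:ℕ):ℂ)⁻¹)) ^ 2 = Qw w := Complex.cpow_nat_inv_pow _ (by norm_num)
  unfold Pw; rw [e]
  generalize (Qw w) ^ (((2:ℕ):ℂ)⁻¹) = q at *
  unfold Qw at h
  linear_combination -w ^ 2 * h
theorem Pw_cont {w} (h : Qw w ∈ slitPlane) : ContinuousAt Pw w := by
  have : ContinuousAt (fun w => (Qw w) ^ (((2:ℕ):ℂ)⁻¹)) w :=
    ContinuousAt.cpow (by unfold Qw; fun_prop) continuousAt_const h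
  unfold Pw; fun_prop
theorem gw_cont {w} (h : w ∈ Ow) : ContinuousAt gw w :=
  ContinuousAt.cpow (Pw_cont h.1) continuousAt_const h.2
theorem gw_ne {w} (h : w ∈ Ow) : gw w ≠ 0 := fun h0 => by
  have := gw6 w
  rw [h0] at this
  exact slitPlane_ne_zero h.2 (by rw [← this]; norm_num)
theorem Eh_cont {β ν w} (hν : ν ≠ 0) (h : w ∈ Ow) : ContinuousAt (Eh β ν) w := by
  have := gw_cont h
  have h2 := gw_ne h
  unfold Eh
  refine ContinuousAt.prodMk (by fun_prop) (ContinuousAt.div (by fun_prop) (by fun_prop) ?_)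
  exact mul_ne_zero hν h2
theorem Pw_real {x : ℝ} (h : -1 < x) (h1 : x ≤ 1) : (x:ℂ) ∈ Ow ∧ ∃ m : ℝ, 0 < m ∧ gw x = m := by
  set s := 1 - x ^ 2 with hs
  have s0 : 0 ≤ s := by nlinarith
  have s1 : s ≤ 1 := by nlinarith
  have q0 : 0 < (s ^ 2 + s + 4) * (s ^ 3 - 3 * s + 4) :=
    mul_pos (by positivity) (by nlinarith [pow_nonneg s0 3])
  have hQ : Qw x = (((s ^ 2 + s + 4) * (s ^ 3 - 3 * s + 4) : ℝ) : ℂ) := by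
    rw [hs]; simp [Qw]
  have sl : ∀ {y : ℝ}, 0 < y → (y:ℂ) ∈ slitPlane := fun h => Or.inl (by simpa using h)
  have hP : ∃ p : ℝ, Pw x = p ∧ 0 < p := by
    set q := ((s ^ 2 + s + 4) * (s ^ 3 - 3 * s + 4)) ^ (((2:ℕ):ℝ)⁻¹) with hq
    have q1 : q ^ 2 = (s ^ 2 + s + 4) * (s ^ 3 - 3 * s + 4) :=
      Real.rpow_inv_natCast_pow q0.le (by norm_num)
    have q2 : 0 < q := Real.rpow_pos_of_pos q0 _
    refine ⟨1 + 3 * x ^ 2 + x * q, ?_, ?_⟩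
    · rw [hq]; push_cast [Complex.ofReal_cpow q0.le, Pw, hQ]; simp
    · rcases le_or_gt 0 x with hx | hx
      · positivity
      · have s2 : 0 < s := by nlinarith
        have e : (1 + 3 * x ^ 2 + x * q) * (1 + 3 * x ^ 2 - x * q) = s ^ 6 := by
          rw [hs] at q1 ⊢; linear_combination -x ^ 2 * q1
        have : 0 < 1 + 3 * x ^ 2 - x * q := by nlinarith
        exact (pos_iff_pos_of_mul_pos (by rw [e]; positivity)).2 this
  obtain ⟨p, hp, p0⟩ := hP
  refine ⟨⟨by rw [hQ]; exact sl q0, by rw [hp]; exact sl p0⟩, p ^ (((6:ℕ):ℝ)⁻¹),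
    Real.rpow_pos_of_pos p0 _, ?_⟩
  rw [gw, hp, Complex.ofReal_cpow p0.le]; simp
theorem gw_mul {x : ℝ} (h : -1 < x) (h1 : x < 1) : gw x * gw (-x) = 1 - x ^ 2 := by
  obtain ⟨-, m, m0, hm⟩ := Pw_real h h1.le
  obtain ⟨-, n, n0, hn⟩ := Pw_real (x := -x) (by linarith) (by linarith)
  rw [ofReal_neg] at hn
  have e := Pw_mul x
  rw [← gw6, ← gw6, hm, hn] at e
  have : (m * n) ^ 6 = (1 - x ^ 2) ^ 6 := by
    rw [mul_pow]; exact_mod_cast e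
  have := (pow_left_inj₀ (by positivity) (by nlinarith) (by norm_num)).1 this
  rw [hm, hn]; exact_mod_cast this
theorem gw_one : gw 1 ^ 2 = 2 := by
  obtain ⟨-, m, m0, hm⟩ := Pw_real (x := 1) (by norm_num) le_rfl
  have e := gw6 1
  have : Pw 1 = 8 := by
    have h : Qw 1 = ((4:ℝ):ℂ) ^ 2 := by norm_num [Qw]
    have : (Qw 1) ^ (((2:ℕ):ℂ)⁻¹) = 4 := by
      have ha : arg ((4:ℝ):ℂ) = 0 := Complex.arg_ofReal_of_nonneg (by norm_num)
      rw [h, Complex.pow_cpow_nat_inv (by norm_num) (by rw [ha]; simp [Real.pi_pos])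
        (by rw [ha]; positivity)]
      norm_num
    rw [Pw, this]; norm_num
  rw [ofReal_one] at hm
  rw [this, hm] at e
  have e' : (m ^ 2) ^ 3 = (2:ℝ) ^ 3 := by
    have : m ^ 6 = 8 := by exact_mod_cast e
    rw [← pow_mul, this]; norm_num
  have := (pow_left_inj₀ (by positivity) (by norm_num) (by norm_num)).1 e'
  rw [hm]; exact_mod_cast this
theorem Ow_ball : ∃ r > 0, Metric.ball 0 r ⊆ Ow := by
  have h0 := (Pw_real (x := 0) (by norm_num) (by norm_num)).1
  rw [ofReal_zero] at h0
  refine Metric.mem_nhds_iff.1 ?_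
  have hQ : ContinuousAt Qw 0 := by unfold Qw; fun_prop
  exact (hQ.eventually (isOpen_slitPlane.mem_nhds h0.1)).and
    ((Pw_cont h0.1).eventually (isOpen_slitPlane.mem_nhds h0.2))
theorem qp_Eh {ε β ν w : ℂ} (hε : ε = 1 ∨ ε = -1) (hβ : ε * β ^ 2 = -1) (hν : ν ^ 6 = β) (hw : w ∈ Ow) :
    qp (Eh β ν w) = Ew ε (w, β) := by
  have b4 : β ^ 4 = 1 := by
    have : ε ^ 2 = 1 := by rcases hε with rfl | rfl <;> norm_num
    linear_combination (ε * β ^ 2 - 1) * hβ - β ^ 4 * this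
  have b0 : β ≠ 0 := by rintro rfl; norm_num at b4
  have n0 : ν ≠ 0 := by rintro rfl; norm_num at hν; exact b0 hν.symm
  have g0 := gw_ne hw
  have e := Pw_mul w
  have g6 := gw6 w
  have e2 : Pw w + Pw (-w) = 2 + 6 * w ^ 2 := by
    have e : Qw (-w) = Qw w := by simp [Qw]
    unfold Pw; rw [e]; ring
  have xy : ν * gw w * (β * (1 - w ^ 2) / (ν * gw w)) = β * (1 - w ^ 2) := by field_simp
  have y6 : (β * (1 - w ^ 2) / (ν * gw w)) ^ 6 = β * Pw (-w) := by
    have : Pw w ≠ 0 := by rw [← g6]; exact pow_ne_zero _ g0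
    rw [div_pow, mul_pow, mul_pow, hν, g6, ← e, div_eq_iff (mul_ne_zero b0 this)]
    linear_combination β ^ 2 * Pw w * Pw (-w) * b4
  simp only [qp, f, Eh, Ew, Ph, bb, Prod.mk.injEq]
  refine ⟨xy, ?_⟩
  rw [y6, mul_assoc 6, xy, mul_pow, hν, g6]
  linear_combination β * e2 + 2 * β * hβ

section
variable [PathConnectedSpace UU] {x0 : UU} {K : Hol ℂ Ys (Equiv.Perm (F3 × Unit))}
theorem Lam_main {ε β z : ℂ} (hε : ε = 1 ∨ ε = -1) (hβ : ε * β ^ 2 = -1) (hz : z ^ 6 = 8 * β)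
    (ha : adm ε β) : (HH x0 K).Lam ε β * (HH x0 K).Lam ε β = 1 ∧
      TP x0 K ((HH x0 K).Lam ε β) (z, 0) (0, 2 * β / z) := by
  have b0 : β ≠ 0 := by rintro rfl; norm_num at hβ
  have z0 : z ≠ 0 := by rintro rfl; norm_num at hz; exact b0 hz
  have g1 := gw_ne (Pw_real (x := 1) (by norm_num) le_rfl).1
  rw [ofReal_one] at g1
  obtain ⟨ν, hν'⟩ : ∃ ν, ν = z / gw 1 := ⟨_, rfl⟩
  have hz' : z = ν * gw 1 := by rw [hν']; field_simp
  have g8 : gw 1 ^ 6 = 8 := by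
    linear_combination (gw 1 ^ 4 + 2 * gw 1 ^ 2 + 4) * gw_one
  have hν : ν ^ 6 = β := by rw [hν', div_pow, hz, g8]; ring
  have n0 : ν ≠ 0 := by rintro rfl; norm_num at hν; exact b0 hν.symm
  obtain ⟨δ, δ0, hg⟩ := ha.good
  have hg := hg β (Metric.mem_ball_self δ0)
  obtain ⟨r, r0, hr⟩ := Ow_ball
  obtain ⟨a, a0, a1, ar⟩ : ∃ a : ℝ, 0 < a ∧ a < 1 ∧ a < r :=
    ⟨min 1 r / 2, by positivity, by linarith [min_le_left 1 r], by linarith [min_le_right 1 r, lt_min one_pos r0]⟩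
  obtain ⟨η, η0, ηδ, ηr⟩ : ∃ a : ℝ, 0 < a ∧ a ≤ δ ∧ a < r :=
    ⟨min δ r / 2, by positivity, by linarith [min_le_left δ r, lt_min δ0 r0], by linarith [min_le_right δ r, lt_min δ0 r0]⟩
  set H := HH x0 K
  set E : ℂ → ℂ × ℂ := fun w => Ew ε (w, β) with hE
  have hga : good ε β a δ := ⟨hg.1, fun w h1 h2 => hg.2 w (h1.trans a1.le) h2⟩
  have ev : ∀ w, E (-w) = E w := fun w => by simp [hE, Ew]
  have cE : Continuous E := by rw [hE]; fun_prop
  -- conjugation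
  have hL : H.Lam ε β = (H.hs E 1 a)⁻¹ * H.Leta ε β a η * H.hs E 1 a := by
    have real_in : ∀ x : ℝ, 0 < |x| → |x| ≤ 1 → (x:ℂ) ∈ upR 1 δ := fun x h1 h2 =>
      ⟨by simpa using h2, by simp, by simpa using δ0.le, by simpa using h1⟩
    rw [H.Lam_eq hε hg η0 ηδ, H.Leta_star hε one_pos hg η0 ηδ η η0 ηδ,
      H.Leta_star hε a0 hga η0 ηδ η η0 ηδ]
    have st := star_upR (a := 1) η0 ηδ
    have e1 := H.star_seg st cE.continuousOn (Hol.sect hε hg) (a := 1) (b := a) (fun r hr => by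
      have := real_in (1 + r * (a - 1)) (abs_pos.2 (by nlinarith [hr.1, hr.2]))
        (abs_le.2 ⟨by nlinarith [hr.1, hr.2], by nlinarith [hr.1, hr.2]⟩)
      simpa using this)
    have e2 := H.star_seg st cE.continuousOn (Hol.sect hε hg) (a := -1) (b := -a) (fun r hr => by
      have := real_in (-(1 + r * (a - 1))) (abs_pos.2 (by nlinarith [hr.1, hr.2]))
        (abs_le.2 ⟨by nlinarith [hr.1, hr.2], by nlinarith [hr.1, hr.2]⟩)
      convert this using 1
      simp; ring)
    have e3 : H.hs E (-1) (-a) = H.hs E 1 a := H.hs_congr fun r hr => by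
      rw [← ev]; congr 1; module
    rw [e3] at e2
    change H.hs E _ (-((1:ℝ):ℂ)) * (H.hs E _ ((1:ℝ):ℂ))⁻¹ =
      _ * (H.hs E _ (-(a:ℂ)) * (H.hs E _ (a:ℂ))⁻¹) * _
    rw [← e1, ← e2, ofReal_one]; group
  have seg : ∀ (σ : ℝ) (u v : ℂ), (σ = 1 ∨ σ = -1) → ‖u‖ < r → ‖v‖ < r →
      (∀ r ∈ Icc (0:ℝ) 1, E (u + r • (v - u)) ∈ Ms) → ∀ d, Tr x0 K (H.hs E u v) (act d (Eh β ν (σ • u)))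
        (act d (Eh β ν (σ • v))) ((hUo x0).hs (fun w => act d (Eh β ν w)) (σ • u) (σ • v)) := by
    intro σ u v hσ hu hv hm d
    have hb : ∀ t ∈ Icc (0:ℝ) 1, σ • u + t • (σ • v - σ • u) ∈ Metric.ball (0:ℂ) r := fun t ht =>
      (convex_ball (0:ℂ) r).add_smul_sub_mem (by rcases hσ with rfl | rfl <;> simpa) 
        (by rcases hσ with rfl | rfl <;> simpa) ht
    have := Tr.path (x0 := x0) (K := K) (γ' := fun t : ℝ => act d (Eh β ν (σ • u + t • (σ • v - σ • u))))
      (γ := fun t => E (u + t • (v - u))) ?_ ?_ hm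
    · simp only [zero_smul, one_smul, add_zero, add_sub_cancel] at this; exact this
    · refine (cont_act d).comp_continuousOn fun t ht => ?_
      have h1 := Eh_cont (β := β) n0 (hr (hb t ht))
      exact ((ContinuousAt.comp (f := fun t : ℝ => σ • u + t • (σ • v - σ • u)) h1
        (by fun_prop))).continuousWithinAt
    · intro t ht
      rw [qp_act, qp_Eh hε hβ hν (hr (hb t ht))]
      change E _ = E _
      rcases hσ with rfl | rfl
      · simp
      · rw [← ev]; congr 1; module
  have st := star_upR (a := a) η0 ηδ
  have mm := Hol.mem_one a0 δ δ0
  have an : ‖(a:ℂ)‖ < r := by simpa [abs_of_pos a0] using ar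
  have hηn : ‖(⟨0, η⟩ : ℂ)‖ < r := by
    have : (⟨0, η⟩ : ℂ) = η * I := by apply Complex.ext <;> simp
    rw [this]; simpa [abs_of_pos η0] using ηr
  have m1 : ∀ t ∈ Icc (0:ℝ) 1, E (a + t • ((⟨0, η⟩ : ℂ) - a)) ∈ Ms := fun t ht => by
    have := st.add_smul_sub_mem mm.1 (t := 1 - t) (by linarith [ht.2]) (by linarith [ht.1])
    convert Hol.sect hε hga this using 2
    module
  have m2 : ∀ t ∈ Icc (0:ℝ) 1, E ((⟨0, η⟩ : ℂ) + t • (-(a:ℂ) - (⟨0, η⟩ : ℂ))) ∈ Ms := fun t ht =>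
    Hol.sect hε hga (st.add_smul_sub_mem mm.2 ht.1 ht.2)
  have hLe : H.Leta ε β a η = H.hs E ⟨0, η⟩ (-a) * H.hs E a ⟨0, η⟩ := rfl
  generalize (⟨0, η⟩ : ℂ) = ι at *
  have aO : (a:ℂ) ∈ Ow := hr (by simpa using an)
  constructor
  · have : H.Leta ε β a η * H.Leta ε β a η = 1 := by
      refine one_of (K := K) (v := Eh β ν a) ?_ fun d => ?_
      · rw [qp_Eh hε hβ hν aO]; exact Hol.sect hε hga mm.1
      have B : ∀ u : ℂ, ‖u‖ < r → u ∈ Metric.ball (0:ℂ) r := fun u hu => by simpa using hu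
      have hc : ContinuousOn (fun w => act d (Eh β ν w)) (Metric.ball (0:ℂ) r) :=
        (cont_act d).comp_continuousOn fun w hw => (Eh_cont n0 (hr hw)).continuousWithinAt
      have hm : MapsTo (fun w => act d (Eh β ν w)) (Metric.ball (0:ℂ) r) UU := fun w hw => by
        have h2 : f (act d (Eh β ν w)) = (qp (act d (Eh β ν w))).2 := rfl
        rw [mem_UU, h2, qp_act, qp_Eh hε hβ hν (hr hw)]
        exact (hg.2 0 (by simp) (by simpa using δ0.le)).1
      have an' : ‖(-a:ℂ)‖ < r := by simpa using an
      have ιn' : ‖(-ι:ℂ)‖ < r := by simpa using hηn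
      have T := ((seg 1 a ι (Or.inl rfl) an hηn m1 d).mul
        (seg 1 ι (-a) (Or.inl rfl) hηn an' m2 d)).mul
        ((by simpa using seg (-1) a ι (Or.inr rfl) an hηn m1 d : Tr x0 K (H.hs E a ι) (act d (Eh β ν ((1:ℝ) • -(a:ℂ)))) (act d (Eh β ν (-ι))) ((hUo x0).hs (fun w => act d (Eh β ν w)) (-a) (-ι))).mul
        (by simpa using seg (-1) ι (-a) (Or.inr rfl) hηn an' m2 d : Tr x0 K (H.hs E ι (-a)) (act d (Eh β ν (-ι))) (act d (Eh β ν a)) ((hUo x0).hs (fun w => act d (Eh β ν w)) (-ι) a)))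
      simp only [one_smul] at T
      rw [(hUo x0).tri (convex_ball (0:ℂ) r) hc hm (B _ an) (B _ hηn) (B _ an'),
        (hUo x0).tri (convex_ball (0:ℂ) r) hc hm (B _ an') (B _ ιn') (B _ an),
        (hUo x0).tri (convex_ball (0:ℂ) r) hc hm (B _ an) (B _ an') (B _ an),
        (hUo x0).hs_self (F := fun w => act d (Eh β ν w)) (hm (B _ an))] at T
      rw [hLe]; exact T
    rw [hL]
    generalize H.Leta ε β a η = L at *
    generalize H.hs E 1 a = R at *
    calc _ = R⁻¹ * (L * L) * R := by group
      _ = 1 := by rw [this]; group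
  · have tR : TP x0 K (H.hs E 1 a) (Eh β ν 1) (Eh β ν a) := by
      have hx : ∀ t ∈ Icc (0:ℝ) 1, ∃ x : ℝ, 0 < x ∧ x ≤ 1 ∧ (1 + t • ((a:ℂ) - 1)) = x := fun t ht =>
        ⟨1 + t * (a - 1), by nlinarith [ht.1, ht.2], by nlinarith [ht.1, ht.2], by simp⟩
      have := TP.path (x0 := x0) (K := K) (γ' := fun t : ℝ => Eh β ν (1 + t • ((a:ℂ) - 1)))
        (γ := fun t => E (1 + t • ((a:ℂ) - 1))) ?_ ?_ ?_
      · simp only [zero_smul, one_smul, add_zero, add_sub_cancel] at this; exact this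
      · intro t ht
        obtain ⟨x, x0, x1, hx⟩ := hx t ht
        have h1 := Eh_cont (β := β) n0 (Pw_real (x := x) (by linarith) x1).1
        rw [← hx] at h1
        exact ((ContinuousAt.comp (f := fun t : ℝ => 1 + t • ((a:ℂ) - 1)) h1
          (by fun_prop))).continuousWithinAt
      · intro t ht
        obtain ⟨x, x0, x1, hx⟩ := hx t ht
        rw [hx]
        exact qp_Eh hε hβ hν (Pw_real (x := x) (by linarith) x1).1
      · intro t ht
        obtain ⟨x, x0, x1, hx⟩ := hx t ht
        rw [hx]
        exact Hol.sect hε hg ⟨by simpa [abs_of_pos x0] using x1, by simp, by simpa using δ0.le,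
          by simpa using x0.ne'⟩
    have tL : TP x0 K (H.Leta ε β a η) (Eh β ν a) (Eh β ν (-a)) := fun d => by
      have an' : ‖(-a:ℂ)‖ < r := by simpa using an
      have T := (seg 1 a ι (Or.inl rfl) an hηn m1 d).mul
        (seg 1 ι (-a) (Or.inl rfl) hηn an' m2 d)
      simp only [one_smul] at T
      rw [hLe]; exact ⟨_, T⟩
    have hm := gw_mul (x := a) (by linarith) a1
    have s0 : (1 - a ^ 2 : ℂ) ≠ 0 := by
      have : (1 - a ^ 2 : ℝ) ≠ 0 := by nlinarith
      exact_mod_cast this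
    have b4 : β ^ 4 = 1 := by
      have : ε ^ 2 = 1 := by rcases hε with rfl | rfl <;> norm_num
      linear_combination (ε * β ^ 2 - 1) * hβ - β ^ 4 * this
    obtain ⟨ζ, hζ⟩ := ru_ex (x := 1) (y := ν ^ 2 / β) one_ne_zero (by
      rw [div_pow, div_eq_iff (pow_ne_zero _ b0), ← pow_mul, mul_comm 2 6, pow_mul, hν]
      linear_combination -β ^ 2 * b4)
    have hζ' : ((ζ : ℂˣ) : ℂ) = ν ^ 2 / β := by simpa using hζ.symm
    have e1 : act (ζ, false) (Eh β ν a) = Eh β ν (-a) := by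
      have g0 := gw_ne aO
      have gm0 : gw (-a) ≠ 0 := fun h => s0 (by rw [← hm, h, mul_zero])
      simp only [act, Eh, Bool.false_eq_true, if_false, Units.val_inv_eq_inv_val, hζ', neg_sq, ← hm,
        Prod.mk.injEq]
      constructor <;> field_simp
    have e2 : act (ζ, false) (Eh β ν 1) = (0, 2 * β / z) := by
      simp only [act, Eh, Bool.false_eq_true, if_false, Units.val_inv_eq_inv_val, hζ', Prod.mk.injEq]
      refine ⟨by simp, ?_⟩
      rw [hz', ← gw_one]; field_simp
    have e3 : Eh β ν 1 = (z, 0) := by simp [Eh, hz']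
    have T := (tR.mul tL)
    rw [← e1] at T
    have T2 := T.mul (tR.act (ζ, false)).inv
    rw [e2, e3, ← mul_assoc, ← hL] at T2
    exact T2
end

open Cov (ok i0 i1)

noncomputable def rt (x : ℂ) : ℂ := exp (log x / 6)
noncomputable def om6 : ℂ := exp (-(Real.pi / 3 : ℂ) * I)
theorem rt_ne (x) : rt x ≠ 0 := exp_ne_zero _
theorem rt6 {x : ℂ} (hx : x ≠ 0) : rt x ^ 6 = x := by
  rw [rt, ← exp_nat_mul, Nat.cast_ofNat, mul_div_cancel₀ _ (by norm_num), exp_log hx]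
theorem rt_one : rt 1 = 1 := by simp [rt]
theorem rt_cont {x : ℂ} (hx : x ∈ slitPlane) : ContinuousAt rt x := by
  unfold rt; have := continuousAt_clog hx; fun_prop
theorem t3_ne : t3 ≠ 0 := by simp [t3, Complex.ext_iff]
theorem t1_ne : t1 ≠ 0 := by simp [t1, Complex.ext_iff]
theorem sl_of {b c : ℂ} (hb : b ≠ 0) (h : b.re * c.re > 0 ∨ b.im * c.im > 0) : c / b ∈ slitPlane := by
  rw [mem_slitPlane_iff]
  by_contra! hc
  have e : c = c / b * b := by field_simp
  generalize c / b = q at *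
  subst e
  rw [mul_re, mul_im, hc.2] at h
  rcases h with h | h <;> nlinarith [sq_nonneg b.re, sq_nonneg b.im]
theorem D3_sl {c : ℂ} (h : c ∈ D3) : c / t3 ∈ slitPlane :=
  sl_of t3_ne (by simp only [t3]; rcases h with h | h; · left; linarith
                  · right; linarith)
theorem D1_sl {c : ℂ} (h : c ∈ D1) : c / t1 ∈ slitPlane :=
  sl_of t1_ne (by simp only [t1]; rcases h.1 with h | h; · left; linarith
                  · right; linarith)

section
variable [PathConnectedSpace UU] {x0 : UU} {K : Hol ℂ Ys (Equiv.Perm (F3 × Unit))}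
theorem TP_axis {b t z : ℂ} {D : Set ℂ} (hb : b ≠ 0) (hD : StarConvex ℝ b D) (hY : D ⊆ Ys)
    (hs : ∀ c ∈ D, c / b ∈ slitPlane) (ht : t ∈ D) (hz : z ^ 6 = b) :
    TP x0 K ((HH x0 K).Y.hs id b t) (z, 0) (z * rt (t / b), 0) := by
  have hm : ∀ r ∈ Icc (0:ℝ) 1, b + r • (t - b) ∈ D := fun r hr => hD.add_smul_sub_mem ht hr.1 hr.2
  have := TP.path (x0 := x0) (K := K) (γ' := fun r : ℝ => (z * rt ((b + r • (t - b)) / b), (0:ℂ)))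
    (γ := fun r : ℝ => ((0:ℂ), b + r • (t - b))) ?_ ?_ (fun r hr => i_mem (hY (hm r hr)))
  · simp only [zero_smul, one_smul, add_zero, add_sub_cancel, div_self hb, rt_one, mul_one] at this
    exact this
  · refine ContinuousOn.prodMk (continuousOn_const.mul fun r hr => ?_) continuousOn_const
    exact ((ContinuousAt.comp (f := fun r : ℝ => (b + r • (t - b)) / b)
      (rt_cont (hs _ (hm r hr))) (by fun_prop))).continuousWithinAt
  · intro r hr
    have : (b + r • (t - b)) / b ≠ 0 := slitPlane_ne_zero (hs _ (hm r hr))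
    simp only [qp, f, mul_pow, rt6 this, hz, mul_div_cancel₀ _ hb]
    simp
theorem TP_th3 {t z : ℂ} (ht : t ∈ D3) (hz : z ^ 6 = t3) :
    TP x0 K ((HH x0 K).Y.th3 t) (z, 0) (z * rt (t / t3), 0) :=
  TP_axis t3_ne star_D3 D3_sub (fun _ => D3_sl) ht hz
theorem TP_th1 {t z : ℂ} (ht : t ∈ D1) (hz : z ^ 6 = t1) :
    TP x0 K ((HH x0 K).Y.th1 t) (z, 0) (z * rt (t / t1), 0) :=
  TP_axis t1_ne star_D1 D1_sub (fun _ => D1_sl) ht hz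
noncomputable def kpj (j : Fin 4) : ℂ := rt (sW j / t3) / rt (sW j / t1)
theorem sW2 : sW 2 = ⟨-2, 2⟩ := rfl
theorem sW3 : sW 3 = ⟨-8, 8⟩ := rfl
theorem sW_ne (j) : sW j ≠ 0 := (D3_sub (W_sub3 _ (sW_mem j))).1
theorem kap_ne (j) : kpj j ≠ 0 := div_ne_zero (rt_ne _) (rt_ne _)
theorem kap6 (j) : kpj j ^ 6 = t1 / t3 := by
  have := sW_ne j
  have := t3_ne
  have := t1_ne
  rw [kpj, div_pow, rt6 (by simp [*]), rt6 (by simp [*])]; field_simp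
theorem TP_om (j) {z : ℂ} (hz : z ^ 6 = t3) : TP x0 K ((HH x0 K).Y.om j) (z, 0) (z * kpj j, 0) := by
  have h1 := TP_th3 (x0 := x0) (K := K) (W_sub3 _ (sW_mem j)) hz
  have h2 := TP_th1 (x0 := x0) (K := K) (W_sub1 _ (sW_mem j)) (z := z * kpj j) (by
    rw [mul_pow, hz, kap6, mul_div_cancel₀ _ t3_ne])
  have e : z * kpj j * rt (sW j / t1) = z * rt (sW j / t3) := by
    rw [kpj, mul_assoc, div_mul_cancel₀ _ (rt_ne _)]
  rw [e] at h2
  exact h1.mul h2.inv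
theorem TP_omom (i j) {z : ℂ} (hz : z ^ 6 = t3) :
    TP x0 K (((HH x0 K).Y.om i)⁻¹ * (HH x0 K).Y.om j) (z, 0) (z * (kpj j / kpj i), 0) := by
  have h1 := TP_om (x0 := x0) (K := K) j hz
  have h2 := TP_om (x0 := x0) (K := K) i (z := z * (kpj j / kpj i)) (by
    rw [mul_pow, div_pow, hz, kap6, kap6, div_self (div_ne_zero t1_ne t3_ne), mul_one])
  rw [mul_assoc, div_mul_cancel₀ _ (kap_ne i)] at h2
  exact h1.mul h2.inv
theorem kap_log (j) : kpj j = exp ((log (sW j / t3) - log (sW j / t1)) / 6) := by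
  rw [kpj, rt, rt, ← exp_sub]; congr 1; ring
theorem log4 {x : ℂ} (hx : x ≠ 0) : log (4 * x) = Real.log 4 + log x := by
  have := log_ofReal_mul (r := 4) (by norm_num) hx
  exact_mod_cast this
theorem kap_sc (i j) (h : sW j = 4 * sW i) : kpj j = kpj i := by
  rw [kap_log, kap_log, h, mul_div_assoc, mul_div_assoc, log4 (div_ne_zero (sW_ne _) t3_ne),
    log4 (div_ne_zero (sW_ne _) t1_ne)]
  congr 1; ring
theorem kap1 : kpj 1 = kpj 0 := kap_sc _ _ (by apply Complex.ext <;> norm_num [sW2, sW3, sW])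
theorem kap3 : kpj 3 = kpj 2 := kap_sc _ _ (by rw [sW3, sW2]; apply Complex.ext <;> norm_num)
theorem kap20 : kpj 2 / kpj 0 = om6 := by
  have e : ∀ (x y q : ℂ) (r : ℝ), y ≠ 0 → x = r * q * y → x / y = r * q := fun x y q r h e => by
    rw [e, mul_div_assoc, div_self h, mul_one]
  have a1 : sW 0 / t3 = ((1/4 : ℝ):ℂ) * I := e _ _ _ _ t3_ne (by apply Complex.ext <;> norm_num [sW2, sW, t3])
  have a2 : sW 0 / t1 = ((1/2 : ℝ):ℂ) * -I := e _ _ _ _ t1_ne (by apply Complex.ext <;> norm_num [sW2, sW, t1])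
  have a3 : sW 2 / t3 = ((1/4 : ℝ):ℂ) * -I := e _ _ _ _ t3_ne (by rw [sW2]; apply Complex.ext <;> norm_num [t3])
  have a4 : sW 2 / t1 = ((1/2 : ℝ):ℂ) * I := e _ _ _ _ t1_ne (by rw [sW2]; apply Complex.ext <;> norm_num [t1])
  rw [kap_log, kap_log, a1, a2, a3, a4, ← exp_sub, log_ofReal_mul (by norm_num) I_ne_zero,
    log_ofReal_mul (by norm_num) (neg_ne_zero.2 I_ne_zero), log_ofReal_mul (by norm_num) I_ne_zero,
    log_ofReal_mul (by norm_num) (neg_ne_zero.2 I_ne_zero), log_I, log_neg_I, om6]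
  congr 1; ring

noncomputable def kL (β : ℂ) : ℂ := 2 * β / rt (8 * β / t3) ^ 2
theorem L3_main {ε β : ℂ} (hε : ε = 1 ∨ ε = -1) (hβ : ε * β ^ 2 = -1) (hD : 8 * β ∈ D3) (ha : adm ε β) :
    (HH x0 K).L3 ε β * (HH x0 K).L3 ε β = 1 ∧ ((HH x0 K).L3 ε β).2 = 1 ∧ kL β ^ 6 = t3 ^ 2 ∧
    ∀ z, z ^ 6 = t3 → TP x0 K ((HH x0 K).L3 ε β) (z, 0) (0, kL β / z) := by
  have bbe : bb ε β = 8 * β := by unfold bb; linear_combination -2 * β * hβ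
  have b0 : β ≠ 0 := by rintro rfl; norm_num at hβ
  have b4 : β ^ 4 = 1 := by
    have : ε ^ 2 = 1 := by rcases hε with rfl | rfl <;> norm_num
    linear_combination (ε * β ^ 2 - 1) * hβ - β ^ 4 * this
  have n3 := t3_ne
  have r6 := rt6 (x := 8 * β / t3) (div_ne_zero (mul_ne_zero (by norm_num) b0) n3)
  have r0 := rt_ne (8 * β / t3)
  have k6 : kL β ^ 6 = t3 ^ 2 := by
    rw [kL, div_pow, ← pow_mul, mul_comm 2 6, pow_mul, r6]
    field_simp
    linear_combination 64 * b4
  rw [Hol.L3, bbe]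
  refine ⟨?_, ?_, k6, fun z hz => ?_⟩
  · obtain ⟨z, hz⟩ := IsAlgClosed.exists_pow_nat_eq (8 * β) (n := 6) (by norm_num)
    have := (Lam_main (x0 := x0) (K := K) hε hβ hz ha).1
    generalize (HH x0 K).Lam ε β = L at *
    generalize (HH x0 K).Y.th3 (8 * β) = R at *
    calc _ = R⁻¹ * (L * L) * R := by group
      _ = 1 := by rw [this]; group
  · have : ((HH x0 K).Lam ε β).2 = 1 := by
      obtain ⟨δ, δ0, hg⟩ := ha.good
      have hg := hg β (Metric.mem_ball_self δ0)
      rw [(HH x0 K).Lam_eq hε hg δ0 le_rfl, Hol.Leta]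
      have : ∀ a b, ((HH x0 K).hs (fun w => Ew ε (w, β)) a b).2 = 1 := fun a b => by
        refine K.const' (bb ε β) ?_
        rw [bbe]; exact D3_sub hD
      rw [Prod.snd_mul, this, this, one_mul]
    rw [Prod.snd_mul, Prod.snd_mul, this, Prod.snd_inv, mul_one, inv_mul_cancel]
  · have z0 : z ≠ 0 := by rintro rfl; exact n3 (by rw [← hz]; norm_num)
    have h1 := TP_th3 (x0 := x0) (K := K) hD hz
    have h2 := (Lam_main (x0 := x0) (K := K) hε hβ (z := z * rt (8 * β / t3)) (by
      rw [mul_pow, hz, r6]; field_simp) ha).2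
    have h3 := (TP_th3 (x0 := x0) (K := K) hD (z := kL β / z) (by
      rw [div_pow, k6, hz]; field_simp)).sw
    have e : kL β / z * rt (8 * β / t3) = 2 * β / (z * rt (8 * β / t3)) := by
      rw [kL]; field_simp
    rw [e] at h3
    rw [mul_assoc]
    exact (h1.mul h2).mul h3.inv

theorem kk_rel : kL (-1) / kL (-I) = om6 := by
  have hm : 8 * (-I) / t3 = I * (8 * -1 / t3) := by ring
  have n0 : (8 * -1 / t3 : ℂ) ≠ 0 := div_ne_zero (by norm_num) t3_ne
  have hl : log (8 * (-I) / t3) = Real.pi / 2 * I + log (8 * -1 / t3) := by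
    rw [hm, (log_mul_eq_add_log_iff I_ne_zero n0).2, log_I]
    have e : (8 * -1 / t3 : ℂ) = ⟨1/2, -1/2⟩ := by
      rw [div_eq_iff t3_ne]; apply Complex.ext <;> norm_num [t3]
    have := abs_lt.1 (abs_arg_lt_pi_div_two_iff.2 (Or.inl (by rw [e]; norm_num : 0 < (8 * -1 / t3 : ℂ).re)))
    rw [arg_I]
    constructor <;> linarith [Real.pi_pos]
  have e1 : rt (8 * (-I) / t3) = exp (Real.pi / 12 * I) * rt (8 * -1 / t3) := by
    rw [rt, rt, hl, ← exp_add]; congr 1; ring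
  have e2 : om6 = -I * exp (Real.pi / 12 * I) ^ 2 := by
    have : -I = exp (-(Real.pi / 2 : ℂ) * I) := by
      rw [← log_neg_I, exp_log (by simp)]
    rw [this, om6, ← exp_nat_mul, ← exp_add]; congr 1; push_cast; ring
  have r0 := rt_ne (8 * -1 / t3)
  have x0 := exp_ne_zero (Real.pi / 12 * I : ℂ)
  have := I_ne_zero
  rw [e2, kL, kL, e1]
  generalize exp (Real.pi / 12 * I : ℂ) = x at *
  generalize rt (8 * -1 / t3) = y at *
  field_simp
  rw [I_sq]; norm_num
theorem om6_zpow {k : ℤ} (h : om6 ^ k = 1) : (6:ℤ) ∣ k := by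
  rw [om6, ← exp_int_mul, exp_eq_one_iff] at h
  obtain ⟨n, hn⟩ := h
  have h2 : ((k:ℂ) + 6 * n) * (Real.pi * I) = 0 := by linear_combination -3 * hn
  have h3 : (k:ℂ) + 6 * n = 0 :=
    (mul_eq_zero.1 h2).resolve_right (mul_ne_zero (by exact_mod_cast Real.pi_ne_zero) I_ne_zero)
  have h4 : k + 6 * n = 0 := by exact_mod_cast h3
  exact ⟨-n, by linarith⟩
theorem om6_6 : om6 ^ 6 = 1 := by
  rw [om6, ← exp_nat_mul, exp_eq_one_iff]
  exact ⟨-1, by push_cast; ring⟩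

theorem eA_main : (HH x0 K).eA * (HH x0 K).eA = 1 ∧ ((HH x0 K).eA).2 = 1 ∧ kL (-1) ^ 6 = t3 ^ 2 ∧
    ∀ z, z ^ 6 = t3 → TP x0 K ((HH x0 K).eA) (z, 0) (0, kL (-1) / z) := by
  have e : (-1 : ℂ) = ⟨-1, 0⟩ := by apply Complex.ext <;> simp
  have d3 : ∀ z : ℂ, z.re < 0 ∨ z.im < 0 → z ∈ Ys := fun z h => D3_sub h
  have a1 : adm (-1) ⟨-1, 0⟩ := admm (d3 _ (by rw [bbm_re, bbm_im]; norm_num)) (by simp)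
  have := L3_main (x0 := x0) (K := K) (ε := -1) (β := -1) (Or.inr rfl) (by norm_num) (by simp [D3])
    (by rw [e]; rw [e] at a1; exact a1)
  have e2 : (HH x0 K).eA = (HH x0 K).L3 (-1) (-1) := by rw [Hol.eA]; congr 1; exact e.symm
  rw [e2]; exact this
theorem eB_main : (HH x0 K).eB * (HH x0 K).eB = 1 ∧ ((HH x0 K).eB).2 = 1 ∧ kL (-I) ^ 6 = t3 ^ 2 ∧
    ∀ z, z ^ 6 = t3 → TP x0 K ((HH x0 K).eB) (z, 0) (0, kL (-I) / z) := by
  have e : (-I : ℂ) = ⟨0, -1⟩ := by apply Complex.ext <;> simp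
  have d3 : ∀ z : ℂ, z.re < 0 ∨ z.im < 0 → z ∈ Ys := fun z h => D3_sub h
  have a2 : adm 1 ⟨0, -1⟩ := adm1 (d3 _ (by rw [bb1_re, bb1_im]; norm_num)) (by simp)
  have := L3_main (x0 := x0) (K := K) (ε := 1) (β := -I) (Or.inl rfl) (by simp) (by simp [D3])
    (by rw [e]; exact a2)
  have e2 : (HH x0 K).eB = (HH x0 K).L3 1 (-I) := by rw [Hol.eB]; congr 1; exact e.symm
  rw [e2]; exact this
theorem AB_main {z : ℂ} (hz : z ^ 6 = t3) :
    TP x0 K ((HH x0 K).eA * (HH x0 K).eB) (z, 0) (z * om6, 0) := by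
  have n3 := t3_ne
  have z0 : z ≠ 0 := by rintro rfl; exact n3 (by rw [← hz]; norm_num)
  obtain ⟨-, -, k6, h1⟩ := eB_main (x0 := x0) (K := K)
  have h2 := (((eA_main (x0 := x0) (K := K)).2.2.2) (kL (-I) / z) (by
    rw [div_pow, k6, hz]; field_simp)).sw
  have h0 : kL (-I) ≠ 0 := div_ne_zero (by simp) (pow_ne_zero _ (rt_ne _))
  have e : kL (-1) / (kL (-I) / z) = z * om6 := by rw [← kk_rel]; field_simp
  rw [e] at h2
  exact (h1 z hz).mul h2
end

open Cov (ok i0 i1)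

abbrev U1 : Set (ℂ × ℂ) := qp ⁻¹' Ms
theorem U1_open : IsOpen U1 := isOpen_Ms.preimage cont_qp
theorem UU_open : IsOpen UU := by
  have : UU = f ⁻¹' Ys := by ext p; exact mem_UU
  rw [this]; exact isOpen_Ys.preimage cont_f
theorem fin_line {p : ℂ × ℂ} (hp : p ∈ U1) (v : ℂ × ℂ) : {l : ℂ | p + l • v ∉ U1}.Finite := by
  let a : Polynomial ℂ := .C p.1 + .C v.1 * .X
  let b : Polynomial ℂ := .C p.2 + .C v.2 * .X
  let F : Polynomial ℂ := a ^ 6 + b ^ 6 + .C 6 * a * b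
  let R : Polynomial ℂ := F * (F - .C 4) * (F - .C (4 * I)) * (a ^ 6 - b ^ 6)
  have key : ∀ l : ℂ, p + l • v ∈ U1 ↔ R.eval l ≠ 0 := fun l => by
    rw [mem_preimage, qp_iff, mem_UU]
    have e1 : a.eval l = (p + l • v).1 := by simp [a]; ring
    have e2 : b.eval l = (p + l • v).2 := by simp [b]; ring
    have e3 : F.eval l = f (p + l • v) := by
      simp only [F, f, Polynomial.eval_add, Polynomial.eval_mul, Polynomial.eval_pow, e1, e2, Polynomial.eval_C]
    simp only [R, Polynomial.eval_sub, Polynomial.eval_mul, Polynomial.eval_pow, e1, e2, e3,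
      Polynomial.eval_C, mul_ne_zero_iff, sub_ne_zero, Ys, mem_ofPred_eq]
    tauto
  have h0 : R ≠ 0 := fun h => by
    have := (key 0).1 (by simpa using hp)
    rw [h] at this; simp at this
  refine (Polynomial.finite_setOf_isRoot h0).subset fun l hl => ?_
  by_contra hc
  exact hl ((key l).2 hc)
theorem join_U1 {C : Set (ℂ × ℂ)} (hC : Convex ℝ C) (hCo : IsOpen C) {p q : ℂ × ℂ}
    (hp : p ∈ C) (hp' : p ∈ U1) (hq : q ∈ C) (hq' : q ∈ U1) : JoinedIn (C ∩ U1) p q := by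
  set L : ℂ → ℂ × ℂ := fun l => p + l • (q - p) with hL
  have cL : Continuous L := by rw [hL]; fun_prop
  have hcv : Convex ℝ (L ⁻¹' C) := by
    intro x hx y hy a b ha hb hab
    have : L (a • x + b • y) = a • L x + b • L y := by
      obtain rfl : a = 1 - b := by linarith
      ext <;> simp [hL] <;> ring
    rw [mem_preimage, this]; exact hC hx hy ha hb hab
  have hF := fin_line hp' (q - p)
  obtain ⟨m, h1, h2⟩ := two_seg hcv (hCo.preimage cL) hF (p := 0) (q := 1) (by simp [hL, hp]; exact hp')
    (by simp [hL, hq]; exact hq')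
  have := ((JoinedIn.of_segment_subset h1).trans (JoinedIn.of_segment_subset h2)).map (f := L) cL
  have h3 : L '' (L ⁻¹' C \ {l : ℂ | p + l • (q - p) ∉ U1}) ⊆ C ∩ U1 := by
    rintro _ ⟨l, hl, rfl⟩
    exact ⟨hl.1, not_not.1 hl.2⟩
  simpa [hL] using this.mono h3
noncomputable def z0 : ℂ := (IsAlgClosed.exists_pow_nat_eq t3 (n := 6) (by norm_num)).choose
theorem z06 : z0 ^ 6 = t3 := (IsAlgClosed.exists_pow_nat_eq t3 (n := 6) (by norm_num)).choose_spec
theorem z0_ne : z0 ≠ 0 := fun h => t3_ne (by rw [← z06, h]; norm_num)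
theorem qP0 : qp (z0, 0) = (0, t3) := by simp [qp, f, z06]
theorem P0_mem : ((z0, 0) : ℂ × ℂ) ∈ U1 := by
  rw [mem_preimage, qP0]; exact i_mem (D3_sub t3_mem)
theorem U1_pc : IsPathConnected U1 :=
  ⟨_, P0_mem, fun {q} hq => by
    have := join_U1 convex_univ isOpen_univ (mem_univ _) P0_mem (mem_univ q) hq
    exact this.mono inter_subset_right⟩
theorem U1_dense (p : ℂ × ℂ) {V : Set (ℂ × ℂ)} (hV : IsOpen V) (hp : p ∈ V) : ∃ q ∈ V, q ∈ U1 := by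
  set L : ℂ → ℂ × ℂ := fun l => (z0, 0) + l • (p - (z0, 0)) with hL
  have cL : Continuous L := by rw [hL]; fun_prop
  have hd := (fin_line P0_mem (p - (z0, 0))).countable.dense_compl ℂ
  obtain ⟨l, hl, hl'⟩ := hd.inter_open_nonempty _ (hV.preimage cL) ⟨1, by simpa [hL] using hp⟩
  exact ⟨L l, hl, not_not.1 hl'⟩
theorem qU' : U1 ⊆ UU := fun _ hp => (qp_iff.1 hp).1
theorem UU_pc : IsPathConnected UU := by
  refine ⟨_, qU' P0_mem, fun {q} hq => ?_⟩
  obtain ⟨ρ, ρ0, hb⟩ := Metric.isOpen_iff.1 UU_open q hq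
  obtain ⟨q', h1, h2⟩ := U1_dense q Metric.isOpen_ball (Metric.mem_ball_self ρ0)
  refine ((U1_pc.joinedIn _ P0_mem _ h2).mono qU').trans (JoinedIn.of_segment_subset ?_)
  exact ((convex_ball q ρ).segment_subset h1 (Metric.mem_ball_self ρ0)).trans hb
instance : PathConnectedSpace UU := isPathConnected_iff_pathConnectedSpace.1 UU_pc

section
variable {E : Type*} [NormedAddCommGroup E] [NormedSpace ℝ E] {X : Set E} {G : Type*} [Group G]
  (H : Hol E X G)
theorem concat {c d : ℝ → E} (hc : Continuous c) (hd : Continuous d) (h : c 1 = d 0) (hcX : ∀ r, c r ∈ X)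
    (hdX : ∀ r, d r ∈ X) {Y : Set E} (hcY : ∀ r, c r ∈ Y) (hdY : ∀ r, d r ∈ Y) :
    ∃ e : ℝ → E, Continuous e ∧ (∀ r, e r ∈ Y) ∧ e 0 = c 0 ∧ e 1 = d 1 ∧ H.h e = H.h d * H.h c := by
  set e : ℝ → E := fun r => if r ≤ 1/2 then c (2 * r) else d (2 * r - 1) with he
  have ce : Continuous e := by
    refine Continuous.if_le (by fun_prop) (by fun_prop) (by fun_prop) (by fun_prop) ?_
    rintro x rfl; norm_num [h]
  have e1 : ∀ r ≤ 1/2, e r = c (2 * r) := fun r hr => if_pos hr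
  have e2 : ∀ r ≥ 1/2, e r = d (2 * r - 1) := fun r hr => by
    rcases hr.eq_or_lt with rfl | hr
    · rw [e1 _ le_rfl]; norm_num [h]
    · exact if_neg (by linarith)
  have eX : ∀ r, e r ∈ X := fun r => by simp only [he]; split_ifs <;> simp [*]
  refine ⟨e, ce, fun r => by simp only [he]; split_ifs <;> simp [*], by rw [e1 0 (by norm_num)]; simp,
    by rw [e2 1 (by norm_num)]; norm_num, ?_⟩
  rw [H.h_eq_hs e, ← H.tri convex_univ ce.continuousOn (fun r _ => eX r) (mem_univ 0) (mem_univ (1/2)) (mem_univ 1)]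
  congr 1
  · refine H.congr' _ _ fun r hr => ?_
    simp only [smul_eq_mul]
    rw [e2 _ (by linarith [hr.1])]; congr 1; ring
  · refine H.congr' _ _ fun r hr => ?_
    simp only [smul_eq_mul]
    rw [e1 _ (by linarith [hr.2])]; congr 1; ring
theorem revp {c : ℝ → E} (hc : Continuous c) (hcX : ∀ r, c r ∈ X) : H.h (fun r => c (1 - r)) = (H.h c)⁻¹ := by
  rw [H.h_eq_hs c, ← H.hs_inv convex_univ hc.continuousOn (fun r _ => hcX r) (mem_univ 0) (mem_univ 1)]
  refine H.congr' _ _ fun r hr => ?_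
  congr 1; simp; ring
end

/-- from `U1` to `UU` -/
theorem ext_gen {G : Type*} [Group G] (K : Hol (ℂ × ℂ) UU G) (S : Subgroup G)
    (hS : ∀ c : ℝ → ℂ × ℂ, Continuous c → (∀ r, c r ∈ U1) → c 0 = (z0, 0) → c 1 = (z0, 0) → K.h c ∈ S)
    {γ : ℝ → ℂ × ℂ} (hγ : ok UU γ) (h0 : γ 0 = (z0, 0)) (h1 : γ 1 = (z0, 0)) : K.h γ ∈ S := by
  have hc : ∀ x, ∃ c : ℝ → ℂ × ℂ, x ∈ U1 → Continuous c ∧ (∀ r, c r ∈ U1) ∧ c 0 = (z0, 0) ∧ c 1 = x := by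
    intro x
    by_cases hx : x ∈ U1
    · obtain ⟨c, h⟩ := path_ex (U1_pc.joinedIn _ P0_mem _ hx)
      exact ⟨c, fun _ => h⟩
    · exact ⟨fun _ => 0, fun h => absurd h hx⟩
  choose c hc using hc
  have hn : ∀ p ∈ U1, ∀ q ∈ U1, ∀ d : ℝ → ℂ × ℂ, Continuous d → (∀ r, d r ∈ U1) → d 0 = p → d 1 = q →
      (K.h (c q))⁻¹ * K.h d * K.h (c p) ∈ S := by
    intro p hp q hq d hd hdU d0 d1
    obtain ⟨a1, a2, a3, a4⟩ := hc p hp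
    obtain ⟨b1, b2, b3, b4⟩ := hc q hq
    obtain ⟨e, e1, e2, e3, e4, e5⟩ := concat K a1 hd (a4.trans d0.symm) (fun r => qU (a2 r))
      (fun r => qU (hdU r)) a2 hdU
    obtain ⟨g, g1, g2, g3, g4, g5⟩ := concat K e1 (d := fun r => c q (1 - r)) (by fun_prop)
      (by simp [e4, d1, b4]) (fun r => qU (e2 r)) (fun r => qU (b2 _)) e2 (fun r => b2 _)
    rw [mul_assoc, ← e5, ← revp K b1 (fun r => qU (b2 r)), ← g5]
    exact hS g g1 g2 (by rw [g3, e3, a3]) (by rw [g4]; simp [b3])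
  have hball : ∀ x, ∃ ρ > 0, ∃ y, x ∈ UU → Metric.ball x ρ ⊆ UU ∧ y ∈ Metric.ball x ρ ∧ y ∈ U1 := by
    intro x
    by_cases hx : x ∈ UU
    · obtain ⟨ρ, ρ0, hb⟩ := Metric.isOpen_iff.1 UU_open x hx
      obtain ⟨q', h1, h2⟩ := U1_dense x Metric.isOpen_ball (Metric.mem_ball_self ρ0)
      exact ⟨ρ, ρ0, q', fun _ => ⟨hb, h1, h2⟩⟩
    · exact ⟨1, one_pos, x, fun h => absurd h hx⟩
  choose ρ ρ0 y hb using hball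
  set g : ℂ × ℂ → G := fun p => K.hs id (y p) p * K.h (c (y p)) with hg
  have key : ∀ p ∈ UU, ∀ q ∈ Metric.ball p (ρ p), q ∈ U1 → (K.h (c q))⁻¹ * K.hs id p q * g p ∈ S := by
    intro p hp q hq hq'
    obtain ⟨b1, b2, b3⟩ := hb p hp
    obtain ⟨d, d1, d2, d3, d4⟩ := path_ex (join_U1 (convex_ball p (ρ p)) Metric.isOpen_ball b2 b3 hq hq')
    have := hn _ b3 _ hq' d d1 (fun r => (d2 r).2) d3 d4
    rw [K.h_eq_hs d, K.path_convex (convex_ball p (ρ p)) b1 d1.continuousOn (fun r _ => (d2 r).1), d3, d4] at this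
    rw [← K.tri (convex_ball p (ρ p)) continuousOn_id b1 b2 (Metric.mem_ball_self (ρ0 p)) hq] at this
    convert this using 1
    simp only [hg]; group
  have := K.local_to_global UU_open S g (fun p hp => ?_) hγ.1 hγ.2
  · rw [h0, h1] at this
    have k := key _ (qU P0_mem) _ (Metric.mem_ball_self (ρ0 _)) P0_mem
    rw [K.hs_self (F := id) (qU P0_mem), mul_one] at k
    have k2 : K.h (c (z0, 0)) ∈ S := by
      obtain ⟨a1, a2, a3, a4⟩ := hc _ P0_mem
      exact hS _ a1 a2 a3 a4
    have k3 : g (z0, 0) ∈ S := by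
      have := S.mul_mem k2 k
      rwa [mul_inv_cancel_left] at this
    have := S.mul_mem (S.mul_mem k3 this) (S.inv_mem k3)
    convert this using 1; group
  · filter_upwards [Metric.ball_mem_nhds p (ρ0 p)] with p' hp'
    obtain ⟨b1, -, -⟩ := hb p hp
    obtain ⟨q, ⟨q1, q2⟩, q3⟩ := U1_dense p' (Metric.isOpen_ball.inter Metric.isOpen_ball)
      ⟨hp', Metric.mem_ball_self (ρ0 p')⟩
    have k1 := key p hp q q1 q3
    have k2 := key p' (b1 hp') q q2 q3
    rw [← K.tri (convex_ball p (ρ p)) continuousOn_id b1 (Metric.mem_ball_self (ρ0 p)) hp' q1] at k1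
    have := S.mul_mem (S.inv_mem k2) k1
    convert this using 1; group

open Cov (ok i0 i1)

theorem nf {G : Type*} [Group G] {A B : G} (hA : A * A = 1) (hB : B * B = 1) {T : Set G}
    (hT : ∀ c ∈ T, Commute c A ∧ Commute c B) {x : G} (hx : x ∈ Subgroup.closure ({A, B} ∪ T)) :
    ∃ k : ℤ, ∃ c ∈ Subgroup.closure T, x = (A * B) ^ k * c ∨ x = (A * B) ^ k * A * c := by
  have hA' : A⁻¹ = A := inv_eq_of_mul_eq_one_left hA
  have hB' : B⁻¹ = B := inv_eq_of_mul_eq_one_left hB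
  have hsw : ∀ k : ℤ, A * (A * B) ^ k = (A * B) ^ (-k) * A := fun k => by
    have h : A * (A * B) * A⁻¹ = (A * B)⁻¹ := by
      rw [mul_inv_rev, hA', hB', ← mul_assoc A A, hA, one_mul]
    rw [zpow_neg, ← inv_zpow, ← h, conj_zpow, inv_mul_cancel_right]
  have stepA : ∀ y, (∃ k : ℤ, ∃ c ∈ Subgroup.closure T, y = (A * B) ^ k * c ∨ y = (A * B) ^ k * A * c) →
      ∃ k : ℤ, ∃ c ∈ Subgroup.closure T, A * y = (A * B) ^ k * c ∨ A * y = (A * B) ^ k * A * c := by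
    rintro y ⟨k, c, hc, rfl | rfl⟩
    · exact ⟨-k, c, hc, .inr (by rw [← hsw, mul_assoc])⟩
    · exact ⟨-k, c, hc, .inl (by rw [← mul_assoc, ← mul_assoc, hsw, mul_assoc _ A A, hA, mul_one])⟩
  have stepB : ∀ y, (∃ k : ℤ, ∃ c ∈ Subgroup.closure T, y = (A * B) ^ k * c ∨ y = (A * B) ^ k * A * c) →
      ∃ k : ℤ, ∃ c ∈ Subgroup.closure T, B * y = (A * B) ^ k * c ∨ B * y = (A * B) ^ k * A * c := by
    intro y hy
    have e : B * y = (A * B) ^ (-1 : ℤ) * (A * y) := by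
      rw [zpow_neg_one, mul_inv_rev, hA', hB', mul_assoc, ← mul_assoc A A, hA, one_mul]
    obtain ⟨k, c, hc, h | h⟩ := stepA y hy
    · exact ⟨-1 + k, c, hc, .inl (by rw [e, h, zpow_add, mul_assoc])⟩
    · exact ⟨-1 + k, c, hc, .inr (by rw [e, h, zpow_add]; simp only [mul_assoc])⟩
  have stepT : ∀ t ∈ Subgroup.closure T, Commute t A → Commute t B → ∀ y, (∃ k : ℤ, ∃ c ∈ Subgroup.closure T, y = (A * B) ^ k * c ∨ y = (A * B) ^ k * A * c) →
      ∃ k : ℤ, ∃ c ∈ Subgroup.closure T, t * y = (A * B) ^ k * c ∨ t * y = (A * B) ^ k * A * c := by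
    rintro t ht tA tB y ⟨k, c, hc, rfl | rfl⟩
    · exact ⟨k, t * c, mul_mem ht hc, .inl (by rw [← mul_assoc, ((tA.mul_right tB).zpow_right k).eq, mul_assoc])⟩
    · exact ⟨k, t * c, mul_mem ht hc, .inr (by
        rw [← mul_assoc, (((tA.mul_right tB).zpow_right k).mul_right tA).eq, mul_assoc])⟩
  induction hx using Subgroup.closure_induction_left with
  | one => exact ⟨0, 1, one_mem _, .inl (by simp)⟩
  | mul_left t ht y _ ih =>
    rcases ht with (rfl | rfl) | ht
    · exact stepA _ ih
    · exact stepB _ ih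
    · exact stepT _ (Subgroup.subset_closure ht) (hT t ht).1 (hT t ht).2 _ ih
  | inv_mul_cancel t ht y _ ih =>
    rcases ht with (rfl | rfl) | ht
    · rw [hA']; exact stepA _ ih
    · rw [hB']; exact stepB _ ih
    · exact stepT _ (inv_mem (Subgroup.subset_closure ht)) (hT t ht).1.inv_left (hT t ht).2.inv_left _ ih

noncomputable def xx : UU := ⟨(z0, 0), qU P0_mem⟩

theorem TP_zpow {K : Hol ℂ Ys (Equiv.Perm (F3 × Unit))} {c : GG xx} {w : ℂ} (hw : w ^ 6 = 1)
    (h : ∀ z, z ^ 6 = t3 → TP xx K c (z, 0) (z * w, 0)) {z : ℂ} (hz : z ^ 6 = t3) (k : ℤ) :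
    TP xx K (c ^ k) (z, 0) (z * w ^ k, 0) := by
  have w0 : w ≠ 0 := by rintro rfl; norm_num at hw
  have h6 : ∀ k : ℤ, (z * w ^ k) ^ 6 = t3 := fun k => by
    rw [mul_pow, hz, ← zpow_natCast, ← zpow_mul, mul_comm k, zpow_mul, zpow_natCast, hw, one_zpow, mul_one]
  have one : TP xx K 1 (z, 0) (z, 0) := by
    have := (h z hz).mul (h z hz).inv
    rwa [inv_mul_cancel] at this
  induction k using Int.induction_on with
  | zero => simpa using one
  | succ k ih =>
    have := ih.mul (h _ (h6 k))
    rwa [← zpow_one_add, mul_assoc, ← zpow_add_one₀ w0, add_comm 1] at this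
  | pred k ih =>
    have e : z * w ^ (-(k:ℤ)) = z * w ^ (-(k:ℤ) - 1) * w := by
      rw [mul_assoc, ← zpow_add_one₀ w0, sub_add_cancel]
    have h1 := h _ (h6 (-(k:ℤ) - 1))
    rw [← e] at h1
    have := ih.mul h1.inv
    rwa [← zpow_neg_one, ← zpow_add, neg_add_eq_sub] at this

theorem main_xx : Nonempty (FundamentalGroup UU xx ≃* FreeGroup (Fin 3)) := by
  obtain ⟨K, hK⟩ := exists_hF
  set H := HH xx K with hH
  obtain ⟨hA, hA2, kA6, hA3⟩ := eA_main (x0 := xx) (K := K)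
  obtain ⟨hB, hB2, -, -⟩ := eB_main (x0 := xx) (K := K)
  obtain ⟨hbu, har, hAB6, hcom⟩ := H.rels hA hB
  set A := H.eA
  set B := H.eB
  set om := H.Y.om
  have om2 : ∀ j, (om j).2 = K.om j := fun j => rfl
  have hz := z06
  -- the three generators
  let c : Fin 3 → GG xx := ![(om 0)⁻¹ * om 1, (A * B)⁻¹ * ((om 0)⁻¹ * om 2), (om 2)⁻¹ * om 3]
  have c0 : c 0 = (om 0)⁻¹ * om 1 := rfl
  have c1 : c 1 = (A * B)⁻¹ * ((om 0)⁻¹ * om 2) := rfl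
  have c2 : c 2 = (om 2)⁻¹ * om 3 := rfl
  have cTP : ∀ i, TP xx K (c i) (z0, 0) (z0, 0) := by
    intro i
    fin_cases i
    · have := TP_omom (x0 := xx) (K := K) 0 1 hz
      rw [kap1, div_self (kap_ne 0), mul_one] at this
      exact this
    · have := TP_omom (x0 := xx) (K := K) 0 2 hz
      rw [kap20] at this
      exact this.mul (AB_main hz).inv
    · have := TP_omom (x0 := xx) (K := K) 2 3 hz
      rw [kap3, div_self (kap_ne 2), mul_one] at this
      exact this
  choose e he using fun i => (cTP i).Tr
  have ccom : ∀ t ∈ range c, Commute t A ∧ Commute t B := by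
    rintro _ ⟨i, rfl⟩
    refine hcom _ ?_
    fin_cases i
    · exact .inr (.inl rfl)
    · exact .inl rfl
    · exact .inr (.inr rfl)
  have hcl : ∀ t ∈ Subgroup.closure (range c), ∃ d ∈ Subgroup.closure (range e), Tr xx K t (z0, 0) (z0, 0) d := by
    intro t ht
    induction ht using Subgroup.closure_induction with
    | mem t ht =>
      obtain ⟨i, rfl⟩ := ht
      exact ⟨e i, Subgroup.subset_closure ⟨i, rfl⟩, he i⟩
    | one => 
      have := (he 0).mul (he 0).inv
      rw [inv_mul_cancel, inv_mul_cancel] at this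
      exact ⟨1, one_mem _, this⟩
    | mul a b _ _ ha hb =>
      obtain ⟨a', h1, h2⟩ := ha
      obtain ⟨b', h3, h4⟩ := hb
      exact ⟨a' * b', mul_mem h1 h3, h4.mul h2⟩
    | inv a _ ha =>
      obtain ⟨a', h1, h2⟩ := ha
      exact ⟨_, inv_mem h1, h2.inv⟩
  set S := Subgroup.closure ({A, B} ∪ range c) with hS
  have SA : A ∈ S := Subgroup.subset_closure (by simp)
  have SB : B ∈ S := Subgroup.subset_closure (by simp)
  have Sc : ∀ i, c i ∈ S := fun i => Subgroup.subset_closure (.inr ⟨i, rfl⟩)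
  have S2 : (om 0)⁻¹ * om 2 ∈ S := by
    have := mul_mem (mul_mem SA SB) (Sc 1)
    rwa [c1, mul_inv_cancel_left] at this
  obtain ⟨g, hg1, hg2⟩ := H.gen (S := S) (fun j => by
      fin_cases j
      · have := one_mem S
        rwa [← inv_mul_cancel (om 0)] at this
      · exact Sc 0
      · exact S2
      · have := mul_mem S2 (Sc 2)
        rwa [c2, mul_assoc, mul_inv_cancel_left] at this) SA SB
    (by rw [hbu]; exact mul_mem (mul_mem SA SB) SA) (by rw [har]; exact mul_mem (mul_mem SB SA) SB)
  have gP : g (qp (z0, 0)) = 1 := by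
    rw [qP0, hg1 _ (D3_sub t3_mem), H.Y.gY3 t3_mem, H.Y.th3_t3]
  have hP : qp (z0, 0) ∈ Ms := P0_mem
  -- loops
  have loops : ∀ γ : ℝ → ℂ × ℂ, Continuous γ → (∀ r, γ r ∈ U1) → γ 0 = (z0, 0) → γ 1 = (z0, 0) →
      (hUo xx).h γ ∈ Subgroup.closure (range e) := by
    intro γ hγ hm h0 h1
    have hT := Tr.path (x0 := xx) (K := K) (γ := qp ∘ γ) (γ' := γ) hγ.continuousOn (fun r _ => rfl) (fun r _ => hm r)
    have hin := hg2 (qp ∘ γ) (cont_qp.comp hγ).continuousOn (fun r _ => hm r)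
    rw [h0, h1] at hT
    simp only [Function.comp_apply, h0, h1, gP, inv_one, one_mul, mul_one] at hin
    rw [← hH] at hT
    obtain ⟨k, t, ht, hk⟩ := nf hA hB ccom hin
    obtain ⟨d, hd, hd'⟩ := hcl t ht
    have om6z : (z0 * om6 ^ k) ^ 6 = t3 := by
      rw [mul_pow, hz, ← zpow_natCast, ← zpow_mul, mul_comm k, zpow_mul, zpow_natCast]
      simp [om6_6]
    rcases hk with hk | hk
    · obtain ⟨d2, hd2⟩ := (TP_zpow (K := K) om6_6 (fun z hz => AB_main hz) hz k).Tr
      have h3 := hd'.mul hd2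
      have e3 := h3.1 1
      have e4 := hT.1 1
      rw [hk] at e4
      rw [show H.eA * H.eB = A * B from rfl, e4] at e3
      have e5 := Cq.inj (z := (z0, 0)) (z' := (z0 * om6 ^ k, 0)) (by
        simp [qp, f, om6z, hz]) hP (congrArg Prod.fst e3)
      have e6 : om6 ^ k = 1 := by
        have := congrArg Prod.fst e5
        simpa [z0_ne] using this
      obtain ⟨m, rfl⟩ := om6_zpow e6
      have e7 : (A * B) ^ (6 * m) = 1 := by
        rw [zpow_mul]; 
        rw [show (A * B) ^ (6:ℤ) = 1 from by exact_mod_cast hAB6, one_zpow]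
      rw [e7, one_mul] at hk
      have e8 := hd'.1 1
      rw [← hk, hT.1 1] at e8
      have e9 : (hUo xx).h γ = d := by
        have := congrArg Prod.snd e8
        rw [mul_one, mul_one] at this
        exact this
      rw [e9]; exact hd
    · exfalso
      set y := kL (-1) / z0 with hy
      have y6 : y ^ 6 = t3 := by
        rw [hy, div_pow, kA6, hz, sq, mul_div_cancel_right₀ _ t3_ne]
      have y6k : (y * om6 ^ k) ^ 6 = t3 := by
        rw [mul_pow, y6, ← zpow_natCast, ← zpow_mul, mul_comm k, zpow_mul, zpow_natCast]
        simp [om6_6]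
      obtain ⟨d1, hd1⟩ := (TP_zpow (K := K) om6_6 (fun z hz => AB_main hz) y6 k).sw.Tr
      obtain ⟨d2, hd2⟩ := (hA3 _ hz).Tr
      have e3 := ((hd'.mul hd2).mul hd1).1 1
      have e4 := hT.1 1
      rw [hk] at e4
      rw [show H.eA * H.eB = A * B from rfl, ← mul_assoc, e4] at e3
      have e5 := Cq.inj (z := (z0, 0)) (z' := (0, y * om6 ^ k)) (by
        simp [qp, f, y6k, hz]) hP (congrArg Prod.fst e3)
      exact z0_ne (congrArg Prod.fst e5)
  have top : ∀ x : Ga xx, x ∈ Subgroup.closure (range e) := fun x => by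
    obtain ⟨γ, h1, h2, h3, rfl⟩ := hU_surj xx x
    exact ext_gen _ _ loops h1 h2 h3
  let L : FreeGroup (Fin 3) →* Ga xx := FreeGroup.lift e
  have Ls : Function.Surjective L := by
    rw [← MonoidHom.range_eq_top, FreeGroup.range_lift_eq_closure]
    exact eq_top_iff.2 fun x _ => top x
  have Li : Function.Injective L := by
    rw [injective_iff_map_eq_one]
    intro w hw
    set n := (KU K).nn xx (z0, 0)
    have key : ∀ i y, (c i).2 y = (FreeGroup.of i * y.1, ()) := by
      have hi : ∀ j y, (K.om j)⁻¹ y = ((kk j)⁻¹ * y.1, ()) := fun j y => by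
        rw [Equiv.Perm.inv_eq_iff_eq, hK]; simp
      have h1 : ∀ i j y, ((om i)⁻¹ * om j).2 y = ((kk i)⁻¹ * kk j * y.1, ()) := fun i j y => by
        rw [Prod.snd_mul, Prod.snd_inv, om2, om2, Equiv.Perm.mul_apply, hK, hi, mul_assoc]
      intro i y
      fin_cases i
      · simp only [Fin.zero_eta, c0, h1]; simp [kk]
      · have : (c 1).2 = ((om 0)⁻¹ * om 2).2 := by
          rw [c1, Prod.snd_mul, Prod.snd_inv, Prod.snd_mul, hA2, hB2, mul_one, inv_one, one_mul]
        simp only [Fin.mk_one, this, h1]; simp [kk]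
      · have : (c 2).2 = ((om 2)⁻¹ * om 3).2 := rfl
        simp only [Fin.reduceFinMk, this, h1]; simp [kk]
    have key2 : ∀ i, (KU K).phi xx (e i) = n⁻¹ * (c i).2 * n := fun i => by
      have := (he i).2
      rw [this, ← mul_assoc, ← mul_assoc, inv_mul_cancel, one_mul, inv_mul_cancel_right]
    have key3 : ∀ w y, (n * (KU K).phi xx (L w) * n⁻¹) y = (w * y.1, ()) := by
      intro w
      induction w using FreeGroup.induction_on with
      | C1 => intro y; rw [map_one, map_one, mul_one, mul_inv_cancel, one_mul]; rfl
      | of i =>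
        intro y
        rw [← key, show L (FreeGroup.of i) = e i from FreeGroup.lift_apply_of .., key2]; congr 1; group
      | inv_of i ih =>
        intro y
        have e : n * (KU K).phi xx (L (FreeGroup.of i)⁻¹) * n⁻¹ = (n * (KU K).phi xx (L (FreeGroup.of i)) * n⁻¹)⁻¹ := by
          rw [map_inv, map_inv, _root_.conj_inv]
        rw [e, Equiv.Perm.inv_eq_iff_eq, ih]
        simp
      | mul a b ha hb =>
        intro y
        have e : n * (KU K).phi xx (L (a * b)) * n⁻¹ =
            (n * (KU K).phi xx (L a) * n⁻¹) * (n * (KU K).phi xx (L b) * n⁻¹) := by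
          rw [map_mul, map_mul, conj_mul]
        rw [e, Equiv.Perm.mul_apply, hb, ha, mul_assoc]
    have := key3 w (1, ())
    rw [hw, map_one, mul_one, mul_inv_cancel] at this
    simpa using (congrArg Prod.fst this).symm
  exact ⟨(MulEquiv.ofBijective L ⟨Li, Ls⟩).symm⟩

end

/-- For `B₀ = {0, 4, 4i}`, the fundamental group of `U_{B₀}` (at any basepoint) is free
of rank 3. -/
theorem stmt14 (x : U ({0, 4, 4 * Complex.I} : Set ℂ)) :
    Nonempty (FundamentalGroup (U ({0, 4, 4 * Complex.I} : Set ℂ)) x ≃* FreeGroup (Fin 3)) := by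
  exact main_xx.map fun e => (FundamentalGroup.fundamentalGroupMulEquivOfPathConnected x xx).trans e
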